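/- arXiv:2404.06840 — 2 statements merged into one kernel-verified Lean document; each statement's English description precedes it below -/
import Mathlib

section
/- Let A be a C*-algebra. The two natural *-homomorphisms q(π_A) and π_{qA} from q²A to qA are homotopic when regarded as homomorphisms into M₂(qA) (via the upper-left corner embedding). -/
/-!
Statement 4 (Lemma 3.4 / `lemma rot`): for a C*-algebra `A`, the two natural
*-homomorphisms `q(π_A)` and `π_{qA}` from `q²A` to `qA` are homotopic as
homomorphisms into `M₂(qA)` (via the upper-left corner embedding).

Setup: `QA = A ⋆ A` with inclusions `ι, ῑ` and identification map `π¹ : QA → A`;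
`qA = ker π¹` (presented abstractly via an embedding `j₁ : qA → QA`);
`π_A : qA → A` is the restriction of `id ⋆ 0 : QA → A`;
`QqA = qA ⋆ qA` with inclusions `η, η̄` and identification `π² : QqA → qA`;
`q²A = ker π²` (presented via `j₂ : q²A → QqA`);
`q(π_A) : q²A → qA` is the restriction of `Q(π_A) = (ι∘π_A) ⋆ (ῑ∘π_A) : QqA → QA`;
`π_{qA} : q²A → qA` is the restriction of `id ⋆ 0 : QqA → qA`.
-/

noncomputable section

/-- A presentation of the free product `Q = A ⋆ A` in the category of C*-algebras. -/
structure QPresentation (A Q : Type) [NonUnitalCStarAlgebra A] [NonUnitalCStarAlgebra Q] where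
  ι : A →⋆ₙₐ[ℂ] Q
  ιbar : A →⋆ₙₐ[ℂ] Q
  free : ∀ (E : Type) [NonUnitalCStarAlgebra E] (f g : A →⋆ₙₐ[ℂ] E),
    ∃! h : Q →⋆ₙₐ[ℂ] E, h.comp ι = f ∧ h.comp ιbar = g

/-- The upper-left corner embedding `b ↦ diag(b, 0)` into `2×2` matrices. -/
def cornerHom (B : Type) [NonUnitalSemiring B] [Module ℂ B] [StarRing B] :
    B →⋆ₙₐ[ℂ] Matrix (Fin 2) (Fin 2) B where
  toFun b := Matrix.of fun i k => if i = 0 ∧ k = 0 then b else 0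
  map_add' x y := by
    ext i k
    simp only [Matrix.of_apply, Matrix.add_apply]
    split_ifs <;> simp
  map_smul' c x := by
    ext i k
    simp only [Matrix.of_apply, Matrix.smul_apply]
    split_ifs <;> simp
  map_zero' := by
    ext i k
    simp
  map_mul' x y := by
    ext i k
    simp only [Matrix.of_apply, Matrix.mul_apply, Fin.sum_univ_two]
    fin_cases i <;> fin_cases k <;> simp
  map_star' x := by
    ext i k
    simp only [Matrix.star_apply, Matrix.of_apply]
    fin_cases i <;> fin_cases k <;> simp

/-- Homotopy of *-homomorphisms: a point-norm continuous path of *-homomorphisms. -/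
def HomHomotopic {X Y : Type} [NonUnitalCStarAlgebra X] [NonUnitalNonAssocSemiring Y]
    [DistribMulAction ℂ Y] [Star Y] [TopologicalSpace Y] (f g : X →⋆ₙₐ[ℂ] Y) : Prop :=
  ∃ H : unitInterval → (X →⋆ₙₐ[ℂ] Y),
    (∀ x : X, Continuous fun t => H t x) ∧ H 0 = f ∧ H 1 = g

theorem QPresentation.hom_ext' {A Q E : Type} [NonUnitalCStarAlgebra A] [NonUnitalCStarAlgebra Q]
    [NonUnitalCStarAlgebra E] (P : QPresentation A Q) (h k : Q →⋆ₙₐ[ℂ] E)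
    (h1 : ∀ a, h (P.ι a) = k (P.ι a)) (h2 : ∀ a, h (P.ιbar a) = k (P.ιbar a)) : h = k := by
  obtain ⟨_, _, hu⟩ := P.free E (k.comp P.ι) (k.comp P.ιbar)
  rw [hu h ⟨NonUnitalStarAlgHom.ext h1, NonUnitalStarAlgHom.ext h2⟩, hu k ⟨rfl, rfl⟩]

theorem QPresentation.exists_lift {A Q E : Type} [NonUnitalCStarAlgebra A]
    [NonUnitalCStarAlgebra Q]
    [NonUnitalCStarAlgebra E] (P : QPresentation A Q) (f g : A →⋆ₙₐ[ℂ] E) :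
    ∃ h : Q →⋆ₙₐ[ℂ] E, (∀ a, h (P.ι a) = f a) ∧ (∀ a, h (P.ιbar a) = g a) := by
  obtain ⟨h, ⟨h1, h2⟩, _⟩ := P.free E f g
  exact ⟨h, fun a => DFunLike.congr_fun h1 a, fun a => DFunLike.congr_fun h2 a⟩

/-- `a ↦ v vᵀ ⊗ φ a` for a path of real unit vectors `v`. -/
def rankHom {A B : Type} [NonUnitalCStarAlgebra A] [NonUnitalCStarAlgebra B]
    [PartialOrder B] [StarOrderedRing B] (φ : A →⋆ₙₐ[ℂ] B) (v : Fin 2 → C(unitInterval, ℝ))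
    (hv : ∀ t, v 0 t * v 0 t + v 1 t * v 1 t = 1) :
    A →⋆ₙₐ[ℂ] C(unitInterval, CStarMatrix (Fin 2) (Fin 2) B) where
  toFun a := ⟨fun t => CStarMatrix.ofMatrix
      (Matrix.of fun i k => ((v i t * v k t : ℝ) : ℂ) • φ a), by
    refine continuous_pi fun i => continuous_pi fun k => ?_
    exact Continuous.smul (by fun_prop) continuous_const⟩
  map_add' x y := by
    ext t i k
    simp
  map_smul' c x := by
    ext t i k
    change ((v i t * v k t : ℝ) : ℂ) • φ (c • x) = c • (((v i t * v k t : ℝ) : ℂ) • φ x)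
    rw [map_smul, smul_comm]
  map_zero' := by
    ext t i k
    simp
  map_mul' x y := by
    ext t i k
    rw [ContinuousMap.mul_apply, CStarMatrix.mul_apply, Fin.sum_univ_two]
    change ((v i t * v k t : ℝ) : ℂ) • φ (x * y) =
      (((v i t * v 0 t : ℝ) : ℂ) • φ x) * (((v 0 t * v k t : ℝ) : ℂ) • φ y) +
      (((v i t * v 1 t : ℝ) : ℂ) • φ x) * (((v 1 t * v k t : ℝ) : ℂ) • φ y)
    rw [smul_mul_smul_comm, smul_mul_smul_comm, ← add_smul, map_mul]
    congr 1
    rw [← Complex.ofReal_mul, ← Complex.ofReal_mul, ← Complex.ofReal_add]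
    congr 1
    linear_combination (-(v i t * v k t)) * hv t
  map_star' x := by
    ext t i k
    simp only [ContinuousMap.coe_mk, ContinuousMap.star_apply, CStarMatrix.star_apply,
      CStarMatrix.ofMatrix_apply, Matrix.of_apply, star_smul, map_star]
    simp [mul_comm]

theorem rankHom_apply {A B : Type} [NonUnitalCStarAlgebra A] [NonUnitalCStarAlgebra B]
    [PartialOrder B] [StarOrderedRing B] (φ : A →⋆ₙₐ[ℂ] B) (v : Fin 2 → C(unitInterval, ℝ))
    (hv : ∀ t, v 0 t * v 0 t + v 1 t * v 1 t = 1) (a : A) (t : unitInterval) (i k : Fin 2) :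
    rankHom φ v hv a t i k = ((v i t * v k t : ℝ) : ℂ) • φ a := rfl

/-- Evaluation at a point. -/
def evalAt {B : Type} [NonUnitalCStarAlgebra B] (t : unitInterval) :
    C(unitInterval, B) →⋆ₙₐ[ℂ] B where
  toFun f := f t
  map_add' _ _ := rfl
  map_smul' _ _ := rfl
  map_zero' := rfl
  map_mul' _ _ := rfl
  map_star' _ := rfl

/-- Entrywise application. -/
def entryMap {B C : Type} [NonUnitalCStarAlgebra B] [NonUnitalCStarAlgebra C]
    (f : B →⋆ₙₐ[ℂ] C) :
    CStarMatrix (Fin 2) (Fin 2) B →⋆ₙₐ[ℂ] CStarMatrix (Fin 2) (Fin 2) C where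
  toFun M := CStarMatrix.ofMatrix (Matrix.of fun i k => f (M i k))
  map_add' x y := by ext i k; simp
  map_smul' c x := by ext i k; simp
  map_zero' := by ext i k; simp
  map_mul' x y := by ext i k; simp [CStarMatrix.mul_apply]
  map_star' x := by ext i k; simp [CStarMatrix.star_apply, map_star]

/-- Diagonal sum. -/
def diagHom {B C : Type} [NonUnitalCStarAlgebra B] [NonUnitalCStarAlgebra C]
    (f g : B →⋆ₙₐ[ℂ] C) : B →⋆ₙₐ[ℂ] CStarMatrix (Fin 2) (Fin 2) C where
  toFun b := CStarMatrix.ofMatrix !![f b, 0; 0, g b]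
  map_add' x y := by ext i k; fin_cases i <;> fin_cases k <;> simp
  map_smul' c x := by ext i k; fin_cases i <;> fin_cases k <;> simp
  map_zero' := by ext i k; fin_cases i <;> fin_cases k <;> simp
  map_mul' x y := by
    ext i k; fin_cases i <;> fin_cases k <;> simp [CStarMatrix.mul_apply]
  map_star' x := by
    ext i k; fin_cases i <;> fin_cases k <;> simp [CStarMatrix.star_apply, map_star]

set_option maxHeartbeats 2000000

theorem statement4
    (A QA qA QqA q2A : Type)
    [NonUnitalCStarAlgebra A] [NonUnitalCStarAlgebra QA] [NonUnitalCStarAlgebra qA]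
    [NonUnitalCStarAlgebra QqA] [NonUnitalCStarAlgebra q2A]
    -- `QA = A ⋆ A` with identification map `π¹`
    (P₁ : QPresentation A QA) (π₁ : QA →⋆ₙₐ[ℂ] A)
    (hπ₁ : ∀ x, π₁ (P₁.ι x) = x) (hπ₁' : ∀ x, π₁ (P₁.ιbar x) = x)
    -- `qA = ker π¹`
    (j₁ : qA →⋆ₙₐ[ℂ] QA) (hj₁ : Function.Injective j₁)
    (hr₁ : Set.range j₁ = {z : QA | π₁ z = 0})
    -- `π_A : qA → A`, the restriction of `id ⋆ 0 : QA → A`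
    (θ : QA →⋆ₙₐ[ℂ] A) (hθ : ∀ x, θ (P₁.ι x) = x) (hθ' : ∀ x, θ (P₁.ιbar x) = 0)
    (πA : qA →⋆ₙₐ[ℂ] A) (hπA : ∀ z : qA, πA z = θ (j₁ z))
    -- `QqA = qA ⋆ qA` with identification map `π²`
    (P₂ : QPresentation qA QqA) (π₂ : QqA →⋆ₙₐ[ℂ] qA)
    (hπ₂ : ∀ z, π₂ (P₂.ι z) = z) (hπ₂' : ∀ z, π₂ (P₂.ιbar z) = z)
    -- `q²A = ker π²`
    (j₂ : q2A →⋆ₙₐ[ℂ] QqA) (hj₂ : Function.Injective j₂)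
    (hr₂ : Set.range j₂ = {v : QqA | π₂ v = 0})
    -- `Q(π_A) = (ι ∘ π_A) ⋆ (ῑ ∘ π_A) : QqA → QA`
    (Φ : QqA →⋆ₙₐ[ℂ] QA)
    (hΦ : Φ.comp P₂.ι = P₁.ι.comp πA) (hΦ' : Φ.comp P₂.ιbar = P₁.ιbar.comp πA)
    -- `q(π_A) : q²A → qA`, the restriction of `Q(π_A)`
    (qπA : q2A →⋆ₙₐ[ℂ] qA) (hqπA : ∀ w : q2A, j₁ (qπA w) = Φ (j₂ w))
    -- `id ⋆ 0 : QqA → qA` and its restriction `π_{qA} : q²A → qA`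
    (Ψ : QqA →⋆ₙₐ[ℂ] qA)
    (hΨ : ∀ z : qA, Ψ (P₂.ι z) = z) (hΨ' : ∀ z : qA, Ψ (P₂.ιbar z) = 0)
    (πqA : q2A →⋆ₙₐ[ℂ] qA) (hπqA : ∀ w : q2A, πqA w = Ψ (j₂ w)) :
    -- conclusion: `q(π_A)` and `π_{qA}` are homotopic as maps into `M₂(qA)`
    HomHomotopic ((cornerHom qA).comp qπA) ((cornerHom qA).comp πqA) := by
  let _ : PartialOrder QA := CStarAlgebra.spectralOrder QA
  let _ : StarOrderedRing QA := CStarAlgebra.spectralOrderedRing QA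
  let _ : PartialOrder A := CStarAlgebra.spectralOrder A
  let _ : StarOrderedRing A := CStarAlgebra.spectralOrderedRing A
  let e : Fin 2 → C(unitInterval, ℝ) := ![1, 0]
  have he : ∀ t, e 0 t * e 0 t + e 1 t * e 1 t = 1 := by intro t; simp [e]
  let r : Fin 2 → C(unitInterval, ℝ) :=
    ![⟨fun t => Real.sin ((t : ℝ) * (Real.pi / 2)), by fun_prop⟩,
      ⟨fun t => Real.cos ((t : ℝ) * (Real.pi / 2)), by fun_prop⟩]
  have hr : ∀ t, r 0 t * r 0 t + r 1 t * r 1 t = 1 := by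
    intro t
    have := Real.sin_sq_add_cos_sq ((t : ℝ) * (Real.pi / 2))
    simp only [r, Matrix.cons_val_zero, Matrix.cons_val_one, ContinuousMap.coe_mk]
    linarith
  obtain ⟨η, hη, hη'⟩ := P₁.exists_lift (rankHom P₁.ι e he) (rankHom P₁.ιbar r hr)
  obtain ⟨ζ, hζ, hζ'⟩ := P₁.exists_lift (rankHom P₁.ιbar e he) (rankHom P₁.ιbar r hr)
  obtain ⟨F, hF, hF'⟩ := P₂.exists_lift (η.comp j₁) (ζ.comp j₁)
  obtain ⟨θb, hθb, hθb'⟩ := P₁.exists_lift (0 : A →⋆ₙₐ[ℂ] A) (NonUnitalStarAlgHom.id ℂ A)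
  have hj2 : ∀ w, π₂ (j₂ w) = 0 := fun w => by
    have : j₂ w ∈ Set.range j₂ := ⟨w, rfl⟩
    rw [hr₂] at this
    exact this
  have hj1 : ∀ w, π₁ (j₁ w) = 0 := fun w => by
    have : j₁ w ∈ Set.range j₁ := ⟨w, rfl⟩
    rw [hr₁] at this
    exact this
  -- image lies in `M₂(qA)`
  have hker : ∀ t w i k, π₁ (F (j₂ w) t i k) = 0 := by
    intro t w i k
    let X : QA →⋆ₙₐ[ℂ] CStarMatrix (Fin 2) (Fin 2) A := ((entryMap π₁).comp (evalAt t)).comp η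
    let Y : QA →⋆ₙₐ[ℂ] CStarMatrix (Fin 2) (Fin 2) A := ((entryMap π₁).comp (evalAt t)).comp ζ
    have hXY : X = Y := by
      apply P₁.hom_ext'
      · intro a
        ext i k
        change π₁ (η (P₁.ι a) t i k) = π₁ (ζ (P₁.ι a) t i k)
        rw [hη, hζ, rankHom_apply, rankHom_apply, map_smul, map_smul, hπ₁, hπ₁']
      · intro a
        ext i k
        change π₁ (η (P₁.ιbar a) t i k) = π₁ (ζ (P₁.ιbar a) t i k)
        rw [hη', hζ']
    have hZ : ((entryMap π₁).comp (evalAt t)).comp F = (X.comp j₁).comp π₂ := by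
      apply P₂.hom_ext'
      · intro a
        change entryMap π₁ (evalAt t (F (P₂.ι a))) = X (j₁ (π₂ (P₂.ι a)))
        rw [hF, hπ₂]
        rfl
      · intro a
        change entryMap π₁ (evalAt t (F (P₂.ιbar a))) = X (j₁ (π₂ (P₂.ιbar a)))
        rw [hF', hπ₂', hXY]
        rfl
    have h3 := DFunLike.congr_fun hZ (j₂ w)
    have h4 : (X.comp j₁).comp π₂ (j₂ w) = 0 := by
      change X (j₁ (π₂ (j₂ w))) = 0
      rw [hj2, map_zero, map_zero]
    rw [h4] at h3
    exact congrFun (congrFun h3 i) k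
  have hex : ∀ z : QA, π₁ z = 0 → ∃ y, j₁ y = z := fun z hz => by
    have : z ∈ Set.range j₁ := by rw [hr₁]; exact hz
    exact this
  choose s hs using fun t w i k => hex _ (hker t w i k)
  let H : unitInterval → (q2A →⋆ₙₐ[ℂ] Matrix (Fin 2) (Fin 2) qA) := fun t =>
    { toFun := fun w => Matrix.of fun i k => s t w i k
      map_add' := fun x y => by
        ext i k
        apply hj₁
        simp [hs]
      map_smul' := fun c x => by
        ext i k
        apply hj₁
        simp [hs]
      map_zero' := by
        ext i k
        apply hj₁
        simp [hs]
      map_mul' := fun x y => by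
        ext i k
        apply hj₁
        simp [hs, Matrix.mul_apply, CStarMatrix.mul_apply]
      map_star' := fun x => by
        ext i k
        apply hj₁
        simp [hs, Matrix.star_apply, CStarMatrix.star_apply, map_star] }
  refine ⟨H, ?_, ?_, ?_⟩
  · intro w
    refine continuous_pi fun i => continuous_pi fun k => ?_
    have hi : Isometry j₁ := NonUnitalStarAlgHom.isometry j₁ hj₁
    rw [hi.isEmbedding.continuous_iff]
    change Continuous fun t => j₁ (s t w i k)
    simp only [hs]
    have hc : Continuous fun t => (F (j₂ w)) t := (F (j₂ w)).continuous
    exact (continuous_apply k).comp ((continuous_apply i).comp hc)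
  · have hη0 : (evalAt 0).comp η = diagHom (P₁.ι.comp θ) (P₁.ιbar.comp θb) := by
      apply P₁.hom_ext'
      · intro a
        ext i k
        change η (P₁.ι a) 0 i k = _
        rw [hη, rankHom_apply]
        fin_cases i <;> fin_cases k <;> simp [e, diagHom, hθ, hθb]
      · intro a
        ext i k
        change η (P₁.ιbar a) 0 i k = _
        rw [hη', rankHom_apply]
        fin_cases i <;> fin_cases k <;> simp [r, diagHom, hθ', hθb']
    have hζ0 : (evalAt 0).comp ζ = diagHom (P₁.ιbar.comp θ) (P₁.ιbar.comp θb) := by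
      apply P₁.hom_ext'
      · intro a
        ext i k
        change ζ (P₁.ι a) 0 i k = _
        rw [hζ, rankHom_apply]
        fin_cases i <;> fin_cases k <;> simp [e, diagHom, hθ, hθb]
      · intro a
        ext i k
        change ζ (P₁.ιbar a) 0 i k = _
        rw [hζ', rankHom_apply]
        fin_cases i <;> fin_cases k <;> simp [r, diagHom, hθ', hθb']
    have hF0 : (evalAt 0).comp F =
        diagHom Φ (((P₁.ιbar.comp θb).comp j₁).comp π₂) := by
      apply P₂.hom_ext'
      · intro a
        have h1 := DFunLike.congr_fun hη0 (j₁ a)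
        have h2 : Φ (P₂.ι a) = P₁.ι (πA a) := DFunLike.congr_fun hΦ a
        change evalAt 0 (F (P₂.ι a)) = _
        rw [hF]
        refine Eq.trans h1 ?_
        ext i k
        fin_cases i <;> fin_cases k <;> simp [diagHom, h2, hπA, hπ₂]
      · intro a
        have h1 := DFunLike.congr_fun hζ0 (j₁ a)
        have h2 : Φ (P₂.ιbar a) = P₁.ιbar (πA a) := DFunLike.congr_fun hΦ' a
        change evalAt 0 (F (P₂.ιbar a)) = _
        rw [hF']
        refine Eq.trans h1 ?_
        ext i k
        fin_cases i <;> fin_cases k <;> simp [diagHom, h2, hπA, hπ₂']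
    ext w i k
    apply hj₁
    change j₁ (s 0 w i k) = _
    rw [hs]
    have h5 := congrFun (congrFun (DFunLike.congr_fun hF0 (j₂ w)) i) k
    refine Eq.trans h5 ?_
    fin_cases i <;> fin_cases k <;> simp [diagHom, cornerHom, hqπA, hj2]
  · have hη1 : (evalAt 1).comp η = diagHom (NonUnitalStarAlgHom.id ℂ QA) 0 := by
      apply P₁.hom_ext'
      · intro a
        ext i k
        change η (P₁.ι a) 1 i k = _
        rw [hη, rankHom_apply]
        fin_cases i <;> fin_cases k <;> simp [e, diagHom]
      · intro a
        ext i k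
        change η (P₁.ιbar a) 1 i k = _
        rw [hη', rankHom_apply]
        fin_cases i <;> fin_cases k <;> simp [r, diagHom]
    have hζ1 : (evalAt 1).comp ζ = diagHom (P₁.ιbar.comp π₁) 0 := by
      apply P₁.hom_ext'
      · intro a
        ext i k
        change ζ (P₁.ι a) 1 i k = _
        rw [hζ, rankHom_apply]
        fin_cases i <;> fin_cases k <;> simp [e, diagHom, hπ₁]
      · intro a
        ext i k
        change ζ (P₁.ιbar a) 1 i k = _
        rw [hζ', rankHom_apply]
        fin_cases i <;> fin_cases k <;> simp [r, diagHom, hπ₁']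
    have hF1 : (evalAt 1).comp F = diagHom (j₁.comp Ψ) 0 := by
      apply P₂.hom_ext'
      · intro a
        have h1 := DFunLike.congr_fun hη1 (j₁ a)
        change evalAt 1 (F (P₂.ι a)) = _
        rw [hF]
        refine Eq.trans h1 ?_
        ext i k
        fin_cases i <;> fin_cases k <;> simp [diagHom, hΨ]
      · intro a
        have h1 := DFunLike.congr_fun hζ1 (j₁ a)
        change evalAt 1 (F (P₂.ιbar a)) = _
        rw [hF']
        refine Eq.trans h1 ?_
        ext i k
        fin_cases i <;> fin_cases k <;> simp [diagHom, hΨ', hj1]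
    ext w i k
    apply hj₁
    change j₁ (s 1 w i k) = _
    rw [hs]
    have h5 := congrFun (congrFun (DFunLike.congr_fun hF1 (j₂ w)) i) k
    refine Eq.trans h5 ?_
    fin_cases i <;> fin_cases k <;> simp [diagHom, cornerHom, hπqA]


end
end

section
/- Let A be separable, let α : qA → K⊗B be a *-homomorphism, let B₀ be the hereditary C*-subalgebra of K⊗B generated by α(qA), and let E_α, α_E, ᾱ_E, j_E : B₀ ↪ E_α be as in the context. Then for every *-homomorphism β : qB₀ → K⊗C there exists a *-homomorphism β′ : qE_α → M₂(β(qB₀)) ⊆ K⊗C such that β is homotopic to β′ ∘ q(j_E). -/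
/-! Statement 6 (Lemma 3.7 / `lemext`): given a separable `A`, `α : qA → K⊗B` with associated extension `0 → B₀ → E_α →p A → 0` (splittings `α_E, ᾱ_E`, inclusion `j_E : B₀ → E_α`, `B₀` the hereditary subalgebra of `K⊗B` generated by `α(qA)`), every `β : qB₀ → K⊗C` is homotopic to `β′ ∘ q(j_E)` for some `β′ : qE_α → M₂(β(qB₀))`.  See the structure docstrings for the encoding of the free products `QX = X ⋆ X`, their ideals `qX`, stabilizations and `E_α`. -/

noncomputable section
open scoped MultiplierAlgebra
/-- The entrywise application of a *-homomorphism to `2×2` matrices. -/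
def matMap₂ {X Y : Type} [NonUnitalSemiring X] [Module ℂ X] [StarRing X]
    [NonUnitalSemiring Y] [Module ℂ Y] [StarRing Y] (f : X →⋆ₙₐ[ℂ] Y) :
    Matrix (Fin 2) (Fin 2) X →⋆ₙₐ[ℂ] Matrix (Fin 2) (Fin 2) Y where
  toFun M := M.map f
  map_add' x y := by ext i k; simp [Matrix.map_apply]
  map_smul' c x := by ext i k; simp [Matrix.map_apply]
  map_zero' := by ext i k; simp [Matrix.map_apply]
  map_mul' x y := by
    ext i k
    simp [Matrix.map_apply, Matrix.mul_apply]
  map_star' x := by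
    ext i k
    simp [Matrix.map_apply, Matrix.star_apply, map_star]

/-- The embedding `b ↦ (b)` of an algebra into `1×1` matrices. -/
def one₁ (B : Type) [NonUnitalSemiring B] [Module ℂ B] [StarRing B] :
    B →⋆ₙₐ[ℂ] Matrix (Fin 1) (Fin 1) B where
  toFun b := Matrix.of fun _ _ => b
  map_add' x y := by ext i k; rfl
  map_smul' c x := by ext i k; rfl
  map_zero' := by ext i k; rfl
  map_mul' x y := by ext i k; simp [Matrix.mul_apply]
  map_star' x := by ext i k; rfl

/-- A presentation of the stabilization `K ⊗ B` (`K` = compact operators on `ℓ²(ℕ)`):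
`KB` is the closure of the increasing union of the matrix algebras `Mₙ(B)` under
the upper-left corner embeddings. -/
structure Stabilization (B KB : Type) [NonUnitalCStarAlgebra B] [NonUnitalCStarAlgebra KB] where
  j : ∀ n : ℕ, (Matrix (Fin n) (Fin n) B →⋆ₙₐ[ℂ] KB)
  inj : ∀ n, Function.Injective (j n)
  compat : ∀ (n : ℕ) (M : Matrix (Fin n) (Fin n) B),
    j (n + 1) (Matrix.of fun i k =>
      if h : (i : ℕ) < n ∧ (k : ℕ) < n then M ⟨i, h.1⟩ ⟨k, h.2⟩ else 0) = j n M
  dense : closure (⋃ n, Set.range (j n)) = Set.univ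

/-- The canonical corner embedding `B → K ⊗ B`. -/
def Stabilization.corner {B KB : Type} [NonUnitalCStarAlgebra B] [NonUnitalCStarAlgebra KB]
    (St : Stabilization B KB) : B →⋆ₙₐ[ℂ] KB :=
  (St.j 1).comp (one₁ B)

/-- The data attached to a homomorphism `α : qA → K ⊗ B` (Cuntz–Gabe §3.3):
the hereditary subalgebra `B₀ ⊆ K⊗B` generated by `α(qA)` (presented via `jB₀`),
the canonical extension `α° : QA → 𝓜(B₀)`, the subalgebra
`E_α = C*(B₀, α_E(A), ᾱ_E(A)) ⊆ 𝓜(B₀) ⊕ A` (presented via `jE`), the two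
splittings `α_E, ᾱ_E : A → E_α` given by `α_E(x) = (α°(ι x), x)`,
`ᾱ_E(x) = (α°(ῑ x), x)`, and the inclusion `j_E : B₀ → E_α`.
This yields the exact sequence `0 → B₀ → E_α → A → 0` with splittings `α_E, ᾱ_E`,
and `α = q(α_E, ᾱ_E)`. -/
structure EalphaData (A QA qA : Type)
    [NonUnitalCStarAlgebra A] [NonUnitalCStarAlgebra QA] [NonUnitalCStarAlgebra qA]
    (P₁ : QPresentation A QA) (j₁ : qA →⋆ₙₐ[ℂ] QA)
    (KB : Type) [NonUnitalCStarAlgebra KB] (α : qA →⋆ₙₐ[ℂ] KB)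
    (B₀T EαT : Type) [NonUnitalCStarAlgebra B₀T] [NonUnitalCStarAlgebra EαT] where
  jB₀ : B₀T →⋆ₙₐ[ℂ] KB
  hjB₀inj : Function.Injective jB₀
  hjB₀r : Set.range jB₀ = closure ((Submodule.span ℂ
    {x : KB | ∃ z w : qA, ∃ b : KB, x = α z * b * α w} : Submodule ℂ KB) : Set KB)
  αext : QA →⋆ₙₐ[ℂ] 𝓜(ℂ, B₀T)
  hαext : ∀ (z : qA) (u : B₀T), jB₀ u = α z → αext (j₁ z) = (u : 𝓜(ℂ, B₀T))
  jE : EαT →⋆ₙₐ[ℂ] (𝓜(ℂ, B₀T) × A)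
  hjEinj : Function.Injective jE
  hjEr : Set.range jE = ((NonUnitalStarAlgebra.adjoin ℂ
      ({p : 𝓜(ℂ, B₀T) × A | ∃ b : B₀T, p = ((b : 𝓜(ℂ, B₀T)), 0)} ∪
       {p : 𝓜(ℂ, B₀T) × A | ∃ x : A, p = (αext (P₁.ι x), x)} ∪
       {p : 𝓜(ℂ, B₀T) × A | ∃ x : A, p = (αext (P₁.ιbar x), x)})).topologicalClosure :
    Set (𝓜(ℂ, B₀T) × A))
  αE : A →⋆ₙₐ[ℂ] EαT
  hαE : ∀ x, jE (αE x) = (αext (P₁.ι x), x)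
  αbarE : A →⋆ₙₐ[ℂ] EαT
  hαbarE : ∀ x, jE (αbarE x) = (αext (P₁.ιbar x), x)
  jEB : B₀T →⋆ₙₐ[ℂ] EαT
  hjEB : ∀ b, jE (jEB b) = ((b : 𝓜(ℂ, B₀T)), 0)

noncomputable section
open scoped MultiplierAlgebra
open Filter Topology

namespace S6

/-- coercion into multipliers -/
abbrev kap (X : Type) [NonUnitalCStarAlgebra X] : X →⋆ₙₐ[ℂ] 𝓜(ℂ, X) := DoubleCentralizer.coeHom

section mult
variable {X : Type} [NonUnitalCStarAlgebra X]

lemma mul_kap (m : 𝓜(ℂ, X)) (x : X) : m * kap X x = kap X (m.fst x) := by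
  refine DoubleCentralizer.ext _ _ _ _ (Prod.ext ?_ ?_)
  · refine ContinuousLinearMap.ext fun y => ?_
    change m.fst (x * y) = m.fst x * y
    have key : ∀ w : X, w * (m.fst (x * y) - m.fst x * y) = 0 := by
      intro w
      rw [mul_sub, ← m.central, ← mul_assoc, ← mul_assoc, ← m.central, sub_self]
    have := key (star (m.fst (x * y) - m.fst x * y))
    exact sub_eq_zero.mp (CStarRing.star_mul_self_eq_zero_iff _ |>.mp this)
  · refine ContinuousLinearMap.ext fun y => ?_
    change m.snd y * x = y * m.fst x
    exact m.central y x

lemma kap_mul (m : 𝓜(ℂ, X)) (x : X) : kap X x * m = kap X (m.snd x) := by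
  have h := congrArg star (mul_kap (star m) (star x))
  rw [star_mul, star_star, ← map_star, star_star, ← map_star] at h
  rw [h]
  congr 1
  rw [DoubleCentralizer.star_fst, star_star, star_star]

lemma kap_inj : Function.Injective (kap X) := by
  intro x y h
  have h2 : ∀ z : X, x * z = y * z := by
    intro z
    have := congrArg (fun m : 𝓜(ℂ, X) => m.fst z) h
    exact this
  have h3 : (x - y) * star (x - y) = 0 := by rw [sub_mul, h2, sub_self]
  exact sub_eq_zero.mp (CStarRing.mul_star_self_eq_zero_iff _ |>.mp h3)

lemma norm_kap (x : X) : ‖kap X x‖ = ‖x‖ := NonUnitalStarAlgHom.norm_map _ kap_inj x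

lemma norm_kap' (x : X) : ‖(x : 𝓜(ℂ, X))‖ = ‖x‖ := norm_kap x

lemma kap_isom : Isometry (kap X) := NonUnitalStarAlgHom.isometry _ kap_inj

lemma fst_eq_of (m n : 𝓜(ℂ, X)) (h : ∀ x, m.fst x = n.fst x) : m = n := by
  refine DoubleCentralizer.ext _ _ _ _ (Prod.ext (ContinuousLinearMap.ext h) ?_)
  refine ContinuousLinearMap.ext fun y => ?_
  change m.snd y = n.snd y
  have key : ∀ w : X, (m.snd y - n.snd y) * w = 0 := by
    intro w
    rw [sub_mul, m.central, n.central, h, sub_self]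
  exact sub_eq_zero.mp (CStarRing.mul_star_self_eq_zero_iff _ |>.mp (key (star _)))

lemma norm_fst_le (m : 𝓜(ℂ, X)) (x : X) : ‖m.fst x‖ ≤ ‖m‖ * ‖x‖ := by
  rw [← DoubleCentralizer.norm_fst]; exact m.fst.le_opNorm x

lemma norm_snd_le (m : 𝓜(ℂ, X)) (x : X) : ‖m.snd x‖ ≤ ‖m‖ * ‖x‖ := by
  rw [← DoubleCentralizer.norm_snd]; exact m.snd.le_opNorm x

lemma strict_clm {I : Type*} (l : Filter I) [l.NeBot] (m : I → (X →L[ℂ] X)) (C : ℝ)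
    (hC : ∀ i, ‖m i‖ ≤ C) (h : ∀ y, ∃ y', Tendsto (fun i => m i y) l (𝓝 y')) :
    ∃ L : X →L[ℂ] X, ∀ y, Tendsto (fun i => m i y) l (𝓝 (L y)) := by
  choose L hL using h
  refine ⟨LinearMap.mkContinuous
    { toFun := L
      map_add' := fun a b => ?_
      map_smul' := fun c a => ?_ } C ?_, hL⟩
  · refine tendsto_nhds_unique (hL (a + b)) ?_
    simpa using (hL a).add (hL b)
  · refine tendsto_nhds_unique (hL (c • a)) ?_
    simpa using (hL a).const_smul c
  · intro x
    refine le_of_tendsto (hL x).norm (Eventually.of_forall fun i => ?_)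
    exact (m i).le_of_opNorm_le (hC i) x

lemma strict_limit {I : Type*} (l : Filter I) [l.NeBot] (m : I → 𝓜(ℂ, X)) (C : ℝ)
    (hC : ∀ i, ‖m i‖ ≤ C) (h1 : ∀ y, ∃ y', Tendsto (fun i => (m i).fst y) l (𝓝 y'))
    (h2 : ∀ y, ∃ y', Tendsto (fun i => (m i).snd y) l (𝓝 y')) :
    ∃ M : 𝓜(ℂ, X), (∀ y, Tendsto (fun i => (m i).fst y) l (𝓝 (M.fst y))) ∧
      (∀ y, Tendsto (fun i => (m i).snd y) l (𝓝 (M.snd y))) := by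
  obtain ⟨L, hL⟩ := strict_clm l (fun i => (m i).fst) C
    (fun i => by rw [DoubleCentralizer.norm_fst]; exact hC i) h1
  obtain ⟨R, hR⟩ := strict_clm l (fun i => (m i).snd) C
    (fun i => by rw [DoubleCentralizer.norm_snd]; exact hC i) h2
  refine ⟨⟨(L, R), fun x y => ?_⟩, hL, hR⟩
  change R x * y = x * L y
  refine tendsto_nhds_unique ((hR x).mul_const y) ?_
  simp_rw [(m _).central]
  exact (hL y).const_mul x

/-- bounded, convergence on a dense-span set suffices -/
lemma conv_of_dense {I : Type*} (l : Filter I) [l.NeBot] (m : I → (X →L[ℂ] X)) (C : ℝ)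
    (hC : ∀ i, ‖m i‖ ≤ C) (S : Set X)
    (hS : ∀ y, y ∈ closure ((Submodule.span ℂ S : Submodule ℂ X) : Set X))
    (h : ∀ y ∈ S, ∃ y', Tendsto (fun i => m i y) l (𝓝 y')) :
    ∀ y, ∃ y', Tendsto (fun i => m i y) l (𝓝 y') := by
  have hspan : ∀ y ∈ Submodule.span ℂ S, ∃ y', Tendsto (fun i => m i y) l (𝓝 y') := by
    intro y hy
    induction hy using Submodule.span_induction with
    | mem x hx => exact h x hx
    | zero => exact ⟨0, by simp⟩
    | add x y _ _ hx hy =>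
      obtain ⟨x', hx⟩ := hx
      obtain ⟨y', hy⟩ := hy
      exact ⟨x' + y', by simpa using hx.add hy⟩
    | smul c x _ hx =>
      obtain ⟨x', hx⟩ := hx
      exact ⟨c • x', by simpa using hx.const_smul c⟩
  intro y
  refine cauchy_map_iff_exists_tendsto.mp ?_
  rw [cauchy_map_iff]
  refine ⟨inferInstance, ?_⟩
  rw [Metric.uniformity_basis_dist.tendsto_right_iff]
  intro ε hε
  have hCn : 0 ≤ C := by
    obtain ⟨i⟩ := l.nonempty_of_neBot
    exact (norm_nonneg _).trans (hC i)
  obtain ⟨x, hx, hxy⟩ := Metric.mem_closure_iff.mp (hS y) (ε / (3 * (C + 1))) (by positivity)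
  obtain ⟨x', hx'⟩ := hspan x hx
  have hc := (cauchy_map_iff.mp hx'.cauchy_map).2
  have := (Metric.uniformity_basis_dist.tendsto_right_iff.mp hc) (ε / 3) (by positivity)
  filter_upwards [this] with p hp
  have hb : ∀ i, dist (m i y) (m i x) < ε / 3 := by
    intro i
    rw [dist_eq_norm, ← map_sub]
    calc ‖m i (y - x)‖ ≤ C * ‖y - x‖ := (m i).le_of_opNorm_le (hC i) _
      _ ≤ (C + 1) * ‖y - x‖ := by gcongr; linarith
      _ < (C + 1) * (ε / (3 * (C + 1))) := by
        rw [← dist_eq_norm]; gcongr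
      _ = ε / 3 := by field_simp
  have h1 := hb p.1
  have h2 := hb p.2
  rw [dist_comm] at h2
  have hp' : dist (m p.1 x) (m p.2 x) < ε / 3 := hp
  have := dist_triangle4 (m p.1 y) (m p.1 x) (m p.2 x) (m p.2 y)
  change dist (m p.1 y) (m p.2 y) < ε
  linarith

end mult

/-- existence of an approximate unit as a filter without mentioning order -/
lemma exists_au (X : Type) [NonUnitalCStarAlgebra X] :
    ∃ l : Filter X, l.NeBot ∧ (∀ᶠ u in l, ‖u‖ ≤ 1) ∧ (∀ᶠ u in l, star u = u) ∧
      (∀ x, Tendsto (fun u => u * x) l (𝓝 x)) ∧ (∀ x, Tendsto (fun u => x * u) l (𝓝 x)) := by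
  letI := CStarAlgebra.spectralOrder X
  haveI := CStarAlgebra.spectralOrderedRing X
  have h := CStarAlgebra.increasingApproximateUnit X
  exact ⟨_, h.neBot, h.eventually_norm, h.eventually_star_eq, h.tendsto_mul_right,
    h.tendsto_mul_left⟩

section ext
variable {X Y : Type} [NonUnitalCStarAlgebra X] [NonUnitalCStarAlgebra Y]

def Nondeg (f : X →⋆ₙₐ[ℂ] 𝓜(ℂ, Y)) : Prop :=
  ∀ y : Y, y ∈ closure ((Submodule.span ℂ {y : Y | ∃ x y', y = (f x).fst y'} : Submodule ℂ Y) : Set Y)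

lemma Nondeg.eq {f : X →⋆ₙₐ[ℂ] 𝓜(ℂ, Y)} (hf : Nondeg f) {m n : 𝓜(ℂ, Y)}
    (h : ∀ x, m * f x = n * f x) : m = n := by
  apply fst_eq_of
  intro y
  have hcl : IsClosed {y : Y | m.fst y = n.fst y} := isClosed_eq m.fst.continuous n.fst.continuous
  refine hcl.closure_subset_iff.mpr ?_ (hf y)
  intro y hy
  induction hy using Submodule.span_induction with
  | mem y hy =>
    obtain ⟨x, y', rfl⟩ := hy
    have := congrArg (fun k : 𝓜(ℂ, Y) => k.fst y') (h x)
    exact this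
  | zero => simp
  | add a b _ _ ha hb => simp only [Set.mem_ofPred_eq, map_add] at *; rw [ha, hb]
  | smul c a _ ha => simp only [Set.mem_ofPred_eq, map_smul] at *; rw [ha]

lemma norm_f_le (f : X →⋆ₙₐ[ℂ] 𝓜(ℂ, Y)) (x : X) : ‖f x‖ ≤ ‖x‖ := NonUnitalStarAlgHom.norm_apply_le f x

lemma exists_ext_aux (f : X →⋆ₙₐ[ℂ] 𝓜(ℂ, Y)) (hf : Nondeg f) (m : 𝓜(ℂ, X)) :
    ∃ M : 𝓜(ℂ, Y), ∀ x, M * f x = f (m.fst x) := by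
  obtain ⟨l, hl, h1, hs, hr, hl'⟩ := exists_au X
  let SS : Set X := {u : X | ‖u‖ ≤ 1 ∧ star u = u}
  let I := {u : X // u ∈ SS}
  let l' : Filter I := comap Subtype.val l
  haveI : l'.NeBot := by
    have hle : l ≤ 𝓟 SS := le_principal_iff.mpr (h1.and hs)
    exact comap_coe_neBot_of_le_principal hle
  have hv : Tendsto (Subtype.val : I → X) l' l := tendsto_comap
  have hfc : Continuous f := by
    exact AddMonoidHomClass.continuous_of_bound f 1 (fun x => by simpa using norm_f_le f x)
  have hC : ∀ i : I, ‖f (m.fst i.1)‖ ≤ ‖m‖ := by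
    intro i
    refine (norm_f_le f _).trans ((norm_fst_le m _).trans ?_)
    exact mul_le_of_le_one_right (norm_nonneg _) i.2.1
  have hC' : ∀ i : I, ‖f (m.snd i.1)‖ ≤ ‖m‖ := by
    intro i
    refine (norm_f_le f _).trans ((norm_snd_le m _).trans ?_)
    exact mul_le_of_le_one_right (norm_nonneg _) i.2.1
  have hmul : ∀ u x : X, m.fst (u * x) = m.fst u * x := by
    intro u x
    apply kap_inj
    rw [map_mul (kap X), ← mul_kap, ← mul_kap, map_mul (kap X), mul_assoc]
  have hx1 : ∀ x, Tendsto (fun i : I => f (m.fst i.1) * f x) l' (𝓝 (f (m.fst x))) := by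
    intro x
    have : Tendsto (fun i : I => f (m.fst (i.1 * x))) l' (𝓝 (f (m.fst x))) :=
      (hfc.tendsto _).comp ((m.fst.continuous.tendsto _).comp ((hr x).comp hv))
    refine this.congr fun i => ?_
    rw [hmul, map_mul]
  have e1 : ∀ y, ∃ y', Tendsto (fun i : I => (f (m.fst i.1)).fst y) l' (𝓝 y') := by
    refine conv_of_dense l' (fun i : I => (f (m.fst i.1)).fst) ‖m‖
      (fun i => by rw [DoubleCentralizer.norm_fst]; exact hC i) _ hf ?_
    rintro _ ⟨x, y', rfl⟩
    refine ⟨(f (m.fst x)).fst y', ?_⟩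
    have h3 : Continuous fun k : 𝓜(ℂ, Y) => k.fst y' := by
      refine AddMonoidHomClass.continuous_of_bound
        ({ toFun := fun k => k.fst y', map_zero' := by simp, map_add' := by simp } :
          𝓜(ℂ, Y) →+ Y) ‖y'‖ (fun k => ?_)
      rw [mul_comm]; exact norm_fst_le k y'
    exact (h3.tendsto _).comp (hx1 x)
  -- right side: y * f(m.fst u)
  have e2 : ∀ y, ∃ y', Tendsto (fun i : I => (star (f (m.fst i.1))).fst y) l' (𝓝 y') := by
    refine conv_of_dense l' (fun i : I => (star (f (m.fst i.1))).fst) ‖m‖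
      (fun i => by rw [DoubleCentralizer.norm_fst, norm_star]; exact hC i) _ hf ?_
    rintro _ ⟨x, y', rfl⟩
    refine ⟨(f ((star m).fst x)).fst y', ?_⟩
    have h3 : Continuous fun k : 𝓜(ℂ, Y) => k.fst y' := by
      refine AddMonoidHomClass.continuous_of_bound
        ({ toFun := fun k => k.fst y', map_zero' := by simp, map_add' := by simp } :
          𝓜(ℂ, Y) →+ Y) ‖y'‖ (fun k => ?_)
      rw [mul_comm]; exact norm_fst_le k y'
    have h4 : Tendsto (fun i : I => star (f (m.fst i.1)) * f x) l' (𝓝 (f ((star m).fst x))) := by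
      have : Tendsto (fun i : I => f (i.1 * (star m).fst x)) l' (𝓝 (f ((star m).fst x))) :=
        (hfc.tendsto _).comp ((hr _).comp hv)
      refine this.congr fun i => ?_
      rw [← map_star f, ← map_mul f]
      congr 1
      apply kap_inj
      rw [map_mul (kap X), map_mul (kap X), ← mul_kap, map_star (kap X), ← mul_kap, star_mul, mul_assoc, ← map_star (kap X), i.2.2]
    exact (h3.tendsto _).comp h4
  have e2' : ∀ y, ∃ y', Tendsto (fun i : I => (f (m.fst i.1)).snd y) l' (𝓝 y') := by
    intro y
    obtain ⟨y', hy'⟩ := e2 (star y)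
    refine ⟨star y', (hy'.star).congr fun i => ?_⟩
    rw [DoubleCentralizer.star_fst, star_star, star_star]
  obtain ⟨M, hM1, -⟩ := strict_limit l' (fun i : I => f (m.fst i.1)) ‖m‖ hC e1 e2'
  refine ⟨M, fun x => ?_⟩
  apply fst_eq_of
  intro y
  have h5 := hM1 ((f x).fst y)
  have h3 : Continuous fun k : 𝓜(ℂ, Y) => k.fst y := by
      refine AddMonoidHomClass.continuous_of_bound
        ({ toFun := fun k => k.fst y, map_zero' := by simp, map_add' := by simp } :
          𝓜(ℂ, Y) →+ Y) ‖y‖ (fun k => ?_)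
      rw [mul_comm]; exact norm_fst_le k y
  have h6 := (h3.tendsto _).comp (hx1 x)
  exact tendsto_nhds_unique h5 h6

theorem exists_ext (f : X →⋆ₙₐ[ℂ] 𝓜(ℂ, Y)) (hf : Nondeg f) :
    ∃ F : 𝓜(ℂ, X) →⋆ₐ[ℂ] 𝓜(ℂ, Y), (∀ m x, F m * f x = f (m.fst x)) ∧ ∀ x, F (kap X x) = f x := by
  choose F hF using exists_ext_aux f hf
  have hmulx : ∀ m n : 𝓜(ℂ, X), F (m * n) = F m * F n := by
    intro m n
    refine hf.eq fun x => ?_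
    rw [hF, mul_assoc, hF, hF]; rfl
  refine ⟨{ toFun := F, map_one' := ?_, map_mul' := hmulx, map_zero' := ?_, map_add' := ?_,
            commutes' := ?_, map_star' := ?_ }, hF, ?_⟩
  · refine hf.eq fun x => ?_
    rw [hF, one_mul]; rfl
  · refine hf.eq fun x => ?_
    rw [hF, zero_mul]; simp
  · intro m n
    refine hf.eq fun x => ?_
    rw [hF, add_mul, hF, hF, ← map_add]; rfl
  · intro r
    refine hf.eq fun x => ?_
    rw [hF, Algebra.algebraMap_eq_smul_one, Algebra.algebraMap_eq_smul_one, smul_mul_assoc, one_mul,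
      ← map_smul]
    rfl
  · intro m
    refine hf.eq fun x => ?_
    rw [hF]
    have key : ∀ x', star (f x') * (star (F m) * f x) = star (f x') * f ((star m).fst x) := by
      intro x'
      rw [← mul_assoc, ← star_mul, hF, ← map_star f, ← map_star f, ← map_mul f, ← map_mul f]
      congr 1
      apply kap_inj
      rw [map_mul (kap X), map_mul (kap X), map_star (kap X), ← mul_kap, ← mul_kap, star_mul, map_star (kap X), mul_assoc]
    have k2 : star (star (F m) * f x) = star (f ((star m).fst x)) := by
      refine hf.eq fun x' => ?_
      have := congrArg star (key x')
      simpa only [star_mul, star_star] using this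
    exact (star_injective k2).symm
  · intro x
    refine hf.eq fun x' => ?_
    change F _ * _ = _
    rw [hF, ← map_mul]; rfl
end ext
end S6
end

noncomputable section
open scoped MultiplierAlgebra
open Filter Topology

namespace S6
section qc
variable {J X : Type} [NonUnitalCStarAlgebra J] [NonUnitalCStarAlgebra X]
  [PartialOrder J] [StarOrderedRing J]

lemma hom_cont {J X : Type} [NonUnitalCStarAlgebra J] [NonUnitalCStarAlgebra X]
    (f : J →⋆ₙₐ[ℂ] X) : Continuous f :=
  AddMonoidHomClass.continuous_of_bound f 1
    (fun x => by simpa using NonUnitalStarAlgHom.norm_apply_le f x)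

lemma qc_step (f : J →⋆ₙₐ[ℂ] X) (hid : ∀ j x, f j * x ∈ Set.range f) (a : J) (ha : 0 ≤ a)
    (ha1 : ‖a‖ < 1) (F : Finset X) (G : Finset J) (ε : ℝ) (hε : 0 < ε) (n : ℕ) :
    ∃ V : J, n • a ≤ V ∧ ‖V‖ ≤ n ∧
      (∀ x ∈ F, ‖f V * x - x * f V‖ ^ 2 ≤ n * (4 * ‖x‖ ^ 2 + 1)) ∧
      ∀ g ∈ G, ‖V * g - n • g‖ ≤ n * ε := by
  have hid' : ∀ j x, x * f j ∈ Set.range f := by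
    intro j x
    obtain ⟨y, hy⟩ := hid (star j) (star x)
    exact ⟨star y, by rw [map_star, hy, star_mul, star_star, map_star, star_star]⟩
  induction n with
  | zero => exact ⟨0, by simp, by simp, by simp, by simp⟩
  | succ n ih =>
    obtain ⟨V, h1, h2, h3, h4⟩ := ih
    have hau := CStarAlgebra.increasingApproximateUnit J
    have hne := hau.neBot
    have e1 : ∀ᶠ v in CStarAlgebra.approximateUnit J, a ≤ v ∧ ‖v‖ ≤ 1 := by
      have := (CStarAlgebra.hasBasis_approximateUnit J).mem_of_mem (i := a) ⟨ha, ha1⟩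
      filter_upwards [this] with v hv
      exact ⟨hv.1, by simpa using hv.2⟩
    have e2 : ∀ x ∈ F, ∀ᶠ v in CStarAlgebra.approximateUnit J,
        ‖star (f V * x - x * f V) * (f v * x - x * f v)‖ < 1 / 2 := by
      intro x _
      obtain ⟨p, hp⟩ := hid V x
      obtain ⟨p', hp'⟩ := hid' V x
      set y := p - p' with hy
      have hc : f V * x - x * f V = f y := by rw [hy, map_sub, hp, hp']
      rw [hc]
      obtain ⟨y', hy'⟩ := hid (star y) x
      have t1 : Tendsto (fun v => f (star y * v) * x - f (y' * v))
          (CStarAlgebra.approximateUnit J) (𝓝 (f (star y) * x - f y')) :=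
        ((((hom_cont f).tendsto _).comp (hau.tendsto_mul_left (star y))).mul_const x).sub
          (((hom_cont f).tendsto _).comp (hau.tendsto_mul_left y'))
      rw [hy', sub_self] at t1
      have t2 := t1.norm
      rw [norm_zero] at t2
      filter_upwards [t2.eventually_lt_const (show (0:ℝ) < 1/2 by norm_num)] with v hv
      rw [map_mul, map_mul, hy', map_star] at hv
      rw [mul_sub, ← mul_assoc, ← mul_assoc]
      exact hv
    have e3 : ∀ g ∈ G, ∀ᶠ v in CStarAlgebra.approximateUnit J, ‖v * g - g‖ ≤ ε := by
      intro g _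
      have := ((hau.tendsto_mul_right g).sub_const g).norm
      rw [sub_self, norm_zero] at this
      exact this.eventually_le_const hε
    have e2' := (Finset.eventually_all F).mpr e2
    have e3' := (Finset.eventually_all G).mpr e3
    obtain ⟨v, ⟨k0, k1⟩, k2, k3⟩ := (e1.and (e2'.and e3')).exists
    refine ⟨V + v, ?_, ?_, ?_, ?_⟩
    · rw [succ_nsmul]; exact add_le_add h1 k0
    · push_cast; exact (norm_add_le _ _).trans (add_le_add h2 k1)
    · intro x hx
      have := h3 x hx
      have q := k2 x hx
      have hb : ‖f v * x - x * f v‖ ≤ 2 * ‖x‖ := by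
        have hfv : ‖f v‖ ≤ 1 := (NonUnitalStarAlgHom.norm_apply_le f v).trans k1
        calc ‖f v * x - x * f v‖ ≤ ‖f v * x‖ + ‖x * f v‖ := norm_sub_le _ _
          _ ≤ ‖f v‖ * ‖x‖ + ‖x‖ * ‖f v‖ := add_le_add (norm_mul_le _ _) (norm_mul_le _ _)
          _ ≤ 1 * ‖x‖ + ‖x‖ * 1 := by gcongr
          _ = 2 * ‖x‖ := by ring
      set c := f V * x - x * f V
      set c' := f v * x - x * f v
      have hcc : f (V + v) * x - x * f (V + v) = c + c' := by
        rw [map_add, add_mul, mul_add]; simp only [c, c']; abel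
      rw [hcc]
      have e : ‖c + c'‖ ^ 2 ≤ ‖c‖ ^ 2 + ‖c'‖ ^ 2 + 2 * ‖star c * c'‖ := by
        rw [pow_two, ← CStarRing.norm_star_mul_self]
        have : star (c + c') * (c + c') = star c * c + star c' * c' + (star c * c' + star (star c * c')) := by
          rw [star_add, star_mul, star_star, add_mul, mul_add, mul_add]; abel
        rw [this]
        refine (norm_add_le _ _).trans ?_
        have a1 := norm_add_le (star c * c) (star c' * c')
        have a2 := norm_add_le (star c * c') (star (star c * c'))
        rw [norm_star] at a2
        rw [CStarRing.norm_star_mul_self, CStarRing.norm_star_mul_self] at a1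
        nlinarith
      have hb2 : ‖c'‖ ^ 2 ≤ (2 * ‖x‖) ^ 2 := by gcongr
      push_cast
      nlinarith
    · intro g hg
      have := h4 g hg
      have := k3 g hg
      have e : (V + v) * g - (n + 1) • g = (V * g - n • g) + (v * g - g) := by
        rw [add_mul, succ_nsmul]; abel
      rw [e]
      refine (norm_add_le _ _).trans ?_
      push_cast
      linarith

theorem qc (f : J →⋆ₙₐ[ℂ] X) (hid : ∀ j x, f j * x ∈ Set.range f) (a : J) (ha : 0 ≤ a)
    (ha1 : ‖a‖ < 1) (F : Finset X) (G : Finset J) (ε : ℝ) (hε : 0 < ε) :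
    ∃ u : J, a ≤ u ∧ ‖u‖ ≤ 1 ∧ (∀ x ∈ F, ‖f u * x - x * f u‖ < ε) ∧
      ∀ g ∈ G, ‖u * g - g‖ < ε := by
  obtain ⟨n, hn⟩ : ∃ n : ℕ, 0 < n ∧ ∀ x ∈ F, (4 * ‖x‖ ^ 2 + 1) < ε ^ 2 * n := by
    have : ∀ x ∈ F, ∀ᶠ n : ℕ in atTop, (4 * ‖x‖ ^ 2 + 1) < ε ^ 2 * n := by
      intro x _
      exact (tendsto_natCast_atTop_atTop.const_mul_atTop (by positivity : 0 < ε ^ 2)).eventually_gt_atTop _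
    exact ((eventually_gt_atTop 0).and ((Finset.eventually_all F).mpr this)).exists
  obtain ⟨hn0, hn⟩ := hn
  obtain ⟨V, h1, h2, h3, h4⟩ := qc_step f hid a ha ha1 F G (ε / 2) (by positivity) n
  have hn' : (0 : ℝ) < n := by exact_mod_cast hn0
  refine ⟨(n : ℝ)⁻¹ • V, ?_, ?_, ?_, ?_⟩
  · have := smul_le_smul_of_nonneg_left h1 (inv_nonneg.mpr hn'.le)
    rw [← Nat.cast_smul_eq_nsmul ℝ, smul_smul, inv_mul_cancel₀ hn'.ne', one_smul] at this
    exact this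
  · rw [norm_smul, norm_inv, Real.norm_natCast, inv_mul_le_iff₀ hn']; simpa using h2
  · intro x hx
    have e : f ((n : ℝ)⁻¹ • V) * x - x * f ((n : ℝ)⁻¹ • V) = ((n : ℂ)⁻¹) • (f V * x - x * f V) := by
      have : ((n : ℝ)⁻¹ • V) = ((n : ℂ)⁻¹) • V := by
        rw [← Complex.coe_smul]; push_cast; rfl
      rw [this, map_smul, smul_mul_assoc, mul_smul_comm, smul_sub]
    rw [e, norm_smul, norm_inv, Complex.norm_natCast, inv_mul_lt_iff₀ hn']
    refine lt_of_pow_lt_pow_left₀ 2 (by positivity) ((h3 x hx).trans_lt ?_)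
    nlinarith [hn x hx]
  · intro g hg
    have e : ((n : ℝ)⁻¹ • V) * g - g = (n : ℝ)⁻¹ • (V * g - n • g) := by
      rw [smul_sub, ← Nat.cast_smul_eq_nsmul ℝ, smul_smul, inv_mul_cancel₀ hn'.ne', one_smul, smul_mul_assoc]
    rw [e, norm_smul, norm_inv, Real.norm_natCast, inv_mul_lt_iff₀ hn']
    have := h4 g hg
    nlinarith
end qc
end S6
end

noncomputable section
open scoped MultiplierAlgebra
open Filter Topology

namespace S6
section qc
variable {J X : Type} [NonUnitalCStarAlgebra J] [NonUnitalCStarAlgebra X]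
  [PartialOrder J] [StarOrderedRing J]

theorem qc' (f : J →⋆ₙₐ[ℂ] X) (hid : ∀ j x, f j * x ∈ Set.range f) (a : J) (ha : 0 ≤ a)
    (ha1 : ‖a‖ < 1) (F : Finset X) (G : Finset J) (ε : ℝ) (hε : 0 < ε) :
    ∃ u : J, a ≤ u ∧ ‖u‖ < 1 ∧ (∀ x ∈ F, ‖f u * x - x * f u‖ < ε) ∧
      ∀ g ∈ G, ‖u * g - g‖ < ε := by
  have h0 : Tendsto (fun δ : ℝ => δ) (𝓝[>] 0) (𝓝 0) := tendsto_nhdsWithin_of_tendsto_nhds tendsto_id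
  have e1 : ∀ᶠ δ : ℝ in 𝓝[>] 0, ‖a‖ < 1 - δ := by
    have : Tendsto (fun δ : ℝ => 1 - δ) (𝓝[>] 0) (𝓝 (1 - 0)) := h0.const_sub 1
    rw [sub_zero] at this
    exact this.eventually_const_lt ha1
  have e2 : ∀ g ∈ G, ∀ᶠ δ : ℝ in 𝓝[>] 0, δ * ‖g‖ < ε / 2 := by
    intro g _
    have := h0.mul_const ‖g‖
    rw [zero_mul] at this
    exact this.eventually_lt_const (by positivity)
  obtain ⟨δ, ⟨h1, h2⟩, hδ⟩ := ((e1.and ((Finset.eventually_all G).mpr e2)).and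
    self_mem_nhdsWithin).exists
  have hδ : 0 < δ := hδ
  have hp : 0 < 1 - δ := (norm_nonneg a).trans_lt h1
  obtain ⟨u, k1, k2, k3, k4⟩ := qc f hid ((1 - δ)⁻¹ • a)
    (smul_nonneg (inv_nonneg.mpr hp.le) ha)
    (by rw [norm_smul, norm_inv, Real.norm_of_nonneg hp.le, inv_mul_lt_iff₀ hp]; linarith)
    F G (ε / 2) (by positivity)
  refine ⟨(1 - δ) • u, ?_, ?_, ?_, ?_⟩
  · have := smul_le_smul_of_nonneg_left k1 hp.le
    rwa [smul_smul, mul_inv_cancel₀ hp.ne', one_smul] at this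
  · rw [norm_smul, Real.norm_of_nonneg hp.le]; nlinarith [norm_nonneg u]
  · intro x hx
    have e : f ((1 - δ) • u) * x - x * f ((1 - δ) • u)
        = (((1 - δ : ℝ) : ℂ)) • (f u * x - x * f u) := by
      rw [← Complex.coe_smul, map_smul, smul_mul_assoc, mul_smul_comm, smul_sub]
    rw [e, norm_smul, Complex.norm_real, Real.norm_of_nonneg hp.le]
    have := k3 x hx
    nlinarith [norm_nonneg (f u * x - x * f u)]
  · intro g hg
    have e : ((1 - δ) • u) * g - g = (1 - δ) • (u * g - g) - δ • g := by
      rw [smul_sub, smul_mul_assoc, sub_smul 1 δ g, one_smul]; abel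
    rw [e]
    refine (norm_sub_le _ _).trans_lt ?_
    rw [norm_smul, norm_smul, Real.norm_of_nonneg hp.le, Real.norm_of_nonneg hδ.le]
    have := k4 g hg
    have := h2 g hg
    nlinarith [norm_nonneg (u * g - g)]
end qc

lemma summable_geo {x : ℕ → ℝ} (C : ℝ) (N : ℕ) (h0 : ∀ n, 0 ≤ x n)
    (h : ∀ n, N ≤ n → x n ≤ C * (1 / 2) ^ n) : Summable x := by
  refine (summable_nat_add_iff N).mp ?_
  refine Summable.of_nonneg_of_le (fun n => h0 _) (fun n => h (n + N) (by omega)) ?_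
  exact (summable_nat_add_iff N).mpr (summable_geometric_two.mul_left C)

theorem seqB {B : Type} [NonUnitalCStarAlgebra B] (b : ℕ → B)
    (hb : ∀ y : B, y ∈ closure ((Submodule.span ℂ {y : B | ∃ k c, y = b k * c} : Submodule ℂ B) : Set B))
    (z : ℕ → 𝓜(ℂ, B)) :
    ∃ u d : ℕ → B, u 0 = 0 ∧ (∀ n, ‖u n‖ ≤ 1) ∧ (∀ n, star (u n) = u n) ∧ (∀ n, star (d n) = d n) ∧
      (∀ n, d n * d n = u (n + 1) - u n) ∧ (∀ k, Summable fun n => ‖d n * b k‖) ∧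
      (∀ k, Summable fun n => ‖kap B (d n * d n) * z k - z k * kap B (d n * d n)‖) ∧
      (∀ k, Tendsto (fun n => kap B (u n) * z k - z k * kap B (u n)) atTop (𝓝 0)) ∧
      ∀ y, Tendsto (fun n => u n * y) atTop (𝓝 y) := by
  classical
  let _ := CStarAlgebra.spectralOrder B
  have _ := CStarAlgebra.spectralOrderedRing B
  let S := {a : B // 0 ≤ a ∧ ‖a‖ < 1}
  have step : ∀ (n : ℕ) (a : S), ∃ a' : S, a.1 ≤ a'.1 ∧
      (∀ k ≤ n, ‖kap B a'.1 * z k - z k * kap B a'.1‖ < (1 / 2) ^ n) ∧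
      (∀ k ≤ n, ‖a'.1 * b k - b k‖ < (1 / 4) ^ n) := by
    intro n a
    obtain ⟨u, h1, h2, h3, h4⟩ := qc' (kap B) (fun j x => ⟨_, (kap_mul x j).symm⟩) a.1 a.2.1 a.2.2
      ((Finset.range (n + 1)).image z) ((Finset.range (n + 1)).image b) ((1 / 4) ^ n) (by positivity)
    refine ⟨⟨u, a.2.1.trans h1, h2⟩, h1, fun k hk => ?_, fun k hk => ?_⟩
    · refine (h3 (z k) (Finset.mem_image_of_mem _ (by simp; omega))).trans_le ?_
      gcongr; norm_num
    · exact h4 (b k) (Finset.mem_image_of_mem _ (by simp; omega))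
  choose nx hn1 hn2 hn3 using step
  let u' : ℕ → S := fun n => Nat.rec ⟨0, le_rfl, by simp⟩ (fun n a => nx n a) n
  have hu's : ∀ n, u' (n + 1) = nx n (u' n) := fun n => rfl
  let u : ℕ → B := fun n => (u' n).1
  have hmono : ∀ n, u n ≤ u (n + 1) := fun n => hn1 n (u' n)
  have hz : ∀ n, ∀ k ≤ n, ‖kap B (u (n + 1)) * z k - z k * kap B (u (n + 1))‖ < (1 / 2) ^ n :=
    fun n => hn2 n (u' n)
  have hbb : ∀ n, ∀ k ≤ n, ‖u (n + 1) * b k - b k‖ < (1 / 4) ^ n :=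
    fun n => hn3 n (u' n)
  have hu1 : ∀ n, ‖u n‖ ≤ 1 := fun n => (u' n).2.2.le
  have hus : ∀ n, star (u n) = u n := fun n => (IsSelfAdjoint.of_nonneg (u' n).2.1)
  have hd : ∀ n, ∃ d : B, star d = d ∧ d * d = u (n + 1) - u n := by
    intro n
    refine ⟨CFC.sqrt (u (n + 1) - u n), IsSelfAdjoint.of_nonneg (CFC.sqrt_nonneg _), ?_⟩
    exact CFC.sqrt_mul_sqrt_self _ (sub_nonneg.mpr (hmono n))
  choose d hd1 hd2 using hd
  have hzs : ∀ k, Summable fun n => ‖kap B (u n) * z k - z k * kap B (u n)‖ := by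
    intro k
    refine summable_geo 2 (k + 1) (fun _ => norm_nonneg _) fun n hn => ?_
    obtain ⟨m, rfl⟩ : ∃ m, n = m + 1 := ⟨n - 1, by omega⟩
    refine (hz m k (by omega)).le.trans ?_
    rw [pow_succ]; linarith
  refine ⟨u, d, rfl, hu1, hus, hd1, hd2, ?_, ?_, ?_, ?_⟩
  · intro k
    refine summable_geo (4 * ‖b k‖ + 4) (k + 1) (fun _ => norm_nonneg _) fun n hn => ?_
    obtain ⟨m, rfl⟩ : ∃ m, n = m + 1 := ⟨n - 1, by omega⟩
    have e : ‖d (m + 1) * b k‖ ^ 2 ≤ ‖b k‖ * (2 * (1 / 4) ^ m) := by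
      rw [pow_two, ← CStarRing.norm_star_mul_self, star_mul, hd1, mul_assoc, ← mul_assoc (d _) (d _),
        hd2]
      refine (norm_mul_le _ _).trans ?_
      rw [norm_star]
      gcongr
      have : (u (m + 1 + 1) - u (m + 1)) * b k = (u (m + 1 + 1) * b k - b k) - (u (m + 1) * b k - b k) := by
        rw [sub_mul]; abel
      rw [this]
      refine (norm_sub_le _ _).trans ?_
      have a1 := hbb (m + 1) k (by omega)
      have a2 := hbb m k (by omega)
      have : (1 / 4 : ℝ) ^ (m + 1) ≤ (1 / 4) ^ m := by
        rw [pow_succ]; have : (0:ℝ) < (1/4)^m := by positivity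
        linarith
      linarith
    refine (pow_le_pow_iff_left₀ (norm_nonneg _) (by positivity) two_ne_zero).mp (e.trans ?_)
    rw [mul_pow, ← pow_mul, mul_comm (m + 1) 2, pow_mul]
    rw [show ((1 / 2 : ℝ) ^ 2) = 1 / 4 by norm_num, pow_succ (1 / 4 : ℝ) m]
    have h4 : (0 : ℝ) < (1 / 4) ^ m := by positivity
    have hb0 := norm_nonneg (b k)
    have : ‖b k‖ * 2 ≤ (4 * ‖b k‖ + 4) ^ 2 * (1 / 4) := by nlinarith
    nlinarith
  · intro k
    refine Summable.of_nonneg_of_le (fun _ => norm_nonneg _) (fun n => ?_)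
      (((summable_nat_add_iff 1).mpr (hzs k)).add (hzs k))
    rw [hd2]
    have : kap B (u (n + 1) - u n) * z k - z k * kap B (u (n + 1) - u n)
      = (kap B (u (n + 1)) * z k - z k * kap B (u (n + 1))) - (kap B (u n) * z k - z k * kap B (u n)) := by
      rw [map_sub, sub_mul, mul_sub]; abel
    rw [this]
    exact norm_sub_le _ _
  · intro k
    exact squeeze_zero_norm (fun n => le_rfl) (hzs k).tendsto_atTop_zero
  · intro y
    have hS : ∀ y ∈ Submodule.span ℂ {y : B | ∃ k c, y = b k * c},
        Tendsto (fun n => u n * y) atTop (𝓝 y) := by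
      intro y hy
      induction hy using Submodule.span_induction with
      | mem x hx =>
        obtain ⟨k, c, rfl⟩ := hx
        have : Tendsto (fun n => u n * b k) atTop (𝓝 (b k)) := by
          rw [← tendsto_sub_nhds_zero_iff]
          refine squeeze_zero_norm (fun n => le_rfl) ?_
          refine Summable.tendsto_atTop_zero ?_
          refine summable_geo 4 (k + 1) (fun _ => norm_nonneg _) fun n hn => ?_
          obtain ⟨m, rfl⟩ : ∃ m, n = m + 1 := ⟨n - 1, by omega⟩
          refine (hbb m k (by omega)).le.trans ?_
          rw [pow_succ]
          have : (1 / 4 : ℝ) ^ m ≤ (1 / 2) ^ m := by gcongr; norm_num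
          have h3 : (0 : ℝ) < (1 / 2) ^ m := by positivity
          linarith
        simpa only [mul_assoc] using this.mul_const c
      | zero => simp
      | add x y _ _ hx hy => simpa only [mul_add] using hx.add hy
      | smul c x _ hx => simpa only [mul_smul_comm] using hx.const_smul c
    rw [Metric.tendsto_nhds]
    intro ε hε
    obtain ⟨x, hx, hxy⟩ := Metric.mem_closure_iff.mp (hb y) (ε / 3) (by positivity)
    filter_upwards [Metric.tendsto_nhds.mp (hS x hx) (ε / 3) (by positivity)] with n hn
    have : dist (u n * y) (u n * x) < ε / 3 := by
      rw [dist_eq_norm, ← mul_sub]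
      refine (norm_mul_le _ _).trans_lt ?_
      rw [← dist_eq_norm]
      have := hu1 n
      nlinarith [dist_nonneg (x := y) (y := x), norm_nonneg (u n)]
    have := dist_triangle4 (u n * y) (u n * x) x y
    rw [dist_comm x y] at this
    linarith
end S6
end

noncomputable section
open scoped MultiplierAlgebra
open Filter Topology
namespace S6

lemma cs {Q : Type} [NonUnitalCStarAlgebra Q] (x y : ℕ → Q) (N : ℕ) :
    ‖∑ n ∈ Finset.range N, y n * star (x n)‖ ^ 2 ≤
      ‖∑ n ∈ Finset.range N, x n * star (x n)‖ * ‖∑ n ∈ Finset.range N, y n * star (y n)‖ := by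
  let _ := CStarAlgebra.spectralOrder Q
  have _ := CStarAlgebra.spectralOrderedRing Q
  let X : WithCStarModule Q (Fin N → Q) := (WithCStarModule.equiv Q (Fin N → Q)).symm (fun i => x i)
  let Y : WithCStarModule Q (Fin N → Q) := (WithCStarModule.equiv Q (Fin N → Q)).symm (fun i => y i)
  have h := CStarModule.norm_inner_le (A := Q) (WithCStarModule Q (Fin N → Q)) (x := X) (y := Y)
  have h1 := CStarModule.norm_sq_eq Q (x := X)
  have h2 := CStarModule.norm_sq_eq Q (x := Y)
  rw [WithCStarModule.pi_inner] at h h1 h2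
  simp only [WithCStarModule.inner_def] at h h1 h2
  simp only [Finset.sum_range]
  have hX : ∀ i, X i = x i := fun _ => rfl
  have hY : ∀ i, Y i = y i := fun _ => rfl
  simp only [hX, hY] at h h1 h2
  rw [← h1, ← h2, ← mul_pow]
  exact pow_le_pow_left₀ (norm_nonneg _) h 2

section T
variable {B Q : Type} [NonUnitalCStarAlgebra B] [NonUnitalCStarAlgebra Q]

def tau (i1 i2 : B →⋆ₙₐ[ℂ] Q) (d : ℕ → B) (W : ℕ → Q) (n : ℕ) : Q :=
  i1 (d n) * (i2 (d n) - W n * i2 (d n))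

def TN (i1 i2 : B →⋆ₙₐ[ℂ] Q) (d : ℕ → B) (W : ℕ → Q) (N : ℕ) : Q :=
  ∑ n ∈ Finset.range N, tau i1 i2 d W n

structure Good (i1 i2 : B →⋆ₙₐ[ℂ] Q) (d b : ℕ → B) (z : ℕ → 𝓜(ℂ, B)) (W : ℕ → Q) : Prop where
  sW : ∀ n, star (W n) = W n
  nW : ∀ n, ‖W n‖ ≤ 1
  c1 : ∀ n, ∀ k ≤ n, ‖W n * (i2 (d n) * (i1 (b k) - i2 (b k))) - (i2 (d n) * (i1 (b k) - i2 (b k)))‖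
    ≤ (1 / 2) ^ n
  c2 : ∀ n, ∀ k ≤ n, ‖W n * (i1 (d n) * i2 ((z k).snd (d n)) - i1 (d n * (z k).snd (d n))) -
    (i1 (d n) * i2 ((z k).snd (d n)) - i1 (d n * (z k).snd (d n)))‖ ≤ (1 / 2) ^ n
  c3 : ∀ n, ∀ k ≤ n, ‖W n * (i1 ((z k).fst (d n)) * i2 (d n) - i1 ((z k).fst (d n) * d n)) -
    (i1 ((z k).fst (d n)) * i2 (d n) - i1 ((z k).fst (d n) * d n))‖ ≤ (1 / 2) ^ n
  c4 : ∀ n, ‖W n * i1 (d n) - i1 (d n) * W n‖ ≤ (1 / 2) ^ n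
  c5 : ∀ n, ∀ k ≤ n, ‖W n * i1 ((z k).fst (d n)) - i1 ((z k).fst (d n)) * W n‖ ≤ (1 / 2) ^ n

variable {i1 i2 : B →⋆ₙₐ[ℂ] Q} {d b u : ℕ → B} {z : ℕ → 𝓜(ℂ, B)} {W : ℕ → Q}

lemma tau_star (hd : ∀ n, star (d n) = d n) (hW : ∀ n, star (W n) = W n) (n : ℕ) :
    star (tau i1 i2 d W n) = tau i2 i1 d W n := by
  unfold tau
  rw [star_mul, star_sub, star_mul, ← map_star, ← map_star, hd, hW, sub_mul, mul_sub, mul_assoc]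

lemma TN_star (hd : ∀ n, star (d n) = d n) (hW : ∀ n, star (W n) = W n) (n : ℕ) :
    star (TN i1 i2 d W n) = TN i2 i1 d W n := by
  unfold TN
  rw [star_sum]
  exact Finset.sum_congr rfl fun n _ => tau_star hd hW n

lemma sum_dd (hu0 : u 0 = 0) (hdd : ∀ n, d n * d n = u (n + 1) - u n) (N : ℕ) :
    ∑ n ∈ Finset.range N, d n * d n = u N := by
  simp only [hdd]
  rw [Finset.sum_range_sub, hu0, sub_zero]

lemma norm_d (hu1 : ∀ n, ‖u n‖ ≤ 1) (hd : ∀ n, star (d n) = d n)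
    (hdd : ∀ n, d n * d n = u (n + 1) - u n) (n : ℕ) : ‖d n‖ ≤ 2 := by
  have h : ‖d n‖ * ‖d n‖ ≤ 2 := by
    rw [← CStarRing.norm_star_mul_self, hd, hdd]
    refine (norm_sub_le _ _).trans ?_
    linarith [hu1 n, hu1 (n + 1)]
  nlinarith [norm_nonneg (d n)]

lemma norm_TN (hu0 : u 0 = 0) (hu1 : ∀ n, ‖u n‖ ≤ 1) (hd : ∀ n, star (d n) = d n)
    (hdd : ∀ n, d n * d n = u (n + 1) - u n)
    (sW : ∀ n, star (W n) = W n) (nW : ∀ n, ‖W n‖ ≤ 1) (N : ℕ) :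
    ‖TN i1 i2 d W N‖ ≤ 2 := by
  let _ := CStarAlgebra.spectralOrder Q
  have _ := CStarAlgebra.spectralOrderedRing Q
  let x : ℕ → Q := fun n => i2 (d n) - i2 (d n) * W n
  have hx : ∀ n, star (x n) = i2 (d n) - W n * i2 (d n) := by
    intro n
    simp only [x]
    rw [star_sub, star_mul, ← map_star, hd, sW]
  have h := cs x (fun n => i1 (d n)) N
  simp only [hx] at h
  have e : ∀ n, star (i1 (d n)) = i1 (d n) := fun n => by rw [← map_star, hd]
  simp only [e] at h
  have e1 : ∑ n ∈ Finset.range N, i1 (d n) * i1 (d n) = i1 (u N) := by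
    simp only [← map_mul]
    rw [← map_sum, sum_dd hu0 hdd]
  rw [e1] at h
  have e2 : ‖∑ n ∈ Finset.range N, x n * (i2 (d n) - W n * i2 (d n))‖ ≤ 4 := by
    have k : ∀ n, x n * (i2 (d n) - W n * i2 (d n)) ≤ (4 : ℝ) • (i2 (d n * d n)) := by
      intro n
      have p1 : 0 ≤ (i2 (d n) + i2 (d n) * W n) * star (i2 (d n) + i2 (d n) * W n) :=
        mul_star_self_nonneg _
      have p2 := CStarAlgebra.star_right_conjugate_le_norm_smul (a := i2 (d n)) (b := W n * W n)
        (by rw [isSelfAdjoint_iff, star_mul, sW])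
      have p3 : ‖W n * W n‖ • (i2 (d n) * star (i2 (d n))) ≤ (1 : ℝ) • (i2 (d n) * star (i2 (d n))) := by
        refine smul_le_smul_of_nonneg_right ?_ (mul_star_self_nonneg _)
        refine (norm_mul_le _ _).trans ?_
        nlinarith [nW n, norm_nonneg (W n)]
      have p4 := p2.trans p3
      have es : star (i2 (d n)) = i2 (d n) := by rw [← map_star, hd]
      rw [es, one_smul] at p4
      rw [star_add, star_mul, es, sW] at p1
      rw [map_mul]
      rw [← sub_nonneg]
      rw [← sub_nonneg] at p4
      have : (4 : ℝ) • (i2 (d n) * i2 (d n)) - x n * (i2 (d n) - W n * i2 (d n))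
        = (i2 (d n) + i2 (d n) * W n) * (i2 (d n) + W n * i2 (d n)) +
          (2 : ℝ) • (i2 (d n) * i2 (d n) - i2 (d n) * (W n * W n) * i2 (d n)) := by
        simp only [x, add_mul, mul_add, sub_mul, mul_sub, mul_assoc, smul_sub]
        have : (4 : ℝ) • (i2 (d n) * i2 (d n)) = (2 : ℝ) • (i2 (d n) * i2 (d n)) +
          (i2 (d n) * i2 (d n) + i2 (d n) * i2 (d n)) := by
          rw [← two_smul ℝ (i2 (d n) * i2 (d n)), ← add_smul]; norm_num
        rw [this, two_smul ℝ (i2 (d n) * (W n * (W n * i2 (d n))))]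
        abel
      rw [this]
      exact add_nonneg p1 (smul_nonneg (by norm_num) p4)
    have k0 : ∀ n, 0 ≤ x n * (i2 (d n) - W n * i2 (d n)) := by
      intro n; rw [← hx]; exact mul_star_self_nonneg _
    have k1 : ∑ n ∈ Finset.range N, x n * (i2 (d n) - W n * i2 (d n)) ≤ (4 : ℝ) • i2 (u N) := by
      rw [← sum_dd hu0 hdd, map_sum, Finset.smul_sum]
      exact Finset.sum_le_sum fun n _ => k n
    refine (CStarAlgebra.norm_le_norm_of_nonneg_of_le (Finset.sum_nonneg fun n _ => k0 n) k1).trans ?_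
    rw [norm_smul]
    have := (NonUnitalStarAlgHom.norm_apply_le i2 (u N)).trans (hu1 N)
    norm_num
    linarith
  have e3 : ‖i1 (u N)‖ ≤ 1 := (NonUnitalStarAlgHom.norm_apply_le i1 (u N)).trans (hu1 N)
  have h' : ‖TN i1 i2 d W N‖ ^ 2 ≤ 4 := by
    refine h.trans ?_
    nlinarith [norm_nonneg (i1 (u N))]
  nlinarith [norm_nonneg (TN i1 i2 d W N)]

lemma conv_TN (hu0 : u 0 = 0) (hu1 : ∀ n, ‖u n‖ ≤ 1) (hd : ∀ n, star (d n) = d n)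
    (hdd : ∀ n, d n * d n = u (n + 1) - u n) (hs : ∀ k, Summable fun n => ‖d n * b k‖)
    (hb : ∀ y : B, y ∈ closure ((Submodule.span ℂ {y : B | ∃ k c, y = b k * c} : Submodule ℂ B) : Set B))
    (hgen : ∀ y : Q, y ∈ closure ((Submodule.span ℂ {y : Q | ∃ b c, y = i1 b * c ∨ y = i2 b * c} :
      Submodule ℂ Q) : Set Q))
    (G : Good i1 i2 d b z W) (y : Q) :
    ∃ y', Tendsto (fun N => TN i1 i2 d W N * y) atTop (𝓝 y') := by
  let S : Set Q := {y : Q | ∃ k c, y = i1 (b k) * c ∨ y = i2 (b k) * c}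
  have hnd := norm_d hu1 hd hdd
  have h1W : ∀ n y, ‖y - W n * y‖ ≤ 2 * ‖y‖ := by
    intro n y
    refine (norm_sub_le _ _).trans ?_
    have := norm_mul_le (W n) y
    nlinarith [G.nW n, norm_nonneg y]
  have hS : ∀ y, y ∈ closure ((Submodule.span ℂ S : Submodule ℂ Q) : Set Q) := by
    have hr : ∀ (i : B →⋆ₙₐ[ℂ] Q) (_ : ∀ k c, i (b k) * c ∈ S) (b' : B) (c : Q),
        i b' * c ∈ (Submodule.span ℂ S).topologicalClosure := by
      intro i hi b' c
      let L : B →ₗ[ℂ] Q :=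
        { toFun := fun b => i b * c
          map_add' := by intro a a'; rw [map_add, add_mul]
          map_smul' := by intro r a; rw [map_smul, smul_mul_assoc]; rfl }
      have hLc : Continuous L := (hom_cont i).mul continuous_const
      have hcl : IsClosed (L ⁻¹' ((Submodule.span ℂ S).topologicalClosure : Set Q)) :=
        (Submodule.isClosed_topologicalClosure _).preimage hLc
      have : b' ∈ L ⁻¹' ((Submodule.span ℂ S).topologicalClosure : Set Q) := by
        refine hcl.closure_subset_iff.mpr ?_ (hb b')
        have : Submodule.span ℂ {y : B | ∃ k c, y = b k * c} ≤
          ((Submodule.span ℂ S).topologicalClosure).comap L := by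
          rw [Submodule.span_le]
          rintro _ ⟨k, c', rfl⟩
          change i (b k * c') * c ∈ (Submodule.span ℂ S).topologicalClosure
          rw [map_mul, mul_assoc]
          exact Submodule.le_topologicalClosure _ (Submodule.subset_span (hi _ _))
        exact this
      exact this
    intro y
    have : (Submodule.span ℂ {y : Q | ∃ b c, y = i1 b * c ∨ y = i2 b * c}).topologicalClosure ≤
      (Submodule.span ℂ S).topologicalClosure := by
      refine Submodule.topologicalClosure_minimal _ ?_ (Submodule.isClosed_topologicalClosure _)
      rw [Submodule.span_le]
      rintro _ ⟨b', c, rfl | rfl⟩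
      · exact hr i1 (fun k c => ⟨k, c, Or.inl rfl⟩) b' c
      · exact hr i2 (fun k c => ⟨k, c, Or.inr rfl⟩) b' c
    exact this (hgen y)
  have key : ∀ y c : Q, Summable (fun n => ‖tau i1 i2 d W n * y‖) →
      ∃ y', Tendsto (fun N => TN i1 i2 d W N * (y * c)) atTop (𝓝 y') := by
    intro y c h
    have := (h.of_norm).hasSum.tendsto_sum_nat
    refine ⟨_, (this.mul_const c).congr fun N => ?_⟩
    rw [← mul_assoc, TN, Finset.sum_mul, Finset.sum_mul, Finset.sum_mul]
  have s2 : ∀ k, Summable (fun n => ‖tau i1 i2 d W n * i2 (b k)‖) := by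
    intro k
    refine Summable.of_nonneg_of_le (fun _ => norm_nonneg _) (fun n => ?_) ((hs k).mul_left 4)
    have e : tau i1 i2 d W n * i2 (b k) = i1 (d n) * (i2 (d n * b k) - W n * i2 (d n * b k)) := by
      simp only [tau, map_mul, mul_assoc, sub_mul]
    rw [e]
    refine (norm_mul_le _ _).trans ?_
    have a1 := h1W n (i2 (d n * b k))
    have a2 := NonUnitalStarAlgHom.norm_apply_le i2 (d n * b k)
    have a3 := (NonUnitalStarAlgHom.norm_apply_le i1 (d n)).trans (hnd n)
    calc _ ≤ 2 * (2 * ‖d n * b k‖) := by gcongr; linarith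
      _ = _ := by ring
  have s3 : ∀ k, Summable (fun n => ‖tau i1 i2 d W n * (i1 (b k) - i2 (b k))‖) := by
    intro k
    refine summable_geo 2 k (fun _ => norm_nonneg _) fun n hn => ?_
    have e : tau i1 i2 d W n * (i1 (b k) - i2 (b k)) =
      i1 (d n) * (i2 (d n) * (i1 (b k) - i2 (b k)) - W n * (i2 (d n) * (i1 (b k) - i2 (b k)))) := by
      simp only [tau, mul_assoc, sub_mul]
    rw [e]
    refine (norm_mul_le _ _).trans ?_
    have a3 := (NonUnitalStarAlgHom.norm_apply_le i1 (d n)).trans (hnd n)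
    have := G.c1 n k hn
    rw [norm_sub_rev] at this
    gcongr
  have s1 : ∀ k, Summable (fun n => ‖tau i1 i2 d W n * (i1 (b k))‖) := by
    intro k
    refine Summable.of_nonneg_of_le (fun _ => norm_nonneg _) (fun n => ?_) ((s3 k).add (s2 k))
    have : tau i1 i2 d W n * (i1 (b k)) = tau i1 i2 d W n * (i1 (b k) - i2 (b k)) +
      tau i1 i2 d W n * i2 (b k) := by rw [mul_sub]; abel
    rw [this]
    exact norm_add_le _ _
  refine conv_of_dense atTop (fun N => ContinuousLinearMap.mul ℂ Q (TN i1 i2 d W N)) 2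
    (fun N => (ContinuousLinearMap.opNorm_mul_apply_le ℂ Q _).trans
      (norm_TN hu0 hu1 hd hdd G.sW G.nW N)) S hS ?_ y
  rintro _ ⟨k, c, rfl | rfl⟩
  · exact key _ _ (s1 k)
  · exact key _ _ (s2 k)

end T
end S6
end

noncomputable section
open scoped MultiplierAlgebra
open Filter Topology
namespace S6
section T
variable {B Q q : Type} [NonUnitalCStarAlgebra B] [NonUnitalCStarAlgebra Q] [NonUnitalCStarAlgebra q]

structure KapOK (i1 i2 : B →⋆ₙₐ[ℂ] Q) (π : Q →⋆ₙₐ[ℂ] B) (u : ℕ → B) (T : 𝓜(ℂ, Q)) (z : 𝓜(ℂ, B))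
    (κ : Q) : Prop where
  pi0 : π κ = 0
  left : Tendsto (fun n => i1 (u n) * κ) atTop (𝓝 κ)
  right : Tendsto (fun n => κ * i2 (u n)) atTop (𝓝 κ)
  eq : ∀ c b, i1 c * T.fst (i2 (z.fst b)) - i1 (z.snd c) * T.fst (i2 b) = i1 c * κ * i2 b

variable {i1 i2 : B →⋆ₙₐ[ℂ] Q} {d b u : ℕ → B} {z : ℕ → 𝓜(ℂ, B)} {W : ℕ → Q}

/-- elements absorbing on the left -/
lemma absorb_closed (v : ℕ → Q) (hv : ∀ n, ‖v n‖ ≤ 1) :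
    IsClosed {y : Q | Tendsto (fun n => v n * y) atTop (𝓝 y)} := by
  rw [← isSeqClosed_iff_isClosed]
  intro x p hx hxp
  rw [Set.mem_ofPred_eq, Metric.tendsto_nhds]
  intro ε hε
  obtain ⟨m, hm⟩ := ((Metric.tendsto_nhds.mp hxp) (ε / 3) (by positivity)).exists
  filter_upwards [Metric.tendsto_nhds.mp (hx m) (ε / 3) (by positivity)] with n hn
  have : dist (v n * p) (v n * x m) < ε / 3 := by
    rw [dist_eq_norm, ← mul_sub]
    refine (norm_mul_le _ _).trans_lt ?_
    rw [← dist_eq_norm, dist_comm]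
    have := hv n
    nlinarith [dist_nonneg (x := x m) (y := p), norm_nonneg (v n)]
  have := dist_triangle4 (v n * p) (v n * x m) (x m) p
  linarith

lemma absorb_mul (i : B →⋆ₙₐ[ℂ] Q) (hu : ∀ y, Tendsto (fun n => u n * y) atTop (𝓝 y)) (b : B) (c : Q) :
    Tendsto (fun n => i (u n) * (i b * c)) atTop (𝓝 (i b * c)) := by
  have := (((hom_cont i).tendsto _).comp (hu b)).mul_const c
  refine this.congr fun n => ?_
  simp only [Function.comp, map_mul, mul_assoc]

lemma TN_absorb (hu : ∀ y, Tendsto (fun n => u n * y) atTop (𝓝 y)) (N : ℕ) (c : Q) :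
    Tendsto (fun n => i1 (u n) * (TN i1 i2 d W N * c)) atTop (𝓝 (TN i1 i2 d W N * c)) := by
  have : Tendsto (fun n => ∑ m ∈ Finset.range N, i1 (u n) * (tau i1 i2 d W m * c)) atTop
    (𝓝 (∑ m ∈ Finset.range N, tau i1 i2 d W m * c)) := by
    refine tendsto_finsetSum _ fun m _ => ?_
    simp only [tau, mul_assoc]
    exact absorb_mul i1 hu _ _
  simpa only [TN, Finset.sum_mul, Finset.mul_sum] using this

lemma exists_kappa (π : Q →⋆ₙₐ[ℂ] B) (h1 : ∀ b, π (i1 b) = b) (h2 : ∀ b, π (i2 b) = b)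
    (hW0 : ∀ n, π (W n) = 0)
    (hu0 : u 0 = 0) (hu1 : ∀ n, ‖u n‖ ≤ 1) (hus : ∀ n, star (u n) = u n) (hd : ∀ n, star (d n) = d n)
    (hdd : ∀ n, d n * d n = u (n + 1) - u n)
    (hz1 : ∀ k, Summable fun n => ‖kap B (d n * d n) * z k - z k * kap B (d n * d n)‖)
    (hz2 : ∀ k, Tendsto (fun n => kap B (u n) * z k - z k * kap B (u n)) atTop (𝓝 0))
    (hu : ∀ y, Tendsto (fun n => u n * y) atTop (𝓝 y))
    (G : Good i1 i2 d b z W) (T : 𝓜(ℂ, Q))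
    (hT : ∀ y, Tendsto (fun N => TN i1 i2 d W N * y) atTop (𝓝 (T.fst y))) (k : ℕ) :
    ∃ κ, KapOK i1 i2 π u T (z k) κ := by
  have hnd := norm_d hu1 hd hdd
  have h1W : ∀ n y, ‖y - W n * y‖ ≤ 2 * ‖y‖ := by
    intro n y
    refine (norm_sub_le _ _).trans ?_
    have := norm_mul_le (W n) y
    nlinarith [G.nW n, norm_nonneg y]
  let kn : ℕ → Q := fun n => i1 (d n) * (i2 ((z k).snd (d n)) - W n * i2 ((z k).snd (d n))) -
    i1 ((z k).fst (d n)) * (i2 (d n) - W n * i2 (d n))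
  have hmm : ∀ n, kap B (d n * (z k).snd (d n) - (z k).fst (d n) * d n) =
      kap B (d n * d n) * z k - z k * kap B (d n * d n) := by
    intro n
    rw [map_sub, map_mul (kap B), map_mul (kap B), ← kap_mul, ← mul_kap, map_mul (kap B)]
    simp only [mul_assoc]
  have hsum : Summable (fun n => ‖kn n‖) := by
    have hs : Summable (fun n => 2 * ‖kap B (d n * d n) * z k - z k * kap B (d n * d n)‖ +
      (‖kn n‖ - 2 * ‖kap B (d n * d n) * z k - z k * kap B (d n * d n)‖ ) ⊔ 0) := by
      refine ((hz1 k).mul_left 2).add ?_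
      refine summable_geo (2 * ‖z k‖ + 4) k (fun _ => le_sup_right) fun n hn => ?_
      refine sup_le ?_ (by positivity)
      rw [sub_le_iff_le_add, ← hmm, norm_kap]
      set p := d n
      set r := (z k).snd p with hr
      set l := (z k).fst p with hl
      have e : kn n = (W n * i1 p - i1 p * W n) * i2 r
          - (W n * (i1 p * i2 r - i1 (p * r)) - (i1 p * i2 r - i1 (p * r)))
          - (W n * i1 l - i1 l * W n) * i2 p
          + (W n * (i1 l * i2 p - i1 (l * p)) - (i1 l * i2 p - i1 (l * p)))
          + (i1 (p * r - l * p) - W n * i1 (p * r - l * p)) := by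
        simp only [kn, mul_sub, sub_mul, mul_assoc, map_sub]
        change i1 p * i2 r - i1 p * (W n * i2 r) - (i1 l * i2 p - i1 l * (W n * i2 p)) = _
        abel
      rw [e]
      have b1 : ‖(W n * i1 p - i1 p * W n) * i2 r‖ ≤ (1 / 2) ^ n * (2 * ‖z k‖) := by
        refine (norm_mul_le _ _).trans ?_
        have h9 := G.c4 n
        have : ‖i2 r‖ ≤ 2 * ‖z k‖ := by
          refine (NonUnitalStarAlgHom.norm_apply_le i2 r).trans ((norm_snd_le _ _).trans ?_)
          rw [mul_comm]; gcongr; exact hnd n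
        gcongr
      have b3 : ‖(W n * i1 l - i1 l * W n) * i2 p‖ ≤ (1 / 2) ^ n * 2 := by
        refine (norm_mul_le _ _).trans ?_
        have : ‖i2 p‖ ≤ 2 := (NonUnitalStarAlgHom.norm_apply_le i2 p).trans (hnd n)
        gcongr; exact G.c5 n k hn
      have b2 := G.c2 n k hn
      have b4 := G.c3 n k hn
      have b5 : ‖i1 (p * r - l * p) - W n * i1 (p * r - l * p)‖ ≤ 2 * ‖p * r - l * p‖ := by
        refine (h1W n _).trans ?_
        gcongr; exact NonUnitalStarAlgHom.norm_apply_le i1 _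
      refine (norm_add_le _ _).trans ?_
      refine (add_le_add ((norm_add_le _ _).trans (add_le_add ((norm_sub_le _ _).trans
        (add_le_add ((norm_sub_le _ _).trans (add_le_add b1 b2)) b3)) b4)) b5).trans ?_
      linarith
    refine Summable.of_nonneg_of_le (fun _ => norm_nonneg _) (fun n => ?_) hs
    have := le_sup_left (a := ‖kn n‖ - 2 * ‖kap B (d n * d n) * z k - z k * kap B (d n * d n)‖) (b := (0:ℝ))
    linarith
  have hlim := hsum.of_norm.hasSum.tendsto_sum_nat
  refine ⟨∑' n, kn n, ?_, ?_, ?_, ?_⟩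
  · have a1 := ((hom_cont π).tendsto _).comp hlim
    have a2 : Tendsto (π ∘ fun n => ∑ i ∈ Finset.range n, kn i) atTop (𝓝 0) := by
      have hz := hz2 k
      rw [tendsto_zero_iff_norm_tendsto_zero] at hz ⊢
      refine hz.congr fun N => ?_
      rw [Function.comp, ← norm_kap (π _), map_sum, map_sum, ← sum_dd hu0 hdd, map_sum, Finset.sum_mul, Finset.mul_sum,
        ← Finset.sum_sub_distrib]
      congr 1
      refine Finset.sum_congr rfl fun n _ => ?_
      rw [← hmm]
      congr 1
      simp only [kn, map_sub, map_mul, h1, h2, hW0, zero_mul, sub_zero]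
    exact tendsto_nhds_unique a1 a2
  · refine (absorb_closed (fun n => i1 (u n)) (fun n => (NonUnitalStarAlgHom.norm_apply_le i1 _).trans (hu1 n))).mem_of_tendsto
      hlim (Eventually.of_forall fun N => ?_)
    have : Tendsto (fun n => ∑ m ∈ Finset.range N, i1 (u n) * kn m) atTop
      (𝓝 (∑ m ∈ Finset.range N, kn m)) := by
      refine tendsto_finsetSum _ fun m _ => ?_
      simp only [kn, mul_sub (i1 (u _))]
      exact (absorb_mul i1 hu _ _).sub (absorb_mul i1 hu _ _)
    simpa only [Finset.mul_sum, Set.mem_ofPred_eq] using this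
  · have hc : star (∑' n, kn n) ∈ {y : Q | Tendsto (fun n => i2 (u n) * y) atTop (𝓝 y)} := by
      refine (absorb_closed (fun n => i2 (u n)) (fun n => (NonUnitalStarAlgHom.norm_apply_le i2 _).trans (hu1 n))).mem_of_tendsto
        hlim.star (Eventually.of_forall fun N => ?_)
      have : Tendsto (fun n => ∑ m ∈ Finset.range N, i2 (u n) * star (kn m)) atTop
        (𝓝 (∑ m ∈ Finset.range N, star (kn m))) := by
        refine tendsto_finsetSum _ fun m _ => ?_
        have e : ∀ (x : Q) (y : B), star (x * (i2 y - W m * i2 y)) = i2 (star y) * ((star x) - W m * star x) := by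
          intro x y
          rw [star_mul, star_sub, star_mul, G.sW, map_star, sub_mul, mul_sub, mul_assoc]
        simp only [kn, star_sub, e, mul_sub (i2 (u _))]
        exact (absorb_mul i2 hu _ _).sub (absorb_mul i2 hu _ _)
      simpa only [Finset.mul_sum, star_sum, Set.mem_ofPred_eq] using this
    have := (show Tendsto (fun n => i2 (u n) * star (∑' n, kn n)) atTop (𝓝 (star (∑' n, kn n))) from hc).star
    rw [star_star] at this
    refine this.congr fun n => ?_
    rw [star_mul, star_star, ← map_star, hus]
  · intro c b'
    have t1 := ((hT (i2 ((z k).fst b'))).const_mul (i1 c)).sub ((hT (i2 b')).const_mul (i1 ((z k).snd c)))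
    have t2 := (hlim.const_mul (i1 c)).mul_const (i2 b')
    refine tendsto_nhds_unique t1 (t2.congr fun N => ?_)
    simp only [TN, Finset.sum_mul, Finset.mul_sum]
    rw [← Finset.sum_sub_distrib]
    refine Finset.sum_congr rfl fun n _ => ?_
    have f1 : (z k).snd (d n) * b' = d n * (z k).fst b' := (z k).central _ _
    have f2 : c * (z k).fst (d n) = (z k).snd c * d n := ((z k).central _ _).symm
    have g1 : i2 ((z k).snd (d n)) * i2 b' = i2 (d n) * i2 ((z k).fst b') := by
      rw [← map_mul, f1, map_mul]
    have g2 : i1 c * i1 ((z k).fst (d n)) = i1 ((z k).snd c) * i1 (d n) := by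
      rw [← map_mul, f2, map_mul]
    have g2' : ∀ x, i1 c * (i1 ((z k).fst (d n)) * x) = i1 ((z k).snd c) * (i1 (d n) * x) := by
      intro x; rw [← mul_assoc, g2, mul_assoc]
    simp only [kn, tau, mul_sub, sub_mul, mul_assoc, g1, g2']

theorem exists_T (π : Q →⋆ₙₐ[ℂ] B) (h1 : ∀ b, π (i1 b) = b) (h2 : ∀ b, π (i2 b) = b)
    (j : q →⋆ₙₐ[ℂ] Q) (hr : Set.range j = {z : Q | π z = 0}) (b : ℕ → B) (z : ℕ → 𝓜(ℂ, B))
    (hb : ∀ y : B, y ∈ closure ((Submodule.span ℂ {y : B | ∃ k c, y = b k * c} : Submodule ℂ B) : Set B))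
    (hgen : ∀ y : Q, y ∈ closure ((Submodule.span ℂ {y : Q | ∃ b c, y = i1 b * c ∨ y = i2 b * c} :
      Submodule ℂ Q) : Set Q)) :
    ∃ (u : ℕ → B) (T : 𝓜(ℂ, Q)), (∀ n, ‖u n‖ ≤ 1) ∧ (∀ n, star (u n) = u n) ∧
      (∀ y, Tendsto (fun n => u n * y) atTop (𝓝 y)) ∧ (∀ y, π (T.fst y) = π y) ∧
      (∀ y, Tendsto (fun n => i1 (u n) * T.fst y) atTop (𝓝 (T.fst y))) ∧
      (∀ y, Tendsto (fun n => i2 (u n) * (star T).fst y) atTop (𝓝 ((star T).fst y))) ∧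
      ∀ k, (∃ κ, KapOK i1 i2 π u T (z k) κ) ∧ ∃ κ, KapOK i2 i1 π u (star T) (z k) κ := by
  classical
  obtain ⟨u, d, hu0, hu1, hus, hd, hdd, hs, hz1, hz2, hu⟩ := seqB b hb z
  have hker : ∀ x, π x = 0 → ∃ w, j w = x := by
    intro x hx
    have : x ∈ Set.range j := by rw [hr]; exact hx
    exact this
  have hj0 : ∀ w, π (j w) = 0 := by
    intro w
    have : j w ∈ {z : Q | π z = 0} := by rw [← hr]; exact ⟨w, rfl⟩
    exact this
  let _ := CStarAlgebra.spectralOrder q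
  have _ := CStarAlgebra.spectralOrderedRing q
  let g1 : (B →⋆ₙₐ[ℂ] Q) → (B →⋆ₙₐ[ℂ] Q) → ℕ → ℕ → Q := fun i1 i2 n k => i2 (d n) * (i1 (b k) - i2 (b k))
  let g2 : (B →⋆ₙₐ[ℂ] Q) → (B →⋆ₙₐ[ℂ] Q) → ℕ → ℕ → Q := fun i1 i2 n k =>
    i1 (d n) * i2 ((z k).snd (d n)) - i1 (d n * (z k).snd (d n))
  let g3 : (B →⋆ₙₐ[ℂ] Q) → (B →⋆ₙₐ[ℂ] Q) → ℕ → ℕ → Q := fun i1 i2 n k =>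
    i1 ((z k).fst (d n)) * i2 (d n) - i1 ((z k).fst (d n) * d n)
  have hw : ∀ n, ∃ w : q, 0 ≤ w ∧ ‖w‖ ≤ 1 ∧
      (∀ x, (x = i1 (d n) ∨ x = i2 (d n) ∨ ∃ k ≤ n, x = i1 ((z k).fst (d n)) ∨ x = i2 ((z k).fst (d n))) →
        ‖j w * x - x * j w‖ < (1 / 2) ^ n) ∧
      (∀ x, (∃ k ≤ n, x = g1 i1 i2 n k ∨ x = g1 i2 i1 n k ∨ x = g2 i1 i2 n k ∨ x = g2 i2 i1 n k ∨
        x = g3 i1 i2 n k ∨ x = g3 i2 i1 n k) → ‖j w * x - x‖ < (1 / 2) ^ n) := by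
    intro n
    let R := Finset.range (n + 1)
    let F : Finset Q := {i1 (d n), i2 (d n)} ∪ R.image (fun k => i1 ((z k).fst (d n))) ∪
      R.image (fun k => i2 ((z k).fst (d n)))
    let G' : Finset Q := R.image (g1 i1 i2 n) ∪ R.image (g1 i2 i1 n) ∪ R.image (g2 i1 i2 n) ∪
      R.image (g2 i2 i1 n) ∪ R.image (g3 i1 i2 n) ∪ R.image (g3 i2 i1 n)
    have hG' : ∀ g ∈ G', π g = 0 := by
      intro g hg
      simp only [G', Finset.mem_union, Finset.mem_image] at hg
      rcases hg with ((((⟨k, _, rfl⟩ | ⟨k, _, rfl⟩) | ⟨k, _, rfl⟩) | ⟨k, _, rfl⟩) | ⟨k, _, rfl⟩) | ⟨k, _, rfl⟩ <;>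
      simp only [g1, g2, g3, map_mul, map_sub, h1, h2, sub_self, mul_zero]
    let σ : Q → q := fun x => if h : π x = 0 then (hker x h).choose else 0
    have hσ : ∀ x, π x = 0 → j (σ x) = x := by
      intro x hx
      simp only [σ, dif_pos hx]
      exact (hker x hx).choose_spec
    obtain ⟨w, w1, w2, w3, w4⟩ := qc j (fun w x => by rw [hr]; change π _ = 0; rw [map_mul, hj0, zero_mul])
      0 le_rfl (by simp) F (G'.image σ) ((1 / 2) ^ n) (by positivity)
    refine ⟨w, w1, w2, fun x hx => w3 x ?_, fun x hx => ?_⟩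
    · simp only [F, R, Finset.mem_union, Finset.mem_image, Finset.mem_insert, Finset.mem_singleton,
        Finset.mem_range]
      rcases hx with rfl | rfl | ⟨k, hk, rfl | rfl⟩
      · tauto
      · tauto
      · exact Or.inl (Or.inr ⟨k, by omega, rfl⟩)
      · exact Or.inr ⟨k, by omega, rfl⟩
    · have hx' : x ∈ G' := by
        simp only [G', R, Finset.mem_union, Finset.mem_image, Finset.mem_range]
        obtain ⟨k, hk, hx⟩ := hx
        rcases hx with rfl | rfl | rfl | rfl | rfl | rfl
        · exact Or.inl (Or.inl (Or.inl (Or.inl (Or.inl ⟨k, by omega, rfl⟩))))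
        · exact Or.inl (Or.inl (Or.inl (Or.inl (Or.inr ⟨k, by omega, rfl⟩))))
        · exact Or.inl (Or.inl (Or.inl (Or.inr ⟨k, by omega, rfl⟩)))
        · exact Or.inl (Or.inl (Or.inr ⟨k, by omega, rfl⟩))
        · exact Or.inl (Or.inr ⟨k, by omega, rfl⟩)
        · exact Or.inr ⟨k, by omega, rfl⟩
      have := w4 (σ x) (Finset.mem_image_of_mem _ hx')
      refine lt_of_le_of_lt ?_ this
      have h9 := NonUnitalStarAlgHom.norm_apply_le j (w * σ x - σ x)
      rw [map_sub, map_mul, hσ x (hG' x hx')] at h9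
      exact h9
  choose w hw1 hw2 hw3 hw4 using hw
  let W : ℕ → Q := fun n => j (w n)
  have sW : ∀ n, star (W n) = W n := fun n => by
    simp only [W]; rw [← map_star, (IsSelfAdjoint.of_nonneg (hw1 n)).star_eq]
  have nW : ∀ n, ‖W n‖ ≤ 1 := fun n => (NonUnitalStarAlgHom.norm_apply_le j _).trans (hw2 n)
  have G1 : Good i1 i2 d b z W :=
    ⟨sW, nW, fun n k hk => (hw4 n _ ⟨k, hk, Or.inl rfl⟩).le,
      fun n k hk => (hw4 n _ ⟨k, hk, Or.inr (Or.inr (Or.inl rfl))⟩).le,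
      fun n k hk => (hw4 n _ ⟨k, hk, Or.inr (Or.inr (Or.inr (Or.inr (Or.inl rfl))))⟩).le,
      fun n => (hw3 n _ (Or.inl rfl)).le,
      fun n k hk => (hw3 n _ (Or.inr (Or.inr ⟨k, hk, Or.inl rfl⟩))).le⟩
  have G2 : Good i2 i1 d b z W :=
    ⟨sW, nW, fun n k hk => (hw4 n _ ⟨k, hk, Or.inr (Or.inl rfl)⟩).le,
      fun n k hk => (hw4 n _ ⟨k, hk, Or.inr (Or.inr (Or.inr (Or.inl rfl)))⟩).le,
      fun n k hk => (hw4 n _ ⟨k, hk, Or.inr (Or.inr (Or.inr (Or.inr (Or.inr rfl))))⟩).le,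
      fun n => (hw3 n _ (Or.inr (Or.inl rfl))).le,
      fun n k hk => (hw3 n _ (Or.inr (Or.inr ⟨k, hk, Or.inr rfl⟩))).le⟩
  have hgen' : ∀ y : Q, y ∈ closure ((Submodule.span ℂ {y : Q | ∃ b c, y = i2 b * c ∨ y = i1 b * c} :
      Submodule ℂ Q) : Set Q) := by
    intro y
    have := hgen y
    simp only [or_comm] at this ⊢
    exact this
  have C1 := conv_TN hu0 hu1 hd hdd hs hb hgen G1
  have C2 := conv_TN hu0 hu1 hd hdd hs hb hgen' G2
  have hW0 : ∀ n, π (W n) = 0 := fun n => hj0 _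
  obtain ⟨T, hT1, hT2⟩ := strict_limit atTop (fun N => kap Q (TN i1 i2 d W N)) 2
    (fun N => by rw [norm_kap]; exact norm_TN hu0 hu1 hd hdd sW nW N) C1 (by
      intro y
      obtain ⟨y', hy'⟩ := C2 (star y)
      refine ⟨star y', hy'.star.congr fun N => ?_⟩
      rw [star_mul, TN_star hd sW, star_star]
      rfl)
  have hT1' : ∀ y, Tendsto (fun N => TN i1 i2 d W N * y) atTop (𝓝 (T.fst y)) := hT1
  have hT2' : ∀ y, Tendsto (fun N => TN i2 i1 d W N * y) atTop (𝓝 ((star T).fst y)) := by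
    intro y
    rw [DoubleCentralizer.star_fst]
    have := (show Tendsto (fun N => star y * TN i1 i2 d W N) atTop (𝓝 (T.snd (star y))) from hT2 (star y)).star
    refine this.congr fun N => ?_
    rw [star_mul, TN_star hd sW, star_star]
  refine ⟨u, T, hu1, hus, hu, ?_, ?_, ?_, ?_⟩
  · intro y
    have a1 := ((hom_cont π).tendsto _).comp (hT1' y)
    refine tendsto_nhds_unique a1 ((hu (π y)).congr fun N => ?_)
    rw [Function.comp, map_mul, TN, map_sum, ← sum_dd hu0 hdd]
    congr 1
    refine Finset.sum_congr rfl fun n _ => ?_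
    simp only [tau, map_mul, map_sub, h1, h2, hW0, zero_mul, sub_zero]
  · intro y
    exact (absorb_closed (fun n => i1 (u n)) (fun n => (NonUnitalStarAlgHom.norm_apply_le i1 _).trans (hu1 n))).mem_of_tendsto
      (hT1' y) (Eventually.of_forall fun N => TN_absorb hu N y)
  · intro y
    exact (absorb_closed (fun n => i2 (u n)) (fun n => (NonUnitalStarAlgHom.norm_apply_le i2 _).trans (hu1 n))).mem_of_tendsto
      (hT2' y) (Eventually.of_forall fun N => TN_absorb hu N y)
  · intro k
    exact ⟨exists_kappa π h1 h2 hW0 hu0 hu1 hus hd hdd hz1 hz2 hu G1 T hT1' k,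
      exists_kappa π h2 h1 hW0 hu0 hu1 hus hd hdd hz1 hz2 hu G2 (star T) hT2' k⟩

end T
end S6
end

noncomputable section
open scoped MultiplierAlgebra
open Filter Topology
namespace S6

section free
variable {A Q E : Type} [NonUnitalCStarAlgebra A] [NonUnitalCStarAlgebra Q] [NonUnitalCStarAlgebra E]

lemma free_uniq (P : QPresentation A Q) (f g : Q →⋆ₙₐ[ℂ] E) (h1 : ∀ a, f (P.ι a) = g (P.ι a))
    (h2 : ∀ a, f (P.ιbar a) = g (P.ιbar a)) : f = g := by
  obtain ⟨h, _, hu⟩ := P.free E (g.comp P.ι) (g.comp P.ιbar)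
  rw [hu f ⟨NonUnitalStarAlgHom.ext h1, NonUnitalStarAlgHom.ext h2⟩, hu g ⟨rfl, rfl⟩]

lemma free_ex (P : QPresentation A Q) (f g : A →⋆ₙₐ[ℂ] E) :
    ∃ h : Q →⋆ₙₐ[ℂ] E, (∀ a, h (P.ι a) = f a) ∧ ∀ a, h (P.ιbar a) = g a := by
  obtain ⟨h, hh, _⟩ := P.free E f g
  exact ⟨h, fun a => by rw [← hh.1]; rfl, fun a => by rw [← hh.2]; rfl⟩

lemma gen_top (P : QPresentation A Q) (S : NonUnitalStarSubalgebra ℂ Q) (hS : IsClosed (S : Set Q))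
    (h1 : ∀ a, P.ι a ∈ S) (h2 : ∀ a, P.ιbar a ∈ S) (z : Q) : z ∈ S := by
  have : IsClosed (S : Set Q) := hS
  let f : A →⋆ₙₐ[ℂ] S := NonUnitalStarAlgHom.codRestrict P.ι S h1
  let g : A →⋆ₙₐ[ℂ] S := NonUnitalStarAlgHom.codRestrict P.ιbar S h2
  obtain ⟨h, hh1, hh2⟩ := free_ex P f g
  have : (NonUnitalStarSubalgebraClass.subtype S).comp h = NonUnitalStarAlgHom.id ℂ Q := by
    apply free_uniq P
    · intro a
      change ((h (P.ι a) : S) : Q) = _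
      rw [hh1]; rfl
    · intro a
      change ((h (P.ιbar a) : S) : Q) = _
      rw [hh2]; rfl
  have h3 := DFunLike.congr_fun this z
  change ((h z : S) : Q) = z at h3
  rw [← h3]; exact (h z).2

lemma gen_induct (P : QPresentation A Q) (p : Q → Prop) (hc : IsClosed {z | p z})
    (h1 : ∀ a, p (P.ι a)) (h2 : ∀ a, p (P.ιbar a))
    (hadd : ∀ x y, p x → p y → p (x + y)) (hmul : ∀ x y, p x → p y → p (x * y))
    (hsm : ∀ (c : ℂ) x, p x → p (c • x)) (hst : ∀ x, p x → p (star x)) (z : Q) : p z := by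
  let S : NonUnitalStarSubalgebra ℂ Q :=
    { carrier := {z | p z}
      add_mem' := fun {x y} hx hy => hadd x y hx hy
      zero_mem' := by
        have := hsm 0 _ (h1 0)
        rw [zero_smul] at this
        exact this
      mul_mem' := fun {x y} hx hy => hmul x y hx hy
      smul_mem' := fun c x hx => hsm c x hx
      star_mem' := fun {x} hx => hst x hx }
  exact gen_top P S hc h1 h2 z

lemma lift_hom {X Y Z : Type} [NonUnitalCStarAlgebra X] [NonUnitalCStarAlgebra Y] [NonUnitalCStarAlgebra Z]
    (f : X →⋆ₙₐ[ℂ] Y) (g : Z →⋆ₙₐ[ℂ] Y) (hg : Function.Injective g) (h : ∀ x, ∃ z, g z = f x) :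
    ∃ f' : X →⋆ₙₐ[ℂ] Z, ∀ x, g (f' x) = f x := by
  choose F hF using h
  refine ⟨{ toFun := F, map_add' := ?_, map_smul' := ?_, map_zero' := ?_, map_mul' := ?_, map_star' := ?_ }, hF⟩
  · intro c x; apply hg; simp [hF, map_smul]
  · apply hg; simp [hF]
  · intro x y; apply hg; simp [hF]
  · intro x y; apply hg; simp [hF]
  · intro x; apply hg; simp [hF, map_star]

lemma gen_span (P : QPresentation A Q) (y : Q) : y ∈ closure ((Submodule.span ℂ
    {y | ∃ (b : A) (c : Q), y = P.ι b * c ∨ y = P.ιbar b * c} : Submodule ℂ Q) : Set Q) := by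
  set V := Submodule.span ℂ {y | ∃ (b : A) (c : Q), y = P.ι b * c ∨ y = P.ιbar b * c} with hV
  let W := V.topologicalClosure
  have hVr : ∀ y ∈ V, ∀ c, y * c ∈ V := by
    intro y hy c
    induction hy using Submodule.span_induction with
    | mem x hx =>
      obtain ⟨b, d, h | h⟩ := hx
      · exact Submodule.subset_span ⟨b, d * c, Or.inl (by rw [h, mul_assoc])⟩
      · exact Submodule.subset_span ⟨b, d * c, Or.inr (by rw [h, mul_assoc])⟩
    | zero => rw [zero_mul]; exact V.zero_mem
    | add x y _ _ hx hy => rw [add_mul]; exact V.add_mem hx hy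
    | smul a x _ hx => rw [smul_mul_assoc]; exact V.smul_mem a hx
  have hWr : ∀ y ∈ W, ∀ c, y * c ∈ W := by
    intro y hy c
    have : Set.MapsTo (fun y => y * c) (V : Set Q) V := fun y hy => hVr y hy c
    exact this.closure (by fun_prop) hy
  have hWc : IsClosed (W : Set Q) := V.isClosed_topologicalClosure
  have hι : ∀ (i : A →⋆ₙₐ[ℂ] Q), (∀ b c, i b * c ∈ V) → ∀ a, i a ∈ W := by
    intro i hi a
    obtain ⟨l, hne, _, _, hu, hu2⟩ := exists_au A
    have h1 : Tendsto (fun n => i a * i n) l (𝓝 (i a)) := by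
      have := (hom_cont i).continuousAt.tendsto.comp (hu2 a)
      refine this.congr fun n => ?_
      simp
    exact hWc.mem_of_tendsto h1 (Eventually.of_forall fun n => V.le_topologicalClosure (hi _ _))
  have h1 := hι P.ι (fun b c => Submodule.subset_span ⟨b, c, Or.inl rfl⟩)
  have h2 := hι P.ιbar (fun b c => Submodule.subset_span ⟨b, c, Or.inr rfl⟩)
  have := gen_induct P (fun z => z ∈ W ∧ star z ∈ W)
    (hWc.inter (hWc.preimage continuous_star))
    (fun a => ⟨h1 a, by rw [← map_star P.ι]; exact h1 _⟩)
    (fun a => ⟨h2 a, by rw [← map_star P.ιbar]; exact h2 _⟩)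
    (fun x y hx hy => ⟨W.add_mem hx.1 hy.1, by rw [star_add]; exact W.add_mem hx.2 hy.2⟩)
    (fun x y hx hy => ⟨hWr _ hx.1 _, by rw [star_mul]; exact hWr _ hy.2 _⟩)
    (fun c x hx => ⟨W.smul_mem c hx.1, by rw [star_smul]; exact W.smul_mem _ hx.2⟩)
    (fun x hx => ⟨hx.2, by rw [star_star]; exact hx.1⟩) y
  exact this.1
end free
end S6
end

noncomputable section
open scoped MultiplierAlgebra
open Filter Topology
namespace S6

section sub
variable {𝓐 𝓑 : Type} [CStarAlgebra 𝓐] [NonUnitalCStarAlgebra 𝓑] (R : NonUnitalStarSubalgebra ℂ 𝓐) [hRc : IsClosed (R : Set 𝓐)]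

lemma exists_mlt (m : 𝓐) (h1 : ∀ r ∈ R, m * r ∈ R) (h2 : ∀ r ∈ R, r * m ∈ R) :
    ∃ W : 𝓜(ℂ, R), (∀ r : R, ((W.fst r : R) : 𝓐) = m * r) ∧ ∀ r : R, ((W.snd r : R) : 𝓐) = r * m := by
  let L : R →ₗ[ℂ] R :=
    { toFun := fun r => ⟨m * r, h1 r r.2⟩
      map_add' := fun x y => Subtype.ext (by simp [mul_add])
      map_smul' := fun c x => Subtype.ext (by simp) }
  let L' : R →ₗ[ℂ] R :=
    { toFun := fun r => ⟨r * m, h2 r r.2⟩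
      map_add' := fun x y => Subtype.ext (by simp [add_mul])
      map_smul' := fun c x => Subtype.ext (by simp) }
  let Lc : R →L[ℂ] R := ⟨L, Continuous.subtype_mk (by fun_prop) _⟩
  let Lc' : R →L[ℂ] R := ⟨L', Continuous.subtype_mk (by fun_prop) _⟩
  refine ⟨⟨(Lc, Lc'), ?_⟩, fun r => rfl, fun r => rfl⟩
  intro x y
  apply Subtype.ext
  change (x * m) * (y : 𝓐) = x * (m * y)
  rw [mul_assoc]

lemma exp_mlt (W : 𝓜(ℂ, R)) (h : 𝓐) (hW : ∀ r : R, ((W.fst r : R) : 𝓐) = h * r) (r : R) :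
    (((NormedSpace.exp W).fst r : R) : 𝓐) = NormedSpace.exp h * r := by
  have h1 := NormedSpace.exp_series_hasSum_exp' (𝕂 := ℂ) W
  have h2 := NormedSpace.exp_series_hasSum_exp' (𝕂 := ℂ) h
  have h3 := h2.mul_right (r : 𝓐)
  let Φ : 𝓜(ℂ, R) →+ 𝓐 :=
    { toFun := fun m => ((m.fst r : R) : 𝓐)
      map_zero' := by simp
      map_add' := fun x y => by simp }
  have hΦ : Continuous Φ := by
    apply AddMonoidHomClass.continuous_of_bound Φ ‖r‖
    intro x
    rw [mul_comm]
    exact norm_fst_le x r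
  have h4 := h1.map Φ hΦ
  have hp : ∀ n : ℕ, (((W ^ n).fst r : R) : 𝓐) = h ^ n * r := by
    intro n
    induction n with
    | zero => simp
    | succ n ih =>
      rw [pow_succ', pow_succ', mul_assoc, ← ih, ← hW]
      rfl
  have he : (Φ ∘ fun n : ℕ => ((n.factorial : ℂ)⁻¹ • W ^ n)) = fun n : ℕ => ((n.factorial : ℂ)⁻¹ • h ^ n) * (r : 𝓐) := by
    funext n
    change ((((n.factorial : ℂ)⁻¹ • W ^ n).fst r : R) : 𝓐) = _
    rw [smul_mul_assoc, ← hp n]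
    rfl
  rw [he] at h4
  exact h4.unique h3

/-- the ideal -/
def Khat (φ : 𝓐 →⋆ₙₐ[ℂ] 𝓑) : Submodule ℂ 𝓜(ℂ, R) where
  carrier := {m | ∃ r : R, φ r = 0 ∧ m = kap R r}
  zero_mem' := ⟨0, by simp, (map_zero (kap R)).symm⟩
  add_mem' := by
    rintro _ _ ⟨r, hr, rfl⟩ ⟨s, hs, rfl⟩
    exact ⟨r + s, by simp [hr, hs], (map_add (kap R) r s).symm⟩
  smul_mem' := by
    rintro c _ ⟨r, hr, rfl⟩
    refine ⟨c • r, ?_, (map_smul (kap R) c r).symm⟩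
    change φ (c • (r : 𝓐)) = 0
    rw [map_smul, hr, smul_zero]

variable {R}
lemma Khat_closed (φ : 𝓐 →⋆ₙₐ[ℂ] 𝓑) : IsClosed (Khat R φ : Set 𝓜(ℂ, R)) := by
  have : (Khat R φ : Set 𝓜(ℂ, R)) = kap R '' {r : R | φ r = 0} := by
    ext m
    constructor
    · rintro ⟨r, hr, rfl⟩; exact ⟨r, hr, rfl⟩
    · rintro ⟨r, hr, rfl⟩; exact ⟨r, hr, rfl⟩
  rw [this]
  apply (kap_isom (X := R)).isClosedEmbedding.isClosedMap
  exact isClosed_eq ((hom_cont φ).comp continuous_subtype_val) continuous_const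

lemma Khat_star (φ : 𝓐 →⋆ₙₐ[ℂ] 𝓑) {m} (hm : m ∈ Khat R φ) : star m ∈ Khat R φ := by
  obtain ⟨r, hr, rfl⟩ := hm
  refine ⟨star r, ?_, (map_star (kap R) r).symm⟩
  change φ (star (r : 𝓐)) = 0
  rw [map_star, hr, star_zero]

lemma Khat_left (φ : 𝓐 →⋆ₙₐ[ℂ] 𝓑) (m : 𝓜(ℂ, R)) {n} (hn : n ∈ Khat R φ) : m * n ∈ Khat R φ := by
  obtain ⟨r, hr, rfl⟩ := hn
  refine ⟨m.fst r, ?_, mul_kap m r⟩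
  have h1 : star (m.fst r) * m.fst r = star r * (star m * m).fst r := by
    apply kap_inj (X := R)
    rw [map_mul (kap R), map_mul (kap R), map_star (kap R), map_star (kap R), ← mul_kap, ← mul_kap, star_mul]
    simp only [mul_assoc]
  have h2 := congrArg (fun x : R => φ (x : 𝓐)) h1
  have h3 : star (φ (m.fst r)) * φ (m.fst r) = 0 := by
    rw [← map_star, ← map_mul]
    refine h2.trans ?_
    change φ (star (r : 𝓐) * ((star m * m).fst r : R)) = 0
    rw [map_mul, map_star, hr, star_zero, zero_mul]
  exact CStarRing.star_mul_self_eq_zero_iff _ |>.mp h3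

lemma Khat_right (φ : 𝓐 →⋆ₙₐ[ℂ] 𝓑) (m : 𝓜(ℂ, R)) {n} (hn : n ∈ Khat R φ) : n * m ∈ Khat R φ := by
  have := Khat_star φ (Khat_left φ (star m) (Khat_star φ hn))
  rwa [star_mul, star_star, star_star] at this

end sub

section exp
variable {𝓐 : Type} [CStarAlgebra 𝓐]
lemma exp_closed (S : Subalgebra ℂ 𝓐) (hS : IsClosed (S : Set 𝓐)) (h : 𝓐) (hh : h ∈ S) : NormedSpace.exp h ∈ S := by
  have h1 := NormedSpace.exp_series_hasSum_exp' (𝕂 := ℂ) h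
  exact hS.mem_of_tendsto h1 (Eventually.of_forall fun s => S.sum_mem fun n _ => S.smul_mem (S.pow_mem hh n) _)
end exp

section RR
variable {𝓐 B : Type} [CStarAlgebra 𝓐] [NonUnitalCStarAlgebra B]

def RR (Δ : B →⋆ₙₐ[ℂ] 𝓐) (u : ℕ → B) : NonUnitalStarSubalgebra ℂ 𝓐 where
  carrier := {r | Tendsto (fun n => Δ (u n) * r) atTop (𝓝 r) ∧ Tendsto (fun n => Δ (u n) * star r) atTop (𝓝 (star r))}
  zero_mem' := by simp
  add_mem' := by
    rintro r s ⟨h1, h2⟩ ⟨h3, h4⟩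
    refine ⟨?_, ?_⟩
    · simpa only [mul_add] using h1.add h3
    · simpa only [mul_add, star_add] using h2.add h4
  mul_mem' := by
    rintro r s ⟨h1, h2⟩ ⟨h3, h4⟩
    refine ⟨?_, ?_⟩
    · simpa only [mul_assoc] using h1.mul_const s
    · simpa only [mul_assoc, star_mul] using h4.mul_const (star r)
  smul_mem' := by
    rintro c r ⟨h1, h2⟩
    refine ⟨?_, ?_⟩
    · simpa only [mul_smul_comm] using h1.const_smul c
    · simpa only [mul_smul_comm, star_smul] using h2.const_smul (star c)
  star_mem' := by
    rintro r ⟨h1, h2⟩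
    exact ⟨h2, by simpa only [star_star] using h1⟩

lemma RR_closed (Δ : B →⋆ₙₐ[ℂ] 𝓐) (u : ℕ → B) (hu : ∀ n, ‖u n‖ ≤ 1) : IsClosed (RR Δ u : Set 𝓐) := by
  have h1 := absorb_closed (fun n => Δ (u n)) (fun n => (NonUnitalStarAlgHom.norm_apply_le Δ (u n)).trans (hu n))
  exact h1.inter (h1.preimage continuous_star)
end RR

end S6
end

noncomputable section
open scoped MultiplierAlgebra
open Filter Topology
namespace S6

lemma exists_combo {X N : Type} [NonUnitalCStarAlgebra X] [CStarAlgebra N] (e : N) (he : e * e = e) (hs : star e = e)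
    (f g : X →⋆ₙₐ[ℂ] N) (hf : ∀ x, e * f x = f x * e) (hg : ∀ x, e * g x = g x * e) :
    ∃ F : X →⋆ₙₐ[ℂ] N, ∀ x, F x = e * f x + (1 - e) * g x := by
  have h1 : ∀ a, e * (e * a) = e * a := fun a => by rw [← mul_assoc, he]
  have h2 : ∀ x a, f x * (e * a) = e * (f x * a) := fun x a => by rw [← mul_assoc, ← hf, mul_assoc]
  have h3 : ∀ x a, g x * (e * a) = e * (g x * a) := fun x a => by rw [← mul_assoc, ← hg, mul_assoc]
  refine ⟨{ toFun := fun x => e * f x + (1 - e) * g x, map_add' := ?_, map_smul' := ?_, map_zero' := ?_, map_mul' := ?_, map_star' := ?_ }, fun x => rfl⟩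
  · intro c x
    simp only [map_smul, mul_smul_comm, smul_add]; rfl
  · simp
  · intro x y
    simp only [map_add, mul_add]; abel
  · intro x y
    simp only [map_mul, sub_mul, one_mul, mul_add, add_mul, mul_sub, mul_assoc, h1, h2, h3]
    abel
  · intro x
    simp only [map_star, star_add, star_mul, star_sub, star_one, hs]
    rw [← map_star f, ← map_star g, hf, mul_sub, sub_mul, one_mul, mul_one, hg]

lemma exists_conj {X N : Type} [NonUnitalCStarAlgebra X] [CStarAlgebra N] (V : N) (hV : star V * V = 1)
    (f : X →⋆ₙₐ[ℂ] N) :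
    ∃ F : X →⋆ₙₐ[ℂ] N, ∀ x, F x = V * f x * star V := by
  have h1 : ∀ a, star V * (V * a) = a := fun a => by rw [← mul_assoc, hV, one_mul]
  refine ⟨{ toFun := fun x => V * f x * star V, map_add' := ?_, map_smul' := ?_, map_zero' := ?_, map_mul' := ?_, map_star' := ?_ }, fun x => rfl⟩
  · intro c x
    simp only [map_smul, mul_smul_comm, smul_mul_assoc]; rfl
  · simp
  · intro x y
    simp only [map_add, mul_add, add_mul]
  · intro x y
    simp only [map_mul, mul_assoc, h1]
  · intro x
    simp only [map_star, star_mul, star_star, mul_assoc]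

lemma Nondeg.eq_left {X Y : Type} [NonUnitalCStarAlgebra X] [NonUnitalCStarAlgebra Y]
    {f : X →⋆ₙₐ[ℂ] 𝓜(ℂ, Y)} (hf : Nondeg f) {m n : 𝓜(ℂ, Y)}
    (h : ∀ x, f x * m = f x * n) : m = n := by
  rw [← star_inj]
  apply hf.eq
  intro x
  have := congrArg star (h (star x))
  rwa [star_mul, star_mul, ← map_star f, star_star] at this

lemma unitary_exp {N : Type} [CStarAlgebra N] (h : N) (hs : star h = -h) :
    star (NormedSpace.exp h) * NormedSpace.exp h = 1 ∧ NormedSpace.exp h * star (NormedSpace.exp h) = 1 := by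
  let _ : NormedAlgebra ℚ N := NormedAlgebra.restrictScalars ℚ ℂ N
  have := NormedSpace.exp_mem_unitary_of_mem_skewAdjoint (x := h) (by rw [skewAdjoint.mem_iff]; exact hs)
  exact this

set_option maxHeartbeats 4000000 in
theorem core {𝓐 𝓑 A B E QB QE qE : Type} [CStarAlgebra 𝓐] [NonUnitalCStarAlgebra 𝓑]
    [NonUnitalCStarAlgebra A] [NonUnitalCStarAlgebra B] [NonUnitalCStarAlgebra E]
    [NonUnitalCStarAlgebra QB] [NonUnitalCStarAlgebra QE] [NonUnitalCStarAlgebra qE]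
    (Δ : B →⋆ₙₐ[ℂ] 𝓐) (u : ℕ → B) (hu : ∀ n, ‖u n‖ ≤ 1) (hub : ∀ b, Tendsto (fun n => u n * b) atTop (𝓝 b))
    (e : 𝓐) (he : e * e = e) (hes : star e = e) (hec : ∀ b, e * Δ b = Δ b * e)
    (h : 𝓐) (hsk : star h = -h) (hhR : ∀ b, Tendsto (fun n => Δ (u n) * (h * Δ b)) atTop (𝓝 (h * Δ b)))
    (φ : 𝓐 →⋆ₙₐ[ℂ] 𝓑)
    (hφ : ∀ b, φ (e * Δ b) = φ (NormedSpace.exp h * ((1 - e) * Δ b) * star (NormedSpace.exp h)))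
    (s : A →⋆ₙₐ[ℂ] 𝓜(ℂ, B)) (a : ℕ → A) (ha : DenseRange a)
    (hκ : ∀ k, ∃ κ, φ κ = 0 ∧ Tendsto (fun n => Δ (u n) * κ) atTop (𝓝 κ) ∧
      Tendsto (fun n => Δ (u n) * star κ) atTop (𝓝 (star κ)) ∧
      ∀ c b, Δ c * h * Δ ((s (a k)).fst b) - Δ ((s (a k)).snd c) * h * Δ b = Δ c * κ * Δ b)
    (μ : E →⋆ₙₐ[ℂ] 𝓜(ℂ, B)) (p : E →⋆ₙₐ[ℂ] A) (hdiff : ∀ x, ∃ b, μ x - s (p x) = kap B b)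
    (jB : B →⋆ₙₐ[ℂ] E) (hμ : ∀ b, μ (jB b) = kap B b) (hp : ∀ b, p (jB b) = 0)
    (PB : QPresentation B QB) (PE : QPresentation E QE) (πE : QE →⋆ₙₐ[ℂ] E)
    (hπ : ∀ x, πE (PE.ι x) = x) (hπ' : ∀ x, πE (PE.ιbar x) = x)
    (QjE : QB →⋆ₙₐ[ℂ] QE) (hQ : ∀ b, QjE (PB.ι b) = PE.ι (jB b)) (hQ' : ∀ b, QjE (PB.ιbar b) = PE.ιbar (jB b))
    (jqE : qE →⋆ₙₐ[ℂ] QE) (hq : ∀ w, πE (jqE w) = 0)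
    (Ψ : QB →⋆ₙₐ[ℂ] 𝓐) (hΨ : ∀ b, Ψ (PB.ι b) = e * Δ b)
    (hΨ' : ∀ b, Ψ (PB.ιbar b) = NormedSpace.exp h * ((1 - e) * Δ b) * star (NormedSpace.exp h)) :
    ∃ f : qE →⋆ₙₐ[ℂ] 𝓐, (∀ w, φ (f w) = 0) ∧ (∀ w, f w ∈ RR Δ u) ∧
      ∀ w y, jqE w = QjE y → f w = Ψ y := by
  set R := RR Δ u with hRdef
  have hRc : IsClosed (R : Set 𝓐) := RR_closed Δ u hu
  have hΔR : ∀ b, Δ b ∈ R := by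
    have h1 : ∀ b, Tendsto (fun n => Δ (u n) * Δ b) atTop (𝓝 (Δ b)) := by
      intro b
      have := (hom_cont Δ).continuousAt.tendsto.comp (hub b)
      refine this.congr fun n => ?_
      simp
    refine fun b => ⟨h1 b, ?_⟩
    rw [← map_star Δ]
    exact h1 _
  have heR : ∀ r ∈ R, e * r ∈ R := by
    rintro r ⟨h1, h2⟩
    refine ⟨?_, ?_⟩
    · refine (h1.const_mul e).congr fun n => ?_
      rw [← mul_assoc, hec, mul_assoc]
    · rw [star_mul]
      simpa only [mul_assoc] using h2.mul_const (star e)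
  have heR' : ∀ r ∈ R, r * e ∈ R := by
    intro r hr
    have := StarMemClass.star_mem (heR _ (StarMemClass.star_mem hr))
    simpa only [star_mul, star_star, hes] using this
  have hhR1 : ∀ r ∈ R, h * r ∈ R := by
    intro r hr
    obtain ⟨h1, h2⟩ := hr
    refine ⟨?_, ?_⟩
    · have hcl := absorb_closed (fun n => Δ (u n)) (fun n => (NonUnitalStarAlgHom.norm_apply_le Δ (u n)).trans (hu n))
      have := h1.const_mul h
      refine hcl.mem_of_tendsto this (Eventually.of_forall fun n => ?_)
      have := (hhR (u n)).mul_const r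
      simp only [mul_assoc] at this
      exact this
    · rw [star_mul]
      simpa only [mul_assoc] using h2.mul_const (star h)
  have hhR2 : ∀ r ∈ R, r * h ∈ R := by
    intro r hr
    have := StarMemClass.star_mem (hhR1 _ (StarMemClass.star_mem hr))
    simp only [star_mul, star_star, hsk, mul_neg] at this
    have := R.smul_mem (-1) this
    simpa using this
  obtain ⟨W, hW, hW'⟩ := exists_mlt R h hhR1 hhR2
  obtain ⟨e1, he1, he1'⟩ := exists_mlt R e heR heR'
  -- basic rules
  have hWk : ∀ r : R, W * kap R r = kap R ⟨h * r, hhR1 r r.2⟩ := fun r => by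
    rw [mul_kap]; congr 1; exact Subtype.ext (hW r)
  have hWk' : ∀ r : R, kap R r * W = kap R ⟨r * h, hhR2 r r.2⟩ := fun r => by
    rw [kap_mul]; congr 1; exact Subtype.ext (hW' r)
  have hek : ∀ r : R, e1 * kap R r = kap R ⟨e * r, heR r r.2⟩ := fun r => by
    rw [mul_kap]; congr 1; exact Subtype.ext (he1 r)
  have hek' : ∀ r : R, kap R r * e1 = kap R ⟨r * e, heR' r r.2⟩ := fun r => by
    rw [kap_mul]; congr 1; exact Subtype.ext (he1' r)
  have hee : e1 * e1 = e1 := by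
    apply fst_eq_of
    intro r
    apply Subtype.ext
    change ((e1.fst (e1.fst r) : R) : 𝓐) = (e1.fst r : R)
    rw [he1, he1, ← mul_assoc, he]
  have hse : star e1 = e1 := by
    apply fst_eq_of
    intro r
    apply Subtype.ext
    rw [DoubleCentralizer.star_fst]
    change star ((e1.snd (star r) : R) : 𝓐) = (e1.fst r : R)
    rw [he1, he1']
    change star (star (r : 𝓐) * e) = _
    rw [star_mul, star_star, hes]
  have hsW : star W = -W := by
    apply fst_eq_of
    intro r
    apply Subtype.ext
    rw [DoubleCentralizer.star_fst]
    change star ((W.snd (star r) : R) : 𝓐) = -((W.fst r : R) : 𝓐)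
    rw [hW, hW']
    change star (star (r : 𝓐) * h) = _
    rw [star_mul, star_star, hsk, neg_mul]
  set U := NormedSpace.exp h with hU
  set V := NormedSpace.exp W with hV
  obtain ⟨hV1, hV2⟩ := unitary_exp W hsW
  have hUR : ∀ r : R, U * r ∈ R := fun r => by
    rw [← exp_mlt R W h hW r]; exact (_ : R).2
  have hVk : ∀ r : R, V * kap R r = kap R ⟨U * r, hUR r⟩ := fun r => by
    rw [mul_kap]; congr 1; exact Subtype.ext (exp_mlt R W h hW r)
  have hUR' : ∀ r : R, r * star U ∈ R := fun r => by
    have := StarMemClass.star_mem (hUR (star r))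
    rw [star_mul] at this
    change star (star (r : 𝓐)) * star U ∈ R at this
    rwa [star_star] at this
  have hVk' : ∀ r : R, kap R r * star V = kap R ⟨r * star U, hUR' r⟩ := fun r => by
    have := congrArg star (hVk (star r))
    rw [star_mul, map_star (kap R), star_star, ← map_star (kap R)] at this
    rw [this]; congr 1
    apply Subtype.ext
    change star (U * star (r : 𝓐)) = r * star U
    rw [star_mul, star_star]
  -- the diagonal
  let ΔR : B →⋆ₙₐ[ℂ] R := NonUnitalStarAlgHom.codRestrict Δ R hΔR
  let f : B →⋆ₙₐ[ℂ] 𝓜(ℂ, R) := (kap R).comp ΔR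
  have hnd : Nondeg f := by
    intro r
    have h1 : Tendsto (fun n => (f (u n)).fst r) atTop (𝓝 r) := by
      rw [tendsto_subtype_rng]
      exact r.2.1
    exact mem_closure_of_tendsto h1 (Eventually.of_forall fun n => Submodule.subset_span ⟨_, _, rfl⟩)
  obtain ⟨D, hD, hDk⟩ := exists_ext f hnd
  have hD' : ∀ m b, f b * D m = f (m.snd b) := by
    intro m b
    rw [← hDk, ← map_mul, kap_mul, hDk]
  have hef : ∀ b, e1 * f b = f b * e1 := by
    intro b
    change e1 * kap R (ΔR b) = kap R (ΔR b) * e1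
    rw [hek, hek']
    congr 1
    exact Subtype.ext (hec b)
  have heD : ∀ m, e1 * D m = D m * e1 := by
    intro m
    apply hnd.eq
    intro b
    rw [mul_assoc, hD, mul_assoc, hef, hef, ← mul_assoc, hD]
  -- commutators
  have hcomm0 : ∀ k, W * D (s (a k)) - D (s (a k)) * W ∈ Khat R φ := by
    intro k
    obtain ⟨κ, hk0, hk1, hk2, hk⟩ := hκ k
    refine ⟨⟨κ, hk1, hk2⟩, hk0, ?_⟩
    apply hnd.eq
    intro b
    apply hnd.eq_left
    intro c
    have e1 : f c * ((W * D (s (a k)) - D (s (a k)) * W) * f b) =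
        f c * (W * f ((s (a k)).fst b)) - f ((s (a k)).snd c) * (W * f b) := by
      rw [sub_mul, mul_sub, mul_assoc, hD, mul_assoc, ← mul_assoc (f c) (D _), hD']
    rw [e1]
    change kap R (ΔR c) * (W * kap R (ΔR _)) - kap R (ΔR _) * (W * kap R (ΔR b)) = kap R (ΔR c) * (kap R ⟨κ, _⟩ * kap R (ΔR b))
    rw [hWk, hWk, ← map_mul (kap R), ← map_mul (kap R), ← map_sub (kap R), ← map_mul (kap R), ← map_mul (kap R)]
    congr 1
    apply Subtype.ext
    have := hk c b
    simp only [mul_assoc] at this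
    exact this
  have hDc : Continuous D := hom_cont (D : 𝓜(ℂ, B) →⋆ₙₐ[ℂ] 𝓜(ℂ, R))
  have hcomm1 : ∀ x, W * D (s x) - D (s x) * W ∈ Khat R φ := by
    intro x
    have hc : IsClosed {x | W * D (s x) - D (s x) * W ∈ Khat R φ} := by
      refine (Khat_closed φ).preimage ?_
      have := hDc.comp (hom_cont s)
      exact (continuous_const.mul this).sub (this.mul continuous_const)
    refine ha.induction_on (p := fun x => W * D (s x) - D (s x) * W ∈ Khat R φ) x hc hcomm0
  have hcommV : ∀ x, V * D (s x) - D (s x) * V ∈ Khat R φ := by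
    intro x
    let S : Subalgebra ℂ 𝓜(ℂ, R) :=
      { carrier := {m | m * D (s x) - D (s x) * m ∈ Khat R φ}
        mul_mem' := by
          intro m n hm hn
          have : m * n * D (s x) - D (s x) * (m * n) = m * (n * D (s x) - D (s x) * n) + (m * D (s x) - D (s x) * m) * n := by
            noncomm_ring
          change _ ∈ Khat R φ
          rw [this]
          exact (Khat R φ).add_mem (Khat_left φ _ hn) (Khat_right φ _ hm)
        add_mem' := by
          intro m n hm hn
          have : (m + n) * D (s x) - D (s x) * (m + n) = (m * D (s x) - D (s x) * m) + (n * D (s x) - D (s x) * n) := by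
            noncomm_ring
          change _ ∈ Khat R φ
          rw [this]
          exact (Khat R φ).add_mem hm hn
        algebraMap_mem' := by
          intro c
          change _ ∈ Khat R φ
          rw [Algebra.commutes, sub_self]
          exact (Khat R φ).zero_mem }
    have hS : IsClosed (S : Set 𝓜(ℂ, R)) :=
      (Khat_closed φ).preimage ((continuous_id.mul continuous_const).sub (continuous_const.mul continuous_id))
    exact exp_closed S hS W (hcomm1 x)
  -- the pair
  let Dh : 𝓜(ℂ, B) →⋆ₙₐ[ℂ] 𝓜(ℂ, R) := (D : 𝓜(ℂ, B) →⋆ₙₐ[ℂ] 𝓜(ℂ, R))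
  obtain ⟨ω, hω⟩ := exists_combo e1 hee hse (Dh.comp μ) ((Dh.comp s).comp p) (fun x => heD _) (fun x => heD _)
  obtain ⟨ω0, hω0⟩ := exists_combo e1 hee hse ((Dh.comp s).comp p) (Dh.comp μ) (fun x => heD _) (fun x => heD _)
  obtain ⟨ω', hω'⟩ := exists_conj V hV1 ω0
  have hωd : ∀ x, ω' x - ω x ∈ Khat R φ := by
    intro x
    obtain ⟨b, hb⟩ := hdiff x
    have hb' : D (μ x) = D (s (p x)) + f b := by
      rw [← hDk, ← map_add, ← hb]; congr 1; abel
    have e2 : ω x = D (s (p x)) + e1 * f b := by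
      rw [hω]
      change e1 * D (μ x) + (1 - e1) * D (s (p x)) = _
      rw [hb']; noncomm_ring
    have e3 : ω' x = V * D (s (p x)) * star V + V * ((1 - e1) * f b) * star V := by
      rw [hω', hω0]
      change V * (e1 * D (s (p x)) + (1 - e1) * D (μ x)) * star V = _
      rw [hb']; noncomm_ring
    have e4 : ω' x - ω x = (V * D (s (p x)) - D (s (p x)) * V) * star V + (V * ((1 - e1) * f b) * star V - e1 * f b) := by
      have e6 : D (s (p x)) * V * star V = D (s (p x)) := by rw [mul_assoc, hV2, mul_one]
      rw [e2, e3, sub_mul (V * D (s (p x))), e6]; abel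
    rw [e4]
    refine (Khat R φ).add_mem (Khat_right φ _ (hcommV _)) ?_
    have e5 : (1 - e1) * f b = kap R ⟨(1 - e) * Δ b, by rw [sub_mul, one_mul]; exact R.sub_mem (hΔR b) (heR _ (hΔR b))⟩ := by
      change (1 - e1) * kap R (ΔR b) = _
      rw [sub_mul, one_mul, hek, ← map_sub (kap R)]
      congr 1
      apply Subtype.ext
      change Δ b - e * Δ b = (1 - e) * Δ b
      rw [sub_mul, one_mul]
    rw [e5, hVk, hVk']
    change _ - e1 * kap R (ΔR b) ∈ _
    rw [hek, ← map_sub (kap R)]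
    refine ⟨_, ?_, rfl⟩
    change φ (U * ((1 - e) * Δ b) * star U - e * Δ b) = 0
    rw [map_sub, hφ, sub_self]
  have hωB : ∀ b, ω (jB b) = kap R ⟨e * Δ b, heR _ (hΔR b)⟩ := by
    intro b
    rw [hω]
    change e1 * D (μ (jB b)) + (1 - e1) * D (s (p (jB b))) = _
    rw [hμ, hp, map_zero, map_zero, mul_zero, add_zero, hDk]
    exact hek _
  have hωB' : ∀ b, ∃ r : R, (r : 𝓐) = U * ((1 - e) * Δ b) * star U ∧ ω' (jB b) = kap R r := by
    intro b
    have e5 : (1 - e1) * f b = kap R ⟨(1 - e) * Δ b, by rw [sub_mul, one_mul]; exact R.sub_mem (hΔR b) (heR _ (hΔR b))⟩ := by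
      change (1 - e1) * kap R (ΔR b) = _
      rw [sub_mul, one_mul, hek, ← map_sub (kap R)]
      congr 1
      apply Subtype.ext
      change Δ b - e * Δ b = (1 - e) * Δ b
      rw [sub_mul, one_mul]
    have : ω' (jB b) = V * ((1 - e1) * f b) * star V := by
      rw [hω', hω0]
      change V * (e1 * D (s (p (jB b))) + (1 - e1) * D (μ (jB b))) * star V = _
      rw [hμ, hp, map_zero, map_zero, mul_zero, zero_add, hDk]
    rw [e5, hVk, hVk'] at this
    exact ⟨_, rfl, this⟩
  obtain ⟨g, hg, hg'⟩ := free_ex PE ω ω'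
  have hgK : ∀ z, g z - ω (πE z) ∈ Khat R φ := by
    intro z
    refine gen_induct PE (fun z => g z - ω (πE z) ∈ Khat R φ) ?_ ?_ ?_ ?_ ?_ ?_ ?_ z
    · exact (Khat_closed φ).preimage ((hom_cont g).sub ((hom_cont ω).comp (hom_cont πE)))
    · intro x; simp only [hg, hπ, sub_self]; exact (Khat R φ).zero_mem
    · intro x; simp only [hg', hπ']; exact hωd x
    · intro x y hx hy
      have : g (x + y) - ω (πE (x + y)) = (g x - ω (πE x)) + (g y - ω (πE y)) := by
        simp only [map_add]; abel
      rw [this]; exact (Khat R φ).add_mem hx hy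
    · intro x y hx hy
      have : g (x * y) - ω (πE (x * y)) = (g x - ω (πE x)) * g y + ω (πE x) * (g y - ω (πE y)) := by
        simp only [map_mul]; noncomm_ring
      rw [this]; exact (Khat R φ).add_mem (Khat_right φ _ hx) (Khat_left φ _ hy)
    · intro c x hx
      have : g (c • x) - ω (πE (c • x)) = c • (g x - ω (πE x)) := by
        simp only [map_smul, smul_sub]
      rw [this]; exact (Khat R φ).smul_mem c hx
    · intro x hx
      have : g (star x) - ω (πE (star x)) = star (g x - ω (πE x)) := by
        simp only [map_star, star_sub]
      rw [this]; exact Khat_star φ hx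
  have hgj : ∀ w, ∃ r : R, φ r = 0 ∧ g (jqE w) = kap R r := by
    intro w
    have := hgK (jqE w)
    rw [hq, map_zero, sub_zero] at this
    exact this
  obtain ⟨F, hF⟩ := lift_hom (g.comp jqE) (kap R) kap_inj (fun w => by
    obtain ⟨r, _, h2⟩ := hgj w
    exact ⟨r, h2.symm⟩)
  refine ⟨(NonUnitalStarSubalgebraClass.subtype R).comp F, ?_, ?_, ?_⟩
  · intro w
    obtain ⟨r, h1, h2⟩ := hgj w
    have : F w = r := kap_inj (X := R) ((hF w).trans h2)
    change φ (F w : R) = 0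
    rw [this, h1]
  · intro w; exact (F w).2
  · intro w y hwy
    have hΨR : ∀ y, Ψ y ∈ R := by
      refine gen_induct PB (fun y => Ψ y ∈ R) (hRc.preimage (hom_cont Ψ)) ?_ ?_ ?_ ?_ ?_ ?_
      · intro b; rw [hΨ]; exact heR _ (hΔR b)
      · intro b
        obtain ⟨r, hr, _⟩ := hωB' b
        rw [hΨ', ← hr]; exact r.2
      · intro x y hx hy; rw [map_add]; exact R.add_mem hx hy
      · intro x y hx hy; rw [map_mul]; exact R.mul_mem hx hy
      · intro c x hx; rw [map_smul]; exact R.smul_mem c hx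
      · intro x hx; rw [map_star]; exact StarMemClass.star_mem hx
    let ΨR : QB →⋆ₙₐ[ℂ] R := NonUnitalStarAlgHom.codRestrict Ψ R hΨR
    have heq : g.comp QjE = (kap R).comp ΨR := by
      apply free_uniq PB
      · intro b
        change g (QjE (PB.ι b)) = kap R (ΨR _)
        rw [hQ, hg, hωB]
        congr 1
        exact Subtype.ext (hΨ b).symm
      · intro b
        change g (QjE (PB.ιbar b)) = kap R (ΨR _)
        obtain ⟨r, hr, h2⟩ := hωB' b
        rw [hQ', hg', h2]
        congr 1
        exact Subtype.ext (hr.trans (hΨ' b).symm)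
    have h3 : F w = ΨR y := by
      apply kap_inj (X := R)
      rw [hF]
      change g (jqE w) = _
      rw [hwy]
      exact DFunLike.congr_fun heq y
    change ((F w : R) : 𝓐) = _
    rw [h3]; rfl
end S6
end

noncomputable section
open scoped MultiplierAlgebra
open Filter Topology
namespace S6

abbrev Mat2 (M : Type) := CStarMatrix (Fin 2) (Fin 2) M

section mat
variable {M : Type} [CStarAlgebra M] [PartialOrder M] [StarOrderedRing M]
variable {M' : Type} [CStarAlgebra M'] [PartialOrder M'] [StarOrderedRing M']

def mk2 (a b c d : M) : Mat2 M := CStarMatrix.ofMatrix !![a, b; c, d]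

lemma mk2_mul (a b c d a' b' c' d' : M) : mk2 a b c d * mk2 a' b' c' d' =
    mk2 (a * a' + b * c') (a * b' + b * d') (c * a' + d * c') (c * b' + d * d') := by
  ext i j
  fin_cases i <;> fin_cases j <;> simp [mk2, CStarMatrix.mul_apply, Fin.sum_univ_two]

lemma mk2_star (a b c d : M) : star (mk2 a b c d) = mk2 (star a) (star c) (star b) (star d) := by
  ext i j
  fin_cases i <;> fin_cases j <;> simp [mk2, CStarMatrix.star_apply]

lemma mk2_add (a b c d a' b' c' d' : M) :
    mk2 a b c d + mk2 a' b' c' d' = mk2 (a + a') (b + b') (c + c') (d + d') := by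
  ext i j
  fin_cases i <;> fin_cases j <;> simp [mk2]

lemma mk2_sub (a b c d a' b' c' d' : M) :
    mk2 a b c d - mk2 a' b' c' d' = mk2 (a - a') (b - b') (c - c') (d - d') := by
  ext i j
  fin_cases i <;> fin_cases j <;> simp [mk2]

lemma mk2_neg (a b c d : M) : -mk2 a b c d = mk2 (-a) (-b) (-c) (-d) := by
  ext i j
  fin_cases i <;> fin_cases j <;> simp [mk2]

lemma mk2_smul (r : ℂ) (a b c d : M) : r • mk2 a b c d = mk2 (r • a) (r • b) (r • c) (r • d) := by
  ext i j
  fin_cases i <;> fin_cases j <;> simp [mk2]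

lemma mk2_one : (1 : Mat2 M) = mk2 1 0 0 1 := by
  ext i j
  fin_cases i <;> fin_cases j <;> simp [mk2]

lemma mk2_zero : (0 : Mat2 M) = mk2 0 0 0 0 := by
  ext i j
  fin_cases i <;> fin_cases j <;> simp [mk2]

lemma mk2_cont {X : Type} [TopologicalSpace X] (a b c d : X → M) (ha : Continuous a) (hb : Continuous b)
    (hc : Continuous c) (hd : Continuous d) :
    Continuous (fun t => mk2 (a t) (b t) (c t) (d t)) := by
  refine continuous_pi fun i => continuous_pi fun j => ?_
  fin_cases i <;> fin_cases j <;> simpa [mk2]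

lemma ent_cont (i j : Fin 2) : Continuous (fun m : Mat2 M => m i j) :=
  (continuous_apply j).comp (continuous_apply i)

lemma mk2_tendsto {X : Type} {l : Filter X} {a b c d : X → M} {a' b' c' d' : M} (ha : Tendsto a l (𝓝 a')) (hb : Tendsto b l (𝓝 b'))
    (hc : Tendsto c l (𝓝 c')) (hd : Tendsto d l (𝓝 d')) :
    Tendsto (fun t => mk2 (a t) (b t) (c t) (d t)) l (𝓝 (mk2 a' b' c' d')) := by
  refine tendsto_pi_nhds.mpr fun i => tendsto_pi_nhds.mpr fun j => ?_
  fin_cases i <;> fin_cases j <;> simpa [mk2]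

def map2 (g : M →⋆ₐ[ℂ] M') : Mat2 M →⋆ₐ[ℂ] Mat2 M' where
  toFun m := CStarMatrix.ofMatrix fun i j => g (m i j)
  map_one' := by
    ext i j
    change g ((1 : Mat2 M) i j) = (1 : Mat2 M') i j
    fin_cases i <;> fin_cases j <;> simp
  map_zero' := by
    ext i j
    change g ((0 : Mat2 M) i j) = (0 : Mat2 M') i j
    simp
  map_add' x y := by
    ext i j
    change g ((x + y) i j) = g (x i j) + g (y i j)
    simp
  map_mul' x y := by
    ext i j
    rw [CStarMatrix.mul_apply]
    change g ((x * y) i j) = ∑ l, g (x i l) * g (y l j)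
    rw [CStarMatrix.mul_apply]
    simp
  commutes' r := by
    ext i j
    change g (algebraMap ℂ (Mat2 M) r i j) = algebraMap ℂ (Mat2 M') r i j
    have h := AlgHomClass.commutes g r
    fin_cases i <;> fin_cases j <;> simp [CStarMatrix.algebraMap_apply, h]
  map_star' x := by
    ext i j
    rw [CStarMatrix.star_apply]
    change g (star x i j) = star (g (x j i))
    rw [CStarMatrix.star_apply, map_star]

lemma map2_apply (g : M →⋆ₐ[ℂ] M') (m : Mat2 M) (i j : Fin 2) : map2 g m i j = g (m i j) := rfl

lemma map2_mk2 (g : M →⋆ₐ[ℂ] M') (a b c d : M) : map2 g (mk2 a b c d) = mk2 (g a) (g b) (g c) (g d) := by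
  ext i j
  fin_cases i <;> fin_cases j <;> rfl

def dg {X : Type} [NonUnitalCStarAlgebra X] (f g : X →⋆ₙₐ[ℂ] M) : X →⋆ₙₐ[ℂ] Mat2 M where
  toFun x := mk2 (f x) 0 0 (g x)
  map_zero' := by rw [map_zero, map_zero, mk2_zero]
  map_add' x y := by simp [mk2_add]
  map_smul' c x := by simp [mk2_smul]
  map_mul' x y := by simp [mk2_mul]
  map_star' x := by simp [mk2_star, map_star]

lemma dg_apply {X : Type} [NonUnitalCStarAlgebra X] (f g : X →⋆ₙₐ[ℂ] M) (x : X) : dg f g x = mk2 (f x) 0 0 (g x) := rfl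

def hmat (x : M) : Mat2 M := mk2 0 x (-star x) 0

/-- the scalar -/
def hpi : ℂ := ((Real.pi / 2 : ℝ) : ℂ)

lemma hmat_star (x : M) : star (hpi • hmat x) = -(hpi • hmat x) := by
  rw [star_smul, hmat, mk2_star]
  have : star hpi = hpi := Complex.conj_ofReal _
  rw [this, ← smul_neg, mk2_neg]
  simp

lemma exp_J {N : Type} [CStarAlgebra N] (J : N) (hJ : J * J = -1) : NormedSpace.exp (hpi • J) = J := by
  let _ : NormedAlgebra ℚ ℂ := NormedAlgebra.restrictScalars ℚ ℝ ℂ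
  let _ : NormedAlgebra ℚ N := NormedAlgebra.restrictScalars ℚ ℂ N
  let L : ℂ →ₐ[ℝ] N := Complex.lift ⟨J, hJ⟩
  have hL : Continuous L := L.toLinearMap.continuous_of_finiteDimensional
  have h1 := NormedSpace.map_exp L hL ((Real.pi / 2 : ℝ) • Complex.I)
  have hI : L Complex.I = J := Complex.liftAux_apply_I J hJ
  rw [map_smul, hI, ← Complex.exp_eq_exp_ℂ] at h1
  have h2 : Complex.exp ((Real.pi / 2 : ℝ) • Complex.I) = Complex.I := by
    rw [Complex.real_smul]
    push_cast
    exact Complex.exp_pi_div_two_mul_I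
  rw [h2, hI] at h1
  rw [hpi, Complex.coe_smul]
  exact h1.symm

lemma J_sq : hmat (1 : M) * hmat 1 = -1 := by
  rw [hmat, mk2_mul, mk2_one, mk2_neg]; simp

lemma exp_hom (φ : M →⋆ₐ[ℂ] M') (x : M) : φ (NormedSpace.exp x) = NormedSpace.exp (φ x) := by
  let _ : NormedAlgebra ℚ M := NormedAlgebra.restrictScalars ℚ ℂ M
  let _ : NormedAlgebra ℚ M' := NormedAlgebra.restrictScalars ℚ ℂ M'
  exact NormedSpace.map_exp φ (hom_cont (φ : M →⋆ₙₐ[ℂ] M')) x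

lemma J_conj (x : M) : hmat (1 : M) * mk2 0 0 0 x * star (hmat (1 : M)) = mk2 x 0 0 0 := by
  rw [hmat, mk2_star, mk2_mul, mk2_mul]; simp

lemma mat_lift {X q : Type} [NonUnitalCStarAlgebra X] [NonUnitalCStarAlgebra q] (f : X →⋆ₙₐ[ℂ] Mat2 M)
    (g : q →⋆ₙₐ[ℂ] M) (hg : Function.Injective g) (h : ∀ x i k, ∃ w, g w = f x i k) :
    ∃ f' : X →⋆ₙₐ[ℂ] Matrix (Fin 2) (Fin 2) q, ∀ x i k, g (f' x i k) = f x i k := by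
  choose F hF using h
  refine ⟨{ toFun := fun x => Matrix.of (F x), map_add' := ?_, map_smul' := ?_, map_zero' := ?_, map_mul' := ?_, map_star' := ?_ }, hF⟩
  · intro c x; ext i k; apply hg; simp [hF, map_smul]
  · ext i k; apply hg; simp [hF]
  · intro x y; ext i k; apply hg; simp [hF]
  · intro x y; ext i k; apply hg; simp [hF, Matrix.mul_apply, CStarMatrix.mul_apply]
  · intro x; ext i k; apply hg
    simp [hF, map_star, Matrix.star_apply, CStarMatrix.star_apply]
end mat

lemma cont_closed {X Y Z : Type} [NonUnitalCStarAlgebra X] [NonUnitalCStarAlgebra Y] [TopologicalSpace Z]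
    (Ψ : Z → (X →⋆ₙₐ[ℂ] Y)) : IsClosed {y | Continuous (fun t => Ψ t y)} := by
  refine isClosed_of_closure_subset fun y hy => ?_
  refine continuous_of_uniform_approx_of_continuous (fun v hv => ?_)
  obtain ⟨ε, hε, h⟩ := Metric.mem_uniformity_dist.mp hv
  obtain ⟨y', hy', hd⟩ := Metric.mem_closure_iff.mp hy ε hε
  refine ⟨fun t => Ψ t y', hy', fun t => h ?_⟩
  rw [dist_eq_norm, ← map_sub]
  rw [dist_eq_norm] at hd
  exact (NonUnitalStarAlgHom.norm_apply_le (Ψ t) _).trans_lt hd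
end S6
end

noncomputable section
open scoped MultiplierAlgebra
open Filter Topology
namespace S6

section univ
variable {A B E Q q QE qE : Type}
    [NonUnitalCStarAlgebra A] [NonUnitalCStarAlgebra B] [NonUnitalCStarAlgebra E]
    [NonUnitalCStarAlgebra Q] [NonUnitalCStarAlgebra q] [NonUnitalCStarAlgebra QE] [NonUnitalCStarAlgebra qE]
    [PartialOrder 𝓜(ℂ, Q)] [StarOrderedRing 𝓜(ℂ, Q)] [PartialOrder 𝓜(ℂ, B)] [StarOrderedRing 𝓜(ℂ, B)]

lemma exists_pt (P : QPresentation B Q) (π : Q →⋆ₙₐ[ℂ] B) (h1 : ∀ x, π (P.ι x) = x) (T : 𝓜(ℂ, Q))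
    (hT : ∀ y, π (T.fst y) = π y) :
    ∃ g : 𝓜(ℂ, Q) →⋆ₐ[ℂ] 𝓜(ℂ, B), (∀ y, g (kap Q y) = kap B (π y)) ∧ g T = 1 := by
  have hnd : Nondeg ((kap B).comp π) := by
    intro y
    obtain ⟨l, hne, _, _, hu, hu2⟩ := exists_au B
    refine mem_closure_of_tendsto (hu y) (Eventually.of_forall fun n => Submodule.subset_span ⟨P.ι n, y, ?_⟩)
    change n * y = π (P.ι n) * y
    rw [h1]
  obtain ⟨g, hg, hg2⟩ := exists_ext _ hnd
  refine ⟨g, hg2, ?_⟩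
  apply hnd.eq
  intro x
  rw [hg, one_mul]
  change kap B (π _) = kap B (π x)
  rw [hT]

/-- interpolating path -/
def Tt (T : 𝓜(ℂ, Q)) (t : unitInterval) : 𝓜(ℂ, Q) := 1 + ((t : ℝ) : ℂ) • (T - 1)

def Ut (T : 𝓜(ℂ, Q)) (t : unitInterval) : Mat2 𝓜(ℂ, Q) := NormedSpace.exp (hpi • hmat (Tt T t))

lemma Ut_cont (T : 𝓜(ℂ, Q)) : Continuous (Ut T) := by
  let _ : NormedAlgebra ℚ (Mat2 𝓜(ℂ, Q)) := NormedAlgebra.restrictScalars ℚ ℂ _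
  have h : Continuous (Tt T) := by
    have h0 : Continuous fun t : unitInterval => ((t : ℝ) : ℂ) :=
      Complex.continuous_ofReal.comp continuous_subtype_val
    have h1 : Continuous fun c : ℂ => c • (T - 1) := continuous_id.smul continuous_const
    exact continuous_const.add (h1.comp h0)
  have h2 : Continuous fun m : Mat2 𝓜(ℂ, Q) => hpi • m := continuous_const_smul _
  refine NormedSpace.exp_continuous.comp (h2.comp ?_)
  exact mk2_cont _ _ _ _ continuous_const h h.star.neg continuous_const

lemma Ut_zero (T : 𝓜(ℂ, Q)) : Ut T 0 = hmat 1 := by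
  have : Tt T 0 = 1 := by simp [Tt]
  rw [Ut, this]
  exact exp_J _ J_sq

lemma Ut_one (T : 𝓜(ℂ, Q)) : Ut T 1 = NormedSpace.exp (hpi • hmat T) := by
  have : Tt T 1 = T := by simp [Tt]
  rw [Ut, this]

lemma Ut_map (T : 𝓜(ℂ, Q)) (g : 𝓜(ℂ, Q) →⋆ₐ[ℂ] 𝓜(ℂ, B)) (hg : g T = 1) (t : unitInterval) :
    map2 g (Ut T t) = hmat 1 := by
  have h1 : g (Tt T t) = 1 := by
    rw [Tt, map_add, map_one, map_smul, map_sub, hg, map_one, sub_self, smul_zero, add_zero]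
  rw [Ut, exp_hom, map_smul, hmat, map2_mk2, map_neg, map_star, h1, map_zero]
  exact exp_J _ J_sq

/-- projection -/
def ee : Mat2 𝓜(ℂ, Q) := mk2 1 0 0 0

def DD (P : QPresentation B Q) : B →⋆ₙₐ[ℂ] Mat2 𝓜(ℂ, Q) := dg ((kap Q).comp P.ι) ((kap Q).comp P.ιbar)

lemma DD_apply (P : QPresentation B Q) (b : B) : DD P b = mk2 (kap Q (P.ι b)) 0 0 (kap Q (P.ιbar b)) := rfl

lemma ee_DD (P : QPresentation B Q) (b : B) : ee * DD P b = mk2 (kap Q (P.ι b)) 0 0 0 := by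
  rw [ee, DD_apply, mk2_mul]; simp

lemma ee_comm (P : QPresentation B Q) (b : B) : ee * DD P b = DD P b * ee := by
  rw [ee, DD_apply, mk2_mul, mk2_mul]; simp

lemma ee_DD' (P : QPresentation B Q) (b : B) : (1 - ee) * DD P b = mk2 0 0 0 (kap Q (P.ιbar b)) := by
  rw [sub_mul, one_mul, ee_DD, DD_apply, mk2_sub]; simp

lemma exists_Psi (P : QPresentation B Q) (T : 𝓜(ℂ, Q)) (t : unitInterval) :
    ∃ Ψ : Q →⋆ₙₐ[ℂ] Mat2 𝓜(ℂ, Q), (∀ b, Ψ (P.ι b) = ee * DD P b) ∧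
      ∀ b, Ψ (P.ιbar b) = Ut T t * ((1 - ee) * DD P b) * star (Ut T t) := by
  have hV := (unitary_exp _ (hmat_star (Tt T t))).1
  obtain ⟨F, hF⟩ := exists_conj (Ut T t) hV (dg (0 : B →⋆ₙₐ[ℂ] 𝓜(ℂ, Q)) ((kap Q).comp P.ιbar))
  obtain ⟨Ψ, h1, h2⟩ := free_ex P (dg ((kap Q).comp P.ι) (0 : B →⋆ₙₐ[ℂ] 𝓜(ℂ, Q))) F
  refine ⟨Ψ, fun b => ?_, fun b => ?_⟩
  · rw [h1, ee_DD]; rfl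
  · rw [h2, hF, ee_DD']; rfl

/-- entries -/
def Ent (m : Mat2 𝓜(ℂ, Q)) : Prop := ∀ i k, m i k ∈ Set.range (kap Q)

lemma Ent_closed : IsClosed {m : Mat2 𝓜(ℂ, Q) | Ent m} := by
  have hc : IsClosed (Set.range (kap Q)) := (kap_isom (X := Q)).isClosedEmbedding.isClosed_range
  have : {m : Mat2 𝓜(ℂ, Q) | Ent m} = ⋂ i, ⋂ k, {m | m i k ∈ Set.range (kap Q)} := by
    ext m; simp [Ent]
  rw [this]
  exact isClosed_iInter fun i => isClosed_iInter fun k => hc.preimage (ent_cont i k)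

lemma Ent_left (m : Mat2 𝓜(ℂ, Q)) {n} (hn : Ent n) : Ent (m * n) := by
  intro i k
  obtain ⟨y0, h0⟩ := hn 0 k
  obtain ⟨y1, h1⟩ := hn 1 k
  refine ⟨(m i 0).fst y0 + (m i 1).fst y1, ?_⟩
  rw [CStarMatrix.mul_apply, Fin.sum_univ_two, ← h0, ← h1, mul_kap, mul_kap, map_add (kap Q)]

lemma Ent_right (m : Mat2 𝓜(ℂ, Q)) {n} (hn : Ent n) : Ent (n * m) := by
  intro i k
  obtain ⟨y0, h0⟩ := hn i 0
  obtain ⟨y1, h1⟩ := hn i 1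
  refine ⟨(m 0 k).snd y0 + (m 1 k).snd y1, ?_⟩
  rw [CStarMatrix.mul_apply, Fin.sum_univ_two, ← h0, ← h1, kap_mul, kap_mul, map_add (kap Q)]

lemma Ent_add {m n : Mat2 𝓜(ℂ, Q)} (hm : Ent m) (hn : Ent n) : Ent (m + n) := by
  intro i k
  obtain ⟨y0, h0⟩ := hm i k
  obtain ⟨y1, h1⟩ := hn i k
  exact ⟨y0 + y1, by rw [map_add (kap Q), h0, h1]; rfl⟩

lemma Ent_smul (c : ℂ) {m : Mat2 𝓜(ℂ, Q)} (hm : Ent m) : Ent (c • m) := by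
  intro i k
  obtain ⟨y0, h0⟩ := hm i k
  exact ⟨c • y0, by rw [map_smul (kap Q), h0]; rfl⟩

lemma Ent_star {m : Mat2 𝓜(ℂ, Q)} (hm : Ent m) : Ent (star m) := by
  intro i k
  obtain ⟨y0, h0⟩ := hm k i
  exact ⟨star y0, by rw [map_star (kap Q), h0, CStarMatrix.star_apply]⟩

lemma Ent_DD (P : QPresentation B Q) (b : B) : Ent (DD P b) := by
  intro i k
  rw [DD_apply]
  fin_cases i <;> fin_cases k
  · exact ⟨_, rfl⟩
  · exact ⟨0, map_zero _⟩
  · exact ⟨0, map_zero _⟩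
  · exact ⟨_, rfl⟩

lemma Ent_Psi (P : QPresentation B Q) (T : 𝓜(ℂ, Q)) (t : unitInterval) (Ψ : Q →⋆ₙₐ[ℂ] Mat2 𝓜(ℂ, Q))
    (h1 : ∀ b, Ψ (P.ι b) = ee * DD P b)
    (h2 : ∀ b, Ψ (P.ιbar b) = Ut T t * ((1 - ee) * DD P b) * star (Ut T t)) (y : Q) : Ent (Ψ y) := by
  refine gen_induct P (fun y => Ent (Ψ y)) (Ent_closed.preimage (hom_cont Ψ)) ?_ ?_ ?_ ?_ ?_ ?_ y
  · intro b; rw [h1]; exact Ent_left _ (Ent_DD P b)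
  · intro b; rw [h2]; exact Ent_right _ (Ent_left _ (Ent_left _ (Ent_DD P b)))
  · intro x y hx hy; rw [map_add]; exact Ent_add hx hy
  · intro x y hx hy; rw [map_mul]; exact Ent_left _ hy
  · intro c x hx; rw [map_smul]; exact Ent_smul c hx
  · intro x hx; rw [map_star]; exact Ent_star hx

lemma Psi_cont (P : QPresentation B Q) (T : 𝓜(ℂ, Q)) (Ψ : unitInterval → (Q →⋆ₙₐ[ℂ] Mat2 𝓜(ℂ, Q)))
    (h1 : ∀ t b, Ψ t (P.ι b) = ee * DD P b)
    (h2 : ∀ t b, Ψ t (P.ιbar b) = Ut T t * ((1 - ee) * DD P b) * star (Ut T t)) (y : Q) :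
    Continuous fun t => Ψ t y := by
  refine gen_induct P (fun y => Continuous fun t => Ψ t y) (cont_closed Ψ) ?_ ?_ ?_ ?_ ?_ ?_ y
  · intro b; simp only [h1]; exact continuous_const
  · intro b; simp only [h2]
    exact ((Ut_cont T).mul continuous_const).mul (Ut_cont T).star
  · intro x y hx hy; simp only [map_add]; exact hx.add hy
  · intro x y hx hy; simp only [map_mul]; exact hx.mul hy
  · intro c x hx; simp only [map_smul]; exact hx.const_smul c
  · intro x hx; simp only [map_star]; exact hx.star

lemma map2_ebar (P : QPresentation B Q) (π : Q →⋆ₙₐ[ℂ] B) (h' : ∀ x, π (P.ιbar x) = x) (T : 𝓜(ℂ, Q)) (t : unitInterval)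
    (g : 𝓜(ℂ, Q) →⋆ₐ[ℂ] 𝓜(ℂ, B)) (hgk : ∀ y, g (kap Q y) = kap B (π y)) (hg : g T = 1) (b : B) :
    map2 g (Ut T t * ((1 - ee) * DD P b) * star (Ut T t)) = mk2 (kap B b) 0 0 0 := by
  rw [ee_DD', map_mul, map_mul, map_star, Ut_map T g hg, map2_mk2, hgk, h', map_zero]
  exact J_conj _

lemma map2_e (P : QPresentation B Q) (π : Q →⋆ₙₐ[ℂ] B) (h : ∀ x, π (P.ι x) = x)
    (g : 𝓜(ℂ, Q) →⋆ₐ[ℂ] 𝓜(ℂ, B)) (hgk : ∀ y, g (kap Q y) = kap B (π y)) (b : B) :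
    map2 g (ee * DD P b) = mk2 (kap B b) 0 0 0 := by
  rw [ee_DD, map2_mk2, hgk, h, map_zero]

lemma ent_q (π : Q →⋆ₙₐ[ℂ] B) (j : q →⋆ₙₐ[ℂ] Q) (hr : Set.range j = {z | π z = 0})
    (g : 𝓜(ℂ, Q) →⋆ₐ[ℂ] 𝓜(ℂ, B)) (hgk : ∀ y, g (kap Q y) = kap B (π y))
    (m : Mat2 𝓜(ℂ, Q)) (hm : Ent m) (h0 : map2 g m = 0) (i k : Fin 2) : ∃ w, ((kap Q).comp j) w = m i k := by
  obtain ⟨y, hy⟩ := hm i k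
  have h1 : map2 g m i k = 0 := by rw [h0]; rfl
  rw [map2_apply, ← hy, hgk] at h1
  have h2 : π y = 0 := kap_inj (X := B) (h1.trans (map_zero (kap B)).symm)
  have : y ∈ Set.range j := by rw [hr]; exact h2
  obtain ⟨w, hw⟩ := this
  exact ⟨w, by rw [← hy, ← hw]; rfl⟩

end univ
end S6
end

noncomputable section
open scoped MultiplierAlgebra
open Filter Topology
namespace S6

section univ2
variable {A B E Q q QE qE : Type}
    [NonUnitalCStarAlgebra A] [NonUnitalCStarAlgebra B] [NonUnitalCStarAlgebra E]
    [NonUnitalCStarAlgebra Q] [NonUnitalCStarAlgebra q] [NonUnitalCStarAlgebra QE] [NonUnitalCStarAlgebra qE]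

lemma kap_tendsto {X : Type} [NonUnitalCStarAlgebra X] {f : ℕ → X} {x : X} (h : Tendsto f atTop (𝓝 x)) :
    Tendsto (fun n => kap X (f n)) atTop (𝓝 (kap X x)) :=
  (hom_cont (kap X)).continuousAt.tendsto.comp h

section
variable [PartialOrder 𝓜(ℂ, Q)] [StarOrderedRing 𝓜(ℂ, Q)] [PartialOrder 𝓜(ℂ, B)] [StarOrderedRing 𝓜(ℂ, B)]

lemma hhR_aux (P : QPresentation B Q) (u : ℕ → B) (T : 𝓜(ℂ, Q))
    (hT1 : ∀ y, Tendsto (fun n => P.ι (u n) * T.fst y) atTop (𝓝 (T.fst y)))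
    (hT2 : ∀ y, Tendsto (fun n => P.ιbar (u n) * (star T).fst y) atTop (𝓝 ((star T).fst y))) (b : B) :
    Tendsto (fun n => DD P (u n) * ((hpi • hmat T) * DD P b)) atTop (𝓝 ((hpi • hmat T) * DD P b)) := by
  have e1 : hmat T * DD P b = mk2 0 (kap Q (T.fst (P.ιbar b))) (-(kap Q ((star T).fst (P.ι b)))) 0 := by
    rw [hmat, DD_apply, mk2_mul, ← mul_kap, ← mul_kap]; simp
  have e2 : ∀ n, DD P (u n) * (hmat T * DD P b) =
      mk2 0 (kap Q (P.ι (u n) * T.fst (P.ιbar b))) (-(kap Q (P.ιbar (u n) * (star T).fst (P.ι b)))) 0 := by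
    intro n
    rw [e1, DD_apply, mk2_mul, map_mul (kap Q), map_mul (kap Q)]; simp
  rw [smul_mul_assoc]
  simp only [mul_smul_comm, e2]
  rw [e1]
  exact (mk2_tendsto tendsto_const_nhds (kap_tendsto (hT1 _)) (kap_tendsto (hT2 _)).neg tendsto_const_nhds).const_smul _

lemma hk_aux (P : QPresentation B Q) (π : Q →⋆ₙₐ[ℂ] B) (u : ℕ → B) (hus : ∀ n, star (u n) = u n) (T : 𝓜(ℂ, Q))
    (g : 𝓜(ℂ, Q) →⋆ₐ[ℂ] 𝓜(ℂ, B)) (hgk : ∀ y, g (kap Q y) = kap B (π y)) (z : 𝓜(ℂ, B)) (κ κ' : Q)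
    (hk : KapOK P.ι P.ιbar π u T z κ) (hk' : KapOK P.ιbar P.ι π u (star T) z κ') :
    ∃ K : Mat2 𝓜(ℂ, Q), map2 g K = 0 ∧ Tendsto (fun n => DD P (u n) * K) atTop (𝓝 K) ∧
      Tendsto (fun n => DD P (u n) * star K) atTop (𝓝 (star K)) ∧
      ∀ c b, DD P c * (hpi • hmat T) * DD P (z.fst b) - DD P (z.snd c) * (hpi • hmat T) * DD P b
        = DD P c * K * DD P b := by
  refine ⟨hpi • mk2 0 (kap Q κ) (-(kap Q κ')) 0, ?_, ?_, ?_, ?_⟩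
  · rw [map_smul, map2_mk2, map_neg, hgk, hgk, hk.pi0, hk'.pi0, map_zero, map_zero, neg_zero, ← mk2_zero, smul_zero]
  · have e : ∀ n, DD P (u n) * mk2 0 (kap Q κ) (-(kap Q κ')) 0 =
        mk2 0 (kap Q (P.ι (u n) * κ)) (-(kap Q (P.ιbar (u n) * κ'))) 0 := by
      intro n
      rw [DD_apply, mk2_mul, map_mul (kap Q), map_mul (kap Q)]; simp
    simp only [mul_smul_comm, e]
    exact (mk2_tendsto tendsto_const_nhds (kap_tendsto hk.left) (kap_tendsto hk'.left).neg tendsto_const_nhds).const_smul _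
  · have e0 : star (mk2 0 (kap Q κ) (-(kap Q κ')) 0) = mk2 0 (-(kap Q (star κ'))) (kap Q (star κ)) 0 := by
      rw [mk2_star, star_neg, map_star (kap Q), map_star (kap Q)]; simp
    have e : ∀ n, DD P (u n) * mk2 0 (-(kap Q (star κ'))) (kap Q (star κ)) 0 =
        mk2 0 (-(kap Q (star (κ' * P.ι (u n))))) (kap Q (star (κ * P.ιbar (u n)))) 0 := by
      intro n
      rw [star_mul, star_mul, ← map_star P.ι, ← map_star P.ιbar, hus, DD_apply, mk2_mul, map_mul (kap Q), map_mul (kap Q)]; simp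
    rw [star_smul, e0]
    simp only [mul_smul_comm, e]
    exact (mk2_tendsto tendsto_const_nhds (kap_tendsto hk'.right.star).neg (kap_tendsto hk.right.star) tendsto_const_nhds).const_smul _
  · intro c b
    have e : ∀ c b, DD P c * hmat T * DD P b =
        mk2 0 (kap Q (P.ι c * T.fst (P.ιbar b))) (-(kap Q (P.ιbar c * (star T).fst (P.ι b)))) 0 := by
      intro c b
      rw [DD_apply, DD_apply, hmat, mk2_mul, mk2_mul, map_mul (kap Q), map_mul (kap Q), ← mul_kap, ← mul_kap]
      simp [mul_assoc]
    simp only [mul_smul_comm, smul_mul_assoc, e]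
    rw [← smul_sub, mk2_sub, DD_apply, DD_apply, mk2_mul, mk2_mul]
    congr 1
    have h1 := congrArg (kap Q) (hk.eq c b)
    have h2 := congrArg (kap Q) (hk'.eq c b)
    rw [map_sub (kap Q), map_mul (kap Q) (_ * _), map_mul (kap Q) _ κ] at h1
    rw [map_sub (kap Q), map_mul (kap Q) (_ * _), map_mul (kap Q) _ κ'] at h2
    rw [h1, neg_sub_neg, ← neg_sub (kap Q (P.ιbar c * _)), h2]
    simp

theorem univ_aux (P : QPresentation B Q) (π : Q →⋆ₙₐ[ℂ] B) (h1 : ∀ x, π (P.ι x) = x) (h2 : ∀ x, π (P.ιbar x) = x)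
    (j : q →⋆ₙₐ[ℂ] Q) (hj : Function.Injective j) (hr : Set.range j = {z : Q | π z = 0})
    (b : ℕ → B)
    (hb : ∀ y : B, y ∈ closure ((Submodule.span ℂ {y : B | ∃ k c, y = b k * c} : Submodule ℂ B) : Set B))
    (s : A →⋆ₙₐ[ℂ] 𝓜(ℂ, B)) (a : ℕ → A) (ha : DenseRange a)
    (μ : E →⋆ₙₐ[ℂ] 𝓜(ℂ, B)) (p : E →⋆ₙₐ[ℂ] A) (hdiff : ∀ x, ∃ b, μ x - s (p x) = kap B b)
    (jB : B →⋆ₙₐ[ℂ] E) (hμ : ∀ b, μ (jB b) = kap B b) (hp : ∀ b, p (jB b) = 0)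
    (PE : QPresentation E QE) (πE : QE →⋆ₙₐ[ℂ] E)
    (hπ : ∀ x, πE (PE.ι x) = x) (hπ' : ∀ x, πE (PE.ιbar x) = x)
    (QjE : Q →⋆ₙₐ[ℂ] QE) (hQ : ∀ b, QjE (P.ι b) = PE.ι (jB b)) (hQ' : ∀ b, QjE (P.ιbar b) = PE.ιbar (jB b))
    (jqE : qE →⋆ₙₐ[ℂ] QE) (hq : ∀ w, πE (jqE w) = 0)
    (qjE : q →⋆ₙₐ[ℂ] qE) (hqj : ∀ z, jqE (qjE z) = QjE (j z)) :
    ∃ f' : qE →⋆ₙₐ[ℂ] Matrix (Fin 2) (Fin 2) q, ∃ H : unitInterval → (q →⋆ₙₐ[ℂ] Matrix (Fin 2) (Fin 2) q),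
      (∀ x, Continuous fun t => H t x) ∧ H 0 = cornerHom q ∧ H 1 = f'.comp qjE := by
  obtain ⟨u, T, hu, hus, hub, hTπ, hT1, hT2, hκ⟩ := exists_T (i1 := P.ι) (i2 := P.ιbar) π h1 h2 j hr b
    (fun k => s (a k)) hb (gen_span P)
  obtain ⟨g, hgk, hgT⟩ := exists_pt P π h1 T hTπ
  choose Ψ hΨ hΨ' using exists_Psi P T
  have hgi : Function.Injective ((kap Q).comp j) := (kap_inj (X := Q)).comp hj
  have hφΨ : ∀ t y, map2 g (Ψ t y) = mk2 (kap B (π y)) 0 0 0 := by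
    intro t y
    have := free_uniq P (((map2 g : Mat2 𝓜(ℂ, Q) →⋆ₐ[ℂ] Mat2 𝓜(ℂ, B)) : Mat2 𝓜(ℂ, Q) →⋆ₙₐ[ℂ] Mat2 𝓜(ℂ, B)).comp (Ψ t))
      (dg ((kap B).comp π) 0) ?_ ?_
    · exact congrArg (fun f : Q →⋆ₙₐ[ℂ] Mat2 𝓜(ℂ, B) => f y) this
    · intro b
      change map2 g (Ψ t (P.ι b)) = mk2 (kap B (π (P.ι b))) 0 0 0
      rw [hΨ, map2_e P π h1 g hgk, h1]
    · intro b
      change map2 g (Ψ t (P.ιbar b)) = mk2 (kap B (π (P.ιbar b))) 0 0 0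
      rw [hΨ', map2_ebar P π h2 T t g hgk hgT, h2]
  have hj0 : ∀ w, π (j w) = 0 := by
    intro w
    have : j w ∈ {z : Q | π z = 0} := by rw [← hr]; exact ⟨w, rfl⟩
    exact this
  have hL : ∀ t, ∃ f' : q →⋆ₙₐ[ℂ] Matrix (Fin 2) (Fin 2) q, ∀ x i k, ((kap Q).comp j) (f' x i k) = Ψ t (j x) i k := by
    intro t
    refine mat_lift ((Ψ t).comp j) ((kap Q).comp j) hgi fun x i k => ?_
    refine ent_q π j hr g hgk _ (Ent_Psi P T t (Ψ t) (hΨ t) (hΨ' t) (j x)) ?_ i k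
    rw [hφΨ, hj0, map_zero (kap B), mk2_zero]
  choose H hH using hL
  obtain ⟨f, hf1, hf2, hf3⟩ := core (DD P) u hu hub ee (by rw [ee, mk2_mul]; simp) (by rw [ee, mk2_star]; simp) (ee_comm P)
    (hpi • hmat T) (hmat_star T) (hhR_aux P u T hT1 hT2)
    ((map2 g : Mat2 𝓜(ℂ, Q) →⋆ₐ[ℂ] Mat2 𝓜(ℂ, B)) : Mat2 𝓜(ℂ, Q) →⋆ₙₐ[ℂ] Mat2 𝓜(ℂ, B))
    (by
      intro b
      change map2 g _ = map2 g _
      rw [← Ut_one, map2_e P π h1 g hgk, map2_ebar P π h2 T 1 g hgk hgT])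
    s a ha
    (by
      intro k
      obtain ⟨⟨κ, hk⟩, κ', hk'⟩ := hκ k
      exact hk_aux P π u hus T g hgk _ κ κ' hk hk')
    μ p hdiff jB hμ hp P PE πE hπ hπ' QjE hQ hQ' jqE hq (Ψ 1) (hΨ 1)
    (by intro b; rw [← Ut_one]; exact hΨ' 1 b)
  have hfE : ∀ w, Ent (f w) := by
    intro w
    exact Ent_closed.mem_of_tendsto (hf2 w).1 (Eventually.of_forall fun n => Ent_right _ (Ent_DD P (u n)))
  obtain ⟨f', hf'⟩ := mat_lift f ((kap Q).comp j) hgi fun x i k => ent_q π j hr g hgk _ (hfE x) (hf1 x) i k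
  refine ⟨f', H, ?_, ?_, ?_⟩
  · intro x
    refine continuous_matrix fun i k => ?_
    have hiso : Isometry ((kap Q).comp j) := NonUnitalStarAlgHom.isometry _ hgi
    rw [hiso.isEmbedding.continuous_iff]
    have : (((kap Q).comp j) ∘ fun t => H t x i k) = fun t => Ψ t (j x) i k := by
      ext1 t
      exact hH t x i k
    rw [this]
    exact (ent_cont i k).comp (Psi_cont P T Ψ hΨ hΨ' (j x))
  · have hΨ0 : Ψ 0 = dg (kap Q) 0 := by
      apply free_uniq P
      · intro b; rw [hΨ, ee_DD]; rfl
      · intro b; rw [hΨ', ee_DD', Ut_zero, J_conj]; rfl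
    ext x i k
    apply hgi
    rw [hH, hΨ0, dg_apply]
    fin_cases i <;> fin_cases k
    · rfl
    · exact (map_zero ((kap Q).comp j)).symm
    · exact (map_zero ((kap Q).comp j)).symm
    · exact (map_zero ((kap Q).comp j)).symm
  · ext x i k
    apply hgi
    rw [hH]
    change _ = ((kap Q).comp j) (f' (qjE x) i k)
    rw [hf', hf3 _ _ (hqj x)]
end
end univ2
end S6
end

noncomputable section
open scoped MultiplierAlgebra
open Filter Topology
namespace S6

section sep
variable {A Q q : Type} [NonUnitalCStarAlgebra A] [NonUnitalCStarAlgebra Q] [NonUnitalCStarAlgebra q]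

/-- stages -/
def stg (S : Set Q) : ℕ → Set Q
  | 0 => S
  | n + 1 => stg S n ∪ ((fun x : Q × Q => x.1 + x.2) '' (stg S n ×ˢ stg S n)) ∪
      ((fun x : Q × Q => x.1 * x.2) '' (stg S n ×ˢ stg S n)) ∪
      ((fun x : ℂ × Q => x.1 • x.2) '' (Set.univ ×ˢ stg S n)) ∪ (star '' (stg S n))

lemma stg_mono (S : Set Q) : Monotone (stg S) :=
  monotone_nat_of_le_succ fun n x hx => Or.inl (Or.inl (Or.inl (Or.inl hx)))

lemma stg_sep (S : Set Q) (hS : TopologicalSpace.IsSeparable S) (n : ℕ) : TopologicalSpace.IsSeparable (stg S n) := by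
  induction n with
  | zero => exact hS
  | succ n ih =>
    refine (((ih.union ?_).union ?_).union ?_).union ?_
    · exact (ih.prod ih).image continuous_add
    · exact (ih.prod ih).image continuous_mul
    · exact ((TopologicalSpace.IsSeparable.of_separableSpace _).prod ih).image continuous_smul
    · exact ih.image continuous_star

lemma sep_Q (P : QPresentation A Q) [TopologicalSpace.SeparableSpace A] : TopologicalSpace.SeparableSpace Q := by
  have hS : TopologicalSpace.IsSeparable (Set.range P.ι ∪ Set.range P.ιbar) :=
    (TopologicalSpace.isSeparable_range (hom_cont P.ι)).union (TopologicalSpace.isSeparable_range (hom_cont P.ιbar))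
  set S := Set.range P.ι ∪ Set.range P.ιbar with hSd
  set W := ⋃ n, stg S n with hW
  have hWs : TopologicalSpace.IsSeparable W := TopologicalSpace.IsSeparable.iUnion (stg_sep S hS)
  have h2 : ∀ x y, x ∈ W → y ∈ W → ∃ n, x ∈ stg S n ∧ y ∈ stg S n := by
    intro x y hx hy
    obtain ⟨n, hn⟩ := Set.mem_iUnion.mp hx
    obtain ⟨m, hm⟩ := Set.mem_iUnion.mp hy
    exact ⟨max n m, stg_mono S (le_max_left _ _) hn, stg_mono S (le_max_right _ _) hm⟩
  have hall : ∀ z, z ∈ closure W := by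
    refine gen_induct P (fun z => z ∈ closure W) isClosed_closure ?_ ?_ ?_ ?_ ?_ ?_
    · intro a; exact subset_closure (Set.mem_iUnion.mpr ⟨0, Or.inl ⟨a, rfl⟩⟩)
    · intro a; exact subset_closure (Set.mem_iUnion.mpr ⟨0, Or.inr ⟨a, rfl⟩⟩)
    · intro x y hx hy
      refine map_mem_closure₂ continuous_add hx hy fun x hx y hy => ?_
      obtain ⟨n, h, h'⟩ := h2 x y hx hy
      exact Set.mem_iUnion.mpr ⟨n + 1, Or.inl (Or.inl (Or.inl (Or.inr ⟨(x, y), ⟨h, h'⟩, rfl⟩)))⟩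
    · intro x y hx hy
      refine map_mem_closure₂ continuous_mul hx hy fun x hx y hy => ?_
      obtain ⟨n, h, h'⟩ := h2 x y hx hy
      exact Set.mem_iUnion.mpr ⟨n + 1, Or.inl (Or.inl (Or.inr ⟨(x, y), ⟨h, h'⟩, rfl⟩))⟩
    · intro c x hx
      refine map_mem_closure (continuous_const_smul c) hx fun x hx => ?_
      obtain ⟨n, h⟩ := Set.mem_iUnion.mp hx
      exact Set.mem_iUnion.mpr ⟨n + 1, Or.inl (Or.inr ⟨(c, x), ⟨trivial, h⟩, rfl⟩)⟩
    · intro x hx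
      refine map_mem_closure continuous_star hx fun x hx => ?_
      obtain ⟨n, h⟩ := Set.mem_iUnion.mp hx
      exact Set.mem_iUnion.mpr ⟨n + 1, Or.inr ⟨x, h, rfl⟩⟩
  rw [← TopologicalSpace.isSeparable_univ_iff]
  exact hWs.closure.mono fun z _ => hall z

lemma sep_q (P : QPresentation A Q) [TopologicalSpace.SeparableSpace A] (j : q →⋆ₙₐ[ℂ] Q) (hj : Function.Injective j) :
    TopologicalSpace.SeparableSpace q := by
  have := sep_Q P
  have hi : Isometry j := NonUnitalStarAlgHom.isometry _ hj
  have := UniformSpace.secondCountable_of_separable Q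
  have := hi.isEmbedding.isInducing.secondCountableTopology
  infer_instance

lemma range_closed {X Y : Type} [NonUnitalCStarAlgebra X] [NonUnitalCStarAlgebra Y] (j : X →⋆ₙₐ[ℂ] Y)
    (hj : Function.Injective j) : IsClosed (Set.range j) :=
  (NonUnitalStarAlgHom.isometry _ hj).isClosedEmbedding.isClosed_range

theorem sigma_unital {K B : Type} [NonUnitalCStarAlgebra K] [NonUnitalCStarAlgebra B]
    [TopologicalSpace.SeparableSpace q] (α : q →⋆ₙₐ[ℂ] K) (jB : B →⋆ₙₐ[ℂ] K) (hj : Function.Injective jB)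
    (hr : Set.range jB = closure ((Submodule.span ℂ
      {x : K | ∃ z w : q, ∃ b : K, x = α z * b * α w} : Submodule ℂ K) : Set K)) :
    (∀ z, ∃ u, jB u = α z) ∧ ∃ b : ℕ → B,
      ∀ y : B, y ∈ closure ((Submodule.span ℂ {y : B | ∃ k c, y = b k * c} : Submodule ℂ B) : Set B) := by
  have hcl := range_closed jB hj
  obtain ⟨l, hl, -, -, hlv, hrv⟩ := exists_au q
  have hmem : ∀ z w b, α z * b * α w ∈ Set.range jB := by
    intro z w b
    rw [hr]
    exact subset_closure (Submodule.subset_span ⟨z, w, b, rfl⟩)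
  have hlα : ∀ z, Tendsto (fun v => α v * α z) l (𝓝 (α z)) := by
    intro z
    refine ((hom_cont α).continuousAt.tendsto.comp (hlv z)).congr fun v => ?_
    exact map_mul α v z
  have hrα : ∀ z, Tendsto (fun v => α z * α v) l (𝓝 (α z)) := by
    intro z
    refine ((hom_cont α).continuousAt.tendsto.comp (hrv z)).congr fun v => ?_
    exact map_mul α z v
  have hex : ∀ z, ∃ u, jB u = α z := by
    intro z
    refine hcl.mem_of_tendsto (hrα z) (Eventually.of_forall fun w => ?_)
    refine hcl.mem_of_tendsto ((hlα z).mul_const (α w)) (Eventually.of_forall fun v => ?_)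
    exact hmem _ _ _
  refine ⟨hex, ?_⟩
  obtain ⟨α', hα'⟩ := lift_hom α jB hj hex
  refine ⟨fun k => α' (TopologicalSpace.denseSeq q k), fun y => ?_⟩
  set V := (Submodule.span ℂ {y : B | ∃ k c, y = α' (TopologicalSpace.denseSeq q k) * c}).topologicalClosure with hV
  have hVc : IsClosed (V : Set B) := Submodule.isClosed_topologicalClosure _
  change y ∈ V
  have h1 : ∀ z c, α' z * c ∈ V := by
    intro z c
    have hc : IsClosed {z | α' z * c ∈ V} := hVc.preimage ((hom_cont α').mul continuous_const)
    refine (TopologicalSpace.denseRange_denseSeq q).induction_on z hc fun k => ?_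
    exact Submodule.le_topologicalClosure _ (Submodule.subset_span ⟨k, c, rfl⟩)
  have hi : Isometry jB := NonUnitalStarAlgHom.isometry _ hj
  have hWc : IsClosed (jB '' V) := hi.isClosedEmbedding.isClosedMap _ hVc
  have hy : jB y ∈ closure ((Submodule.span ℂ
      {x : K | ∃ z w : q, ∃ b : K, x = α z * b * α w} : Submodule ℂ K) : Set K) := by
    rw [← hr]; exact ⟨y, rfl⟩
  have hsub : ((Submodule.span ℂ {x : K | ∃ z w : q, ∃ b : K, x = α z * b * α w} : Submodule ℂ K) : Set K) ⊆ jB '' V := by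
    intro x hx
    induction hx using Submodule.span_induction with
    | mem x hx =>
      obtain ⟨z, w, b, rfl⟩ := hx
      obtain ⟨y', hy'⟩ := hmem z w b
      refine hWc.mem_of_tendsto (((hlα z).mul_const b).mul_const (α w)) (Eventually.of_forall fun v => ?_)
      refine ⟨α' v * y', h1 _ _, ?_⟩
      rw [map_mul, hα', hy']
      simp only [mul_assoc]
    | zero => exact ⟨0, V.zero_mem, map_zero _⟩
    | add x y _ _ hx hy =>
      obtain ⟨x', hx', rfl⟩ := hx
      obtain ⟨y', hy', rfl⟩ := hy
      exact ⟨_, V.add_mem hx' hy', map_add _ _ _⟩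
    | smul c x _ hx =>
      obtain ⟨x', hx', rfl⟩ := hx
      exact ⟨_, V.smul_mem c hx', map_smul _ _ _⟩
  obtain ⟨y', hy', he⟩ := closure_minimal hsub hWc hy
  rwa [← hj he]
end sep
end S6
end

noncomputable section
open scoped MultiplierAlgebra
open Filter Topology
namespace S6

theorem ext_diff {A QA qA K B E : Type} [NonUnitalCStarAlgebra A] [NonUnitalCStarAlgebra QA] [NonUnitalCStarAlgebra qA]
    [NonUnitalCStarAlgebra K] [NonUnitalCStarAlgebra B] [NonUnitalCStarAlgebra E]
    (P : QPresentation A QA) (π : QA →⋆ₙₐ[ℂ] A)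
    (h1 : ∀ x, π (P.ι x) = x) (h2 : ∀ x, π (P.ιbar x) = x) (j : qA →⋆ₙₐ[ℂ] QA)
    (hr : Set.range j = {z : QA | π z = 0}) (α : qA →⋆ₙₐ[ℂ] K) (ED : EalphaData A QA qA P j K α B E)
    (hα : ∀ z, ∃ u, ED.jB₀ u = α z) (x : E) :
    ∃ b, (ED.jE x).1 - ED.αext (P.ι (ED.jE x).2) = kap B b := by
  let s : A →⋆ₙₐ[ℂ] 𝓜(ℂ, B) := ED.αext.comp P.ι
  have hs : ∀ a, s a = ED.αext (P.ι a) := fun _ => rfl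
  have hc : IsClosed (Set.range (kap B)) := (kap_isom (X := B)).isClosedEmbedding.isClosed_range
  let S : NonUnitalStarSubalgebra ℂ (𝓜(ℂ, B) × A) :=
    { carrier := {e | ∃ b, kap B b = e.1 - s e.2}
      add_mem' := by
        rintro x y ⟨b, hb⟩ ⟨c, hc⟩
        refine ⟨b + c, ?_⟩
        rw [map_add (kap B), hb, hc, Prod.fst_add, Prod.snd_add, map_add s]
        abel
      zero_mem' := by
        refine ⟨0, ?_⟩
        change kap B 0 = 0 - s 0
        rw [map_zero (kap B), map_zero s, sub_zero]
      mul_mem' := by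
        rintro x y ⟨b, hb⟩ ⟨c, hc⟩
        refine ⟨x.1.fst c + (s y.2).snd b, ?_⟩
        rw [map_add (kap B), ← mul_kap, ← kap_mul, hb, hc, Prod.fst_mul, Prod.snd_mul, map_mul s]
        noncomm_ring
      smul_mem' := by
        rintro r x ⟨b, hb⟩
        refine ⟨r • b, ?_⟩
        rw [map_smul (kap B), hb, Prod.smul_fst, Prod.smul_snd, map_smul s, smul_sub]
      star_mem' := by
        rintro x ⟨b, hb⟩
        refine ⟨star b, ?_⟩
        rw [map_star (kap B), hb, Prod.fst_star, Prod.snd_star, map_star s, star_sub] }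
  have hSc : IsClosed (S : Set (𝓜(ℂ, B) × A)) :=
    hc.preimage (continuous_fst.sub ((hom_cont s).comp continuous_snd))
  have hmem : ED.jE x ∈ Set.range ED.jE := ⟨x, rfl⟩
  rw [ED.hjEr] at hmem
  have hle : (NonUnitalStarAlgebra.adjoin ℂ
      ({p : 𝓜(ℂ, B) × A | ∃ b : B, p = ((b : 𝓜(ℂ, B)), 0)} ∪
       {p : 𝓜(ℂ, B) × A | ∃ x : A, p = (ED.αext (P.ι x), x)} ∪
       {p : 𝓜(ℂ, B) × A | ∃ x : A, p = (ED.αext (P.ιbar x), x)})).topologicalClosure ≤ S := by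
    refine NonUnitalStarSubalgebra.topologicalClosure_minimal _ (NonUnitalStarAlgebra.adjoin_le ?_) hSc
    rintro e ((⟨b, rfl⟩ | ⟨a, rfl⟩) | ⟨a, rfl⟩)
    · refine ⟨b, ?_⟩
      change _ = _ - s 0
      rw [map_zero, sub_zero]; rfl
    · refine ⟨0, ?_⟩
      change _ = ED.αext (P.ι a) - s a
      rw [hs, sub_self, map_zero (kap B)]
    · have : P.ιbar a - P.ι a ∈ Set.range j := by
        rw [hr]
        change π _ = 0
        rw [map_sub, h1, h2, sub_self]
      obtain ⟨z, hz⟩ := this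
      obtain ⟨u, hu⟩ := hα z
      refine ⟨u, ?_⟩
      change _ = ED.αext (P.ιbar a) - s a
      rw [hs, ← map_sub, ← hz, ED.hαext z u hu]; rfl
  obtain ⟨b, hb⟩ := hle hmem
  exact ⟨b, hb.symm⟩

lemma corner_nat {X Y : Type} [NonUnitalCStarAlgebra X] [NonUnitalCStarAlgebra Y] (β : X →⋆ₙₐ[ℂ] Y) :
    (matMap₂ β).comp (cornerHom X) = (cornerHom Y).comp β := by
  ext x i k
  change β (if i = 0 ∧ k = 0 then x else 0) = if i = 0 ∧ k = 0 then β x else 0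
  split_ifs <;> simp
end S6

end

theorem statement6
    (A QA qA : Type)
    [NonUnitalCStarAlgebra A] [NonUnitalCStarAlgebra QA] [NonUnitalCStarAlgebra qA]
    [TopologicalSpace.SeparableSpace A]
    -- `QA = A ⋆ A`, `qA = ker π₁`
    (P₁ : QPresentation A QA) (π₁ : QA →⋆ₙₐ[ℂ] A)
    (hπ₁ : ∀ x, π₁ (P₁.ι x) = x) (hπ₁' : ∀ x, π₁ (P₁.ιbar x) = x)
    (j₁ : qA →⋆ₙₐ[ℂ] QA) (hj₁ : Function.Injective j₁)
    (hr₁ : Set.range j₁ = {z : QA | π₁ z = 0})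
    -- stabilizations `KB = K ⊗ B`, `KC = K ⊗ C`
    (B KB C KC : Type) [NonUnitalCStarAlgebra B] [NonUnitalCStarAlgebra KB]
    [NonUnitalCStarAlgebra C] [NonUnitalCStarAlgebra KC]
    (StB : Stabilization B KB) (StC : Stabilization C KC)
    -- `α : qA → K ⊗ B` and its associated extension `0 → B₀ → E_α → A → 0`
    (α : qA →⋆ₙₐ[ℂ] KB)
    (B₀T EαT : Type) [NonUnitalCStarAlgebra B₀T] [NonUnitalCStarAlgebra EαT]
    (ED : EalphaData A QA qA P₁ j₁ KB α B₀T EαT)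
    -- `QB₀ = B₀ ⋆ B₀`, `qB₀ = ker πB₀`
    (QB₀ qB₀T : Type) [NonUnitalCStarAlgebra QB₀] [NonUnitalCStarAlgebra qB₀T]
    (PB₀ : QPresentation B₀T QB₀) (πB₀ : QB₀ →⋆ₙₐ[ℂ] B₀T)
    (hπB₀ : ∀ x, πB₀ (PB₀.ι x) = x) (hπB₀' : ∀ x, πB₀ (PB₀.ιbar x) = x)
    (jqB₀ : qB₀T →⋆ₙₐ[ℂ] QB₀) (hjqB₀ : Function.Injective jqB₀)
    (hrqB₀ : Set.range jqB₀ = {z : QB₀ | πB₀ z = 0})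
    -- `QE_α = E_α ⋆ E_α`, `qE_α = ker πE`
    (QEα qEαT : Type) [NonUnitalCStarAlgebra QEα] [NonUnitalCStarAlgebra qEαT]
    (PE : QPresentation EαT QEα) (πE : QEα →⋆ₙₐ[ℂ] EαT)
    (hπE : ∀ x, πE (PE.ι x) = x) (hπE' : ∀ x, πE (PE.ιbar x) = x)
    (jqE : qEαT →⋆ₙₐ[ℂ] QEα) (hjqE : Function.Injective jqE)
    (hrqE : Set.range jqE = {z : QEα | πE z = 0})
    -- `q(j_E) : qB₀ → qE_α`, the restriction of `Q(j_E)`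
    (QjE : QB₀ →⋆ₙₐ[ℂ] QEα)
    (hQjE : QjE.comp PB₀.ι = PE.ι.comp ED.jEB)
    (hQjE' : QjE.comp PB₀.ιbar = PE.ιbar.comp ED.jEB)
    (qjE : qB₀T →⋆ₙₐ[ℂ] qEαT)
    (hqjE : ∀ z : qB₀T, jqE (qjE z) = QjE (jqB₀ z))
    -- a homomorphism `β : qB₀ → K ⊗ C`
    (β : qB₀T →⋆ₙₐ[ℂ] KC) :
    -- conclusion: there is `β' : qE_α → M₂(β(qB₀)) ⊆ M₂(K ⊗ C)` such that
    -- `β` is homotopic to `β' ∘ q(j_E)`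
    ∃ β' : qEαT →⋆ₙₐ[ℂ] Matrix (Fin 2) (Fin 2) KC,
      (∀ (w : qEαT) (i k : Fin 2), β' w i k ∈ closure (Set.range β)) ∧
      HomHomotopic ((cornerHom KC).comp β) (β'.comp qjE) := by
  have := S6.sep_q P₁ j₁ hj₁
  obtain ⟨hα, b, hb⟩ := S6.sigma_unital α ED.jB₀ ED.hjB₀inj ED.hjB₀r
  let _ := CStarAlgebra.spectralOrder 𝓜(ℂ, QB₀)
  have _ := CStarAlgebra.spectralOrderedRing 𝓜(ℂ, QB₀)
  let _ := CStarAlgebra.spectralOrder 𝓜(ℂ, B₀T)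
  have _ := CStarAlgebra.spectralOrderedRing 𝓜(ℂ, B₀T)
  obtain ⟨f', H, hH, hH0, hH1⟩ := S6.univ_aux PB₀ πB₀ hπB₀ hπB₀' jqB₀ hjqB₀ hrqB₀ b hb
    (ED.αext.comp P₁.ι) (TopologicalSpace.denseSeq A) (TopologicalSpace.denseRange_denseSeq A)
    ((NonUnitalStarAlgHom.fst ℂ 𝓜(ℂ, B₀T) A).comp ED.jE) ((NonUnitalStarAlgHom.snd ℂ 𝓜(ℂ, B₀T) A).comp ED.jE)
    (S6.ext_diff P₁ π₁ hπ₁ hπ₁' j₁ hr₁ α ED hα) ED.jEB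
    (fun b => congrArg Prod.fst (ED.hjEB b)) (fun b => congrArg Prod.snd (ED.hjEB b))
    PE πE hπE hπE' QjE (fun b => DFunLike.congr_fun hQjE b) (fun b => DFunLike.congr_fun hQjE' b) jqE
    (fun w => by
      have : jqE w ∈ {z : QEα | πE z = 0} := by rw [← hrqE]; exact ⟨w, rfl⟩
      exact this) qjE hqjE
  refine ⟨(matMap₂ β).comp f', fun w i k => subset_closure ⟨f' w i k, rfl⟩,
    fun t => (matMap₂ β).comp (H t), fun x => ?_, ?_, ?_⟩
  · refine continuous_matrix fun i k => ?_
    exact (S6.hom_cont β).comp ((hH x).matrix_elem i k)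
  · change (matMap₂ β).comp (H 0) = _
    rw [hH0, S6.corner_nat]
  · change (matMap₂ β).comp (H 1) = _
    rw [hH1]; rfl
end
end
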